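/- Let d ≥ 1, 1 < p < ∞, λ > 0, and let I_0 : ℝ^d → ℝ^d be an orthogonal projection. Let c : ℝ → ℝ^{d×d} be a Borel measurable, locally bounded map with c(t) symmetric non-negative definite for all t and satisfying ⟨c(t)ξ,ξ⟩ ≥ λ |I_0 ξ|^2 for all t ∈ ℝ, ξ ∈ ℝ^d. Then there exists a constant M_0 > 0 depending only on d, p, and the rank of I_0 such that for every u ∈ C_0^∞(ℝ^{d+1}) and all h, k in the range of I_0 with |h| = |k| = 1, one has ‖⟨D_x^2 u(·,·) h, k⟩‖_{L^p(ℝ^{d+1})} ≤ (M_0/λ) ‖∂_t u + Lu‖_{L^p(ℝ^{d+1})}, where Lu(t,x) = Σ_{i,j=1}^d c_{ij}(t) ∂_{x_i x_j}^2 u(t,x) and D_x^2 u is the Hessian of u in the space variables. -/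

import Mathlib

open MeasureTheory ENNReal

/-- Time derivative `∂ₜ u` of `u : ℝ × ℝᵈ → ℝ` (time is the first coordinate). -/
noncomputable def ptime {d : ℕ} (u : ℝ × (Fin d → ℝ) → ℝ) (z : ℝ × (Fin d → ℝ)) : ℝ :=
  deriv (fun s => u (s, z.2)) z.1

/-- Spatial partial derivative `∂_{xᵢ} u` of `u : ℝ × ℝᵈ → ℝ`. -/
noncomputable def pspace {d : ℕ} (i : Fin d) (u : ℝ × (Fin d → ℝ) → ℝ)
    (z : ℝ × (Fin d → ℝ)) : ℝ :=
  fderiv ℝ (fun y => u (z.1, y)) z.2 (Pi.single i 1)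

/-- Second spatial partial derivative `∂²_{xᵢxⱼ} u` of `u : ℝ × ℝᵈ → ℝ`. -/
noncomputable def pspace2 {d : ℕ} (i j : Fin d) (u : ℝ × (Fin d → ℝ) → ℝ) :
    ℝ × (Fin d → ℝ) → ℝ :=
  pspace i (pspace j u)

namespace ParabolicLp

open Set Filter Topology
open scoped NNReal

/-- The half-open parabolic cube with lower corner `c` and size `ρ`. -/
def pcube (c : ℝ × ℝ) (ρ : ℝ) : Set (ℝ × ℝ) :=
  Ico c.1 (c.1 + ρ ^ 2) ×ˢ Ico c.2 (c.2 + ρ)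

theorem measurableSet_pcube (c : ℝ × ℝ) (ρ : ℝ) : MeasurableSet (pcube c ρ) :=
  measurableSet_Ico.prod measurableSet_Ico

theorem volume_pcube (c : ℝ × ℝ) (ρ : ℝ) :
    volume (pcube c ρ) = ENNReal.ofReal (ρ ^ 3) := by
  rw [pcube, Measure.volume_eq_prod, Measure.prod_prod, Real.volume_Ico, Real.volume_Ico,
    ← ENNReal.ofReal_mul (by nlinarith)]
  congr 1
  ring

/-- Index of the dyadic parabolic cube of size `r` that contains `z`. -/
noncomputable def pidx (r : ℝ) (z : ℝ × ℝ) : ℤ × ℤ := (⌊z.1 / r ^ 2⌋, ⌊z.2 / r⌋)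

/-- Lower corner of the parabolic cube of size `r` with given index. -/
def pcorner (r : ℝ) (q : ℤ × ℤ) : ℝ × ℝ := (q.1 * r ^ 2, q.2 * r)

theorem mem_pcube_pcorner {r : ℝ} (hr : 0 < r) (q : ℤ × ℤ) (z : ℝ × ℝ) :
    z ∈ pcube (pcorner r q) r ↔ pidx r z = q := by
  have h2 : 0 < r ^ 2 := by positivity
  simp only [pcube, pcorner, pidx, mem_prod, mem_Ico, Prod.ext_iff, Int.floor_eq_iff,
    le_div_iff₀ h2, div_lt_iff₀ h2, le_div_iff₀ hr, div_lt_iff₀ hr, add_mul, one_mul]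

theorem pidx_double {r : ℝ} {z w : ℝ × ℝ} (h : pidx r w = pidx r z) :
    pidx (2 * r) w = pidx (2 * r) z := by
  have key : ∀ z : ℝ × ℝ, pidx (2 * r) z = ((pidx r z).1 / (4 : ℕ), (pidx r z).2 / (2 : ℕ)) := by
    intro z
    simp only [pidx, ← Int.floor_div_natCast]
    congr 2
    · rw [div_div]; congr 1; push_cast; ring
    · rw [div_div]; congr 1; push_cast; ring
  rw [key, key, h]

theorem pidx_coarser {R : ℝ} {m n : ℕ} (hmn : m ≤ n) {z w : ℝ × ℝ}
    (h : pidx (R / 2 ^ n) w = pidx (R / 2 ^ n) z) :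
    pidx (R / 2 ^ m) w = pidx (R / 2 ^ m) z := by
  induction n, hmn using Nat.le_induction with
  | base => exact h
  | succ n hn ih =>
    apply ih
    have := pidx_double h
    rwa [show 2 * (R / 2 ^ (n + 1)) = R / 2 ^ n by rw [pow_succ]; field_simp] at this

/-- Calderón–Zygmund stopping cubes at height `α` for a continuous integrable function. -/
theorem exists_stopping_cubes {f : ℝ × ℝ → ℝ} (hf : Continuous f) (hfi : Integrable f)
    {α : ℝ} (hα : 0 < α) :
    ∃ (ι : Type) (_ : Countable ι) (c : ι → ℝ × ℝ) (ρ : ι → ℝ),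
      (∀ i, 0 < ρ i) ∧ Pairwise (Function.onFun Disjoint fun i => pcube (c i) (ρ i)) ∧
      (∀ i, ENNReal.ofReal α * volume (pcube (c i) (ρ i)) ≤ ∫⁻ z in pcube (c i) (ρ i), ‖f z‖ₑ) ∧
      (∀ i, ∫⁻ z in pcube (c i) (ρ i), ‖f z‖ₑ ≤
        8 * ENNReal.ofReal α * volume (pcube (c i) (ρ i))) ∧
      ∀ z, (∀ i, z ∉ pcube (c i) (ρ i)) → |f z| ≤ α := by
  classical
  obtain ⟨R, hR0, hR⟩ : ∃ R : ℝ, 0 < R ∧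
      ∫⁻ z, ‖f z‖ₑ ≤ ENNReal.ofReal α * ENNReal.ofReal (R ^ 3) := by
    refine ⟨(∫⁻ z, ‖f z‖ₑ).toReal / α + 1, by positivity, ?_⟩
    have hfin : ∫⁻ z, ‖f z‖ₑ ≠ ⊤ := hfi.2.ne
    set I := (∫⁻ z, ‖f z‖ₑ).toReal
    rw [← ENNReal.ofReal_toReal hfin, ← ENNReal.ofReal_mul hα.le]
    apply ENNReal.ofReal_le_ofReal
    have hI : 0 ≤ I / α := by positivity
    have h1 : I = α * (I / α) := by field_simp
    have h2 : I / α ≤ (I / α + 1) ^ 3 := by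
      nlinarith [sq_nonneg (I / α), mul_nonneg hI hI, mul_nonneg hI (mul_nonneg hI hI)]
    calc I = α * (I / α) := h1
      _ ≤ _ := mul_le_mul_of_nonneg_left h2 hα.le
  set r : ℕ → ℝ := fun m => R / 2 ^ m with hr
  have hr0 : ∀ m, 0 < r m := fun m => by positivity
  set Q : ℕ → ℤ × ℤ → Set (ℝ × ℝ) := fun m q => pcube (pcorner (r m) q) (r m) with hQ
  have hmem : ∀ m q z, z ∈ Q m q ↔ pidx (r m) z = q := fun m q z => mem_pcube_pcorner (hr0 m) q z
  have hvol : ∀ m q, volume (Q m q) = ENNReal.ofReal (r m ^ 3) := fun m q =>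
    volume_pcube _ _
  set S : ℕ → ℤ × ℤ → Prop := fun m q =>
    ENNReal.ofReal α * volume (Q m q) < ∫⁻ z in Q m q, ‖f z‖ₑ with hS
  have hS0 : ∀ q, ¬ S 0 q := by
    intro q
    simp only [hS, not_lt, hvol]
    refine (setLIntegral_le_lintegral _ _).trans (hR.trans ?_)
    simp [hr]
  set ι := {x : ℕ × ℤ × ℤ // S x.1 x.2 ∧ ∃ z, pidx (r x.1) z = x.2 ∧
    ∀ m < x.1, ¬ S m (pidx (r m) z)} with hι
  refine ⟨ι, inferInstance, fun i => pcorner (r i.1.1) i.1.2, fun i => r i.1.1,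
    fun i => hr0 _, ?_, ?_, ?_, ?_⟩
  · rintro ⟨⟨m, q⟩, hs, z, hz, hm⟩ ⟨⟨n, q'⟩, hs', z', hz', hn⟩ hne
    rw [Function.onFun, Set.disjoint_left]
    intro w hw hw'
    apply hne
    have hw := (hmem m q w).1 hw
    have hw' := (hmem n q' w).1 hw'
    simp only at hs hs' hz hz' hm hn
    have hmn : m = n := by
      rcases lt_trichotomy m n with h | h | h
      · exfalso
        apply hn m h
        rw [← pidx_coarser (R := R) h.le (hw'.trans hz'.symm)]
        change S m (pidx (r m) w)
        rwa [hw]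
      · exact h
      · exfalso
        apply hm n h
        rw [← pidx_coarser (R := R) h.le (hw.trans hz.symm)]
        change S n (pidx (r n) w)
        rwa [hw']
    subst hmn
    have : q = q' := hw.symm.trans hw'
    subst this
    rfl
  · rintro ⟨⟨m, q⟩, hs, -⟩
    exact hs.le
  · rintro ⟨⟨m, q⟩, hs, z, hz, hm⟩
    rcases m with _ | m
    · exact absurd hs (hS0 _)
    have h1 := hm m (Nat.lt_succ_self m)
    simp only [hS, not_lt] at h1
    have hsub : Q (m + 1) q ⊆ Q m (pidx (r m) z) := by
      intro w hw
      rw [hmem] at hw ⊢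
      exact pidx_coarser (R := R) (Nat.le_succ m) (hw.trans hz.symm)
    refine (lintegral_mono_set hsub).trans (h1.trans ?_)
    change _ ≤ 8 * ENNReal.ofReal α * volume (Q (m + 1) q)
    rw [hvol, hvol, mul_comm 8, mul_assoc]
    gcongr
    rw [show (8 : ℝ≥0∞) = ENNReal.ofReal 8 by simp, ← ENNReal.ofReal_mul (by norm_num)]
    apply ENNReal.ofReal_le_ofReal
    simp only [hr, pow_succ]
    apply le_of_eq
    field_simp
    norm_num
  · intro z hz
    have hno : ∀ m, ¬ S m (pidx (r m) z) := by
      intro m hm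
      have hex : ∃ m, S m (pidx (r m) z) := ⟨m, hm⟩
      exact hz ⟨⟨Nat.find hex, pidx (r (Nat.find hex)) z⟩, Nat.find_spec hex, z, rfl,
        fun k hk => Nat.find_min hex hk⟩ ((hmem _ _ _).2 rfl)
    by_contra hlt
    push Not at hlt
    obtain ⟨β, hβ, hβ'⟩ := exists_between hlt
    have hopen : ∀ᶠ w in 𝓝 z, β < |f w| := hf.abs.continuousAt.eventually (lt_mem_nhds hβ')
    obtain ⟨δ, hδ, hball⟩ := Metric.eventually_nhds_iff.1 hopen
    have hr_lim : Tendsto r atTop (𝓝 0) := by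
      have := (tendsto_pow_atTop_nhds_zero_of_lt_one (r := (1/2 : ℝ)) (by norm_num)
        (by norm_num)).const_mul R
      simpa [hr, div_eq_mul_inv] using this
    obtain ⟨m, hm1, hm2⟩ : ∃ m, r m < δ ∧ r m < 1 :=
      ((hr_lim.eventually (gt_mem_nhds hδ)).and (hr_lim.eventually (gt_mem_nhds one_pos))).exists
    apply hno m
    have hz' : z ∈ Q m (pidx (r m) z) := (hmem _ _ _).2 rfl
    have hsub : ∀ w ∈ Q m (pidx (r m) z), β < |f w| := by
      intro w hw
      apply hball
      simp only [hQ, pcube, mem_prod, mem_Ico] at hw hz'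
      have hsq : r m ^ 2 < δ := by nlinarith [hr0 m]
      rw [Prod.dist_eq, max_lt_iff, Real.dist_eq, Real.dist_eq, abs_lt, abs_lt]
      refine ⟨⟨?_, ?_⟩, ?_, ?_⟩ <;>
        linarith [hw.1.1, hw.1.2, hw.2.1, hw.2.2, hz'.1.1, hz'.1.2, hz'.2.1, hz'.2.2]
    have h0 : 0 < volume (Q m (pidx (r m) z)) := by
      rw [hvol]; simp [hr0 m]
    have hfin : volume (Q m (pidx (r m) z)) ≠ ⊤ := by rw [hvol]; simp
    calc ENNReal.ofReal α * volume (Q m (pidx (r m) z))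
        < ENNReal.ofReal β * volume (Q m (pidx (r m) z)) := by
          rw [ENNReal.mul_lt_mul_iff_left h0.ne' hfin]
          exact (ENNReal.ofReal_lt_ofReal_iff (hα.trans hβ)).2 hβ
      _ = ∫⁻ w in Q m (pidx (r m) z), ENNReal.ofReal β := (setLIntegral_const _ _).symm
      _ ≤ _ := by
        apply setLIntegral_mono' (measurableSet_pcube _ _)
        intro w hw
        rw [Real.enorm_eq_ofReal_abs]
        exact ENNReal.ofReal_le_ofReal (hsub w hw).le

/-- The correlation `w ↦ ∫ K(y) f(w + y) dy`. -/
noncomputable def corr (K f : ℝ × ℝ → ℝ) (w : ℝ × ℝ) : ℝ := ∫ y, K y * f (w + y)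

/-- The open parabolic box of size `2ρ` centred at the origin. -/
def pbox (ρ : ℝ) : Set (ℝ × ℝ) :=
  Ioo (-(2 * ρ ^ 2)) (2 * ρ ^ 2) ×ˢ Ioo (-(2 * ρ)) (2 * ρ)

theorem measurableSet_pbox (ρ : ℝ) : MeasurableSet (pbox ρ) :=
  measurableSet_Ioo.prod measurableSet_Ioo

theorem volume_pbox (ρ : ℝ) :
    volume (pbox ρ) = 16 * ENNReal.ofReal (ρ ^ 3) := by
  rw [pbox, Measure.volume_eq_prod, Measure.prod_prod, Real.volume_Ioo, Real.volume_Ioo,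
    ← ENNReal.ofReal_mul (by nlinarith), show (16 : ℝ≥0∞) = ENNReal.ofReal 16 by simp,
    ← ENNReal.ofReal_mul (by norm_num)]
  congr 1
  ring

/-- Bounded integrable kernels with an `L²` bound `A` and a Hörmander bound `B`. -/
structure IsCZKernel (K : ℝ × ℝ → ℝ) (A B : ℝ≥0) : Prop where
  measurable : Measurable K
  bounded : ∃ M, ∀ z, |K z| ≤ M
  integrable : Integrable K
  l2 : ∀ f : ℝ × ℝ → ℝ, Integrable f → (∃ M, ∀ z, |f z| ≤ M) →
    ∫⁻ w, ‖corr K f w‖ₑ ^ 2 ≤ A * ∫⁻ w, ‖f w‖ₑ ^ 2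
  hormander : ∀ ρ > 0, ∀ η : ℝ × ℝ, |η.1| ≤ ρ ^ 2 → |η.2| ≤ ρ →
    ∫⁻ z in (pbox ρ)ᶜ, ‖K (z + η) - K z‖ₑ ≤ B

theorem corr_eq (K f : ℝ × ℝ → ℝ) (w : ℝ × ℝ) : corr K f w = ∫ y, K (y - w) * f y := by
  rw [corr, ← integral_sub_right_eq_self (fun y => K y * f (w + y)) w]
  simp

theorem integrable_corr_aux {K f : ℝ × ℝ → ℝ} (hK : Measurable K) (hb : ∃ M, ∀ z, |K z| ≤ M)
    (hf : Integrable f) (w : ℝ × ℝ) : Integrable fun y => K (y - w) * f y := by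
  obtain ⟨M, hM⟩ := hb
  exact hf.bdd_mul (c := M) (hK.comp (measurable_id.sub_const w)).aestronglyMeasurable
    (ae_of_all _ fun y => hM _)

theorem aestronglyMeasurable_corr {K f : ℝ × ℝ → ℝ} (hK : Measurable K)
    (hf : AEStronglyMeasurable f) : AEStronglyMeasurable (corr K f) := by
  have h1 : AEStronglyMeasurable (fun z : (ℝ × ℝ) × (ℝ × ℝ) => K (z.2 - z.1) * f z.2)
      (volume.prod volume) :=
    (hK.comp (measurable_snd.sub measurable_fst)).aestronglyMeasurable.mul hf.comp_snd
  have h2 := h1.integral_prod_right'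
  refine h2.congr (ae_of_all _ fun w => ?_)
  rw [corr_eq]

theorem corr_add {K f g : ℝ × ℝ → ℝ} (hK : Measurable K) (hb : ∃ M, ∀ z, |K z| ≤ M)
    (hf : Integrable f) (hg : Integrable g) (w : ℝ × ℝ) :
    corr K (fun z => f z + g z) w = corr K f w + corr K g w := by
  simp only [corr_eq, mul_add]
  exact integral_add (integrable_corr_aux hK hb hf w) (integrable_corr_aux hK hb hg w)

/-- Contribution of one cube to the mean-zero part. -/
theorem lintegral_cube_hormander {K : ℝ × ℝ → ℝ} {A B : ℝ≥0} (hK : IsCZKernel K A B)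
    {b : ℝ × ℝ → ℝ} (hb : Measurable b) (c : ℝ × ℝ) {ρ : ℝ} (hρ : 0 < ρ) :
    ∫⁻ w in {w | c - w ∈ pbox ρ}ᶜ,
      ∫⁻ y in pcube c ρ, ‖K (y - w) - K (c - w)‖ₑ * ‖b y‖ₑ ≤
      B * ∫⁻ y in pcube c ρ, ‖b y‖ₑ := by
  have hKm := hK.measurable
  rw [lintegral_lintegral_swap (by fun_prop), ← lintegral_const_mul _ hb.enorm]
  apply setLIntegral_mono' (measurableSet_pcube c ρ)
  intro y hy
  rw [lintegral_mul_const _ (by fun_prop)]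
  gcongr
  have hms : MeasurableSet {w | c - w ∈ pbox ρ}ᶜ :=
    ((measurableSet_pbox ρ).preimage (by fun_prop : Measurable fun w => c - w)).compl
  rw [← lintegral_indicator hms]
  calc _ = ∫⁻ w, (fun z => (pbox ρ)ᶜ.indicator (fun z => ‖K (z + (y - c)) - K z‖ₑ) z) (c - w) := by
        apply lintegral_congr
        intro w
        by_cases hw : c - w ∈ pbox ρ
        · rw [indicator_of_notMem (by simpa using hw)]
          simp [hw]
        · rw [indicator_of_mem (by simpa using hw)]
          simp only
          rw [indicator_of_mem (by simpa using hw)]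
          congr 3
          abel
    _ = ∫⁻ z in (pbox ρ)ᶜ, ‖K (z + (y - c)) - K z‖ₑ := by
        rw [lintegral_sub_left_eq_self, lintegral_indicator (measurableSet_pbox ρ).compl]
    _ ≤ B := by
        simp only [pcube, mem_prod, mem_Ico] at hy
        apply hK.hormander ρ hρ
        · rw [Prod.fst_sub, abs_le]; constructor <;> nlinarith [hy.1.1, hy.1.2, sq_nonneg ρ]
        · rw [Prod.snd_sub, abs_le]; constructor <;> linarith [hy.2.1, hy.2.2]

/-- Good and bad parts of a function with respect to a countable disjoint family of sets. -/
theorem exists_good_bad {ι : Type} [Countable ι] {f : ℝ × ℝ → ℝ} (hf : Measurable f)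
    (hfi : Integrable f) {Q : ι → Set (ℝ × ℝ)} (hQ : ∀ i, MeasurableSet (Q i))
    (hd : Pairwise (Function.onFun Disjoint Q)) (hQ0 : ∀ i, volume (Q i) ≠ 0)
    (hQt : ∀ i, volume (Q i) ≠ ⊤) :
    ∃ g b : ℝ × ℝ → ℝ, Measurable g ∧ Measurable b ∧ (∀ z, f z = g z + b z) ∧
      (∀ z, z ∉ ⋃ i, Q i → g z = f z ∧ b z = 0) ∧
      (∀ i, ∫ z in Q i, b z = 0) ∧
      (∀ i, ∀ z ∈ Q i, ‖g z‖ₑ * volume (Q i) ≤ ∫⁻ z in Q i, ‖f z‖ₑ) ∧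
      ∀ i, ∫⁻ z in Q i, ‖b z‖ₑ ≤ 2 * ∫⁻ z in Q i, ‖f z‖ₑ := by
  classical
  set a : ι → ℝ := fun i => (volume (Q i)).toReal⁻¹ * ∫ z in Q i, f z with ha
  set g : ℝ × ℝ → ℝ := fun z => if h : ∃ i, z ∈ Q i then a h.choose else f z with hg
  have hgQ : ∀ i, ∀ z ∈ Q i, g z = a i := by
    intro i z hz
    have h : ∃ i, z ∈ Q i := ⟨i, hz⟩
    have : h.choose = i := by
      by_contra hne
      exact Set.disjoint_left.1 (hd hne) h.choose_spec hz
    simp only [hg, dif_pos h, this]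
  have hgc : ∀ z, z ∉ ⋃ i, Q i → g z = f z := by
    intro z hz
    have h : ¬ ∃ i, z ∈ Q i := by simpa using hz
    simp only [hg, dif_neg h]
  have hgm : Measurable g := by
    intro s hs
    have : g ⁻¹' s = ((⋃ i, Q i)ᶜ ∩ f ⁻¹' s) ∪ ⋃ i, (Q i ∩ {_z | a i ∈ s}) := by
      ext z
      by_cases hz : z ∈ ⋃ i, Q i
      · obtain ⟨i, hi⟩ := mem_iUnion.1 hz
        have : g z = a i := hgQ i z hi
        simp only [mem_preimage, this, mem_union, mem_inter_iff, mem_compl_iff, hz, not_true,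
          false_and, false_or, mem_iUnion, mem_ofPred_eq]
        refine ⟨fun h => ⟨i, hi, h⟩, ?_⟩
        rintro ⟨j, hj, h⟩
        rwa [← hgQ i z hi, hgQ j z hj]
      · have h2 : ¬ ∃ i, z ∈ Q i := by simpa using hz
        simp only [mem_preimage, hgc z hz, mem_union, mem_inter_iff, mem_compl_iff, hz,
          not_false_eq_true, true_and, mem_iUnion, mem_ofPred_eq]
        constructor
        · exact Or.inl
        · rintro (h | ⟨i, hi, -⟩)
          · exact h
          · exact absurd ⟨i, hi⟩ h2
    rw [this]
    exact ((MeasurableSet.iUnion hQ).compl.inter (hf hs)).union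
      (MeasurableSet.iUnion fun i => (hQ i).inter (MeasurableSet.const _))
  have ha_bd : ∀ i, ‖a i‖ₑ * volume (Q i) ≤ ∫⁻ z in Q i, ‖f z‖ₑ := by
    intro i
    simp only [ha, enorm_mul]
    have h1 : ‖(volume (Q i)).toReal⁻¹‖ₑ = (volume (Q i))⁻¹ := by
      have : (volume (Q i)).toReal ≠ 0 := ENNReal.toReal_ne_zero.2 ⟨hQ0 i, hQt i⟩
      rw [enorm_inv this, Real.enorm_eq_ofReal ENNReal.toReal_nonneg,
        ENNReal.ofReal_toReal (hQt i)]
    rw [h1, mul_comm, ← mul_assoc, ENNReal.mul_inv_cancel (hQ0 i) (hQt i), one_mul]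
    exact enorm_integral_le_lintegral_enorm _
  refine ⟨g, fun z => f z - g z, hgm, hf.sub hgm, fun z => by ring,
    fun z hz => ⟨hgc z hz, by simp [hgc z hz]⟩, ?_, ?_, ?_⟩
  · intro i
    have : ∫ z in Q i, (f z - g z) = ∫ z in Q i, (f z - a i) :=
      setIntegral_congr_fun (hQ i) fun z hz => by simp only [hgQ i z hz]
    rw [this, integral_sub hfi.integrableOn (integrableOn_const (hQt i)), setIntegral_const]
    simp only [ha, smul_eq_mul, Measure.real]
    rw [mul_inv_cancel_left₀, sub_self]
    exact ENNReal.toReal_ne_zero.2 ⟨hQ0 i, hQt i⟩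
  · intro i z hz
    rw [hgQ i z hz]
    exact ha_bd i
  · intro i
    calc ∫⁻ z in Q i, ‖f z - g z‖ₑ ≤ ∫⁻ z in Q i, (‖f z‖ₑ + ‖a i‖ₑ) := by
          apply setLIntegral_mono' (hQ i)
          intro z hz
          rw [hgQ i z hz]
          exact enorm_sub_le
      _ = (∫⁻ z in Q i, ‖f z‖ₑ) + ‖a i‖ₑ * volume (Q i) := by
          rw [lintegral_add_right _ measurable_const, setLIntegral_const]
      _ ≤ _ := by rw [two_mul]; gcongr; exact ha_bd i

/-- Off the dilated cubes, the operator applied to the mean-zero part is integrable. -/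
theorem lintegral_corr_bad {K : ℝ × ℝ → ℝ} {A B : ℝ≥0} (hK : IsCZKernel K A B)
    {ι : Type} [Countable ι] {c : ι → ℝ × ℝ} {ρ : ι → ℝ} (hρ : ∀ i, 0 < ρ i)
    (hd : Pairwise (Function.onFun Disjoint fun i => pcube (c i) (ρ i)))
    {b : ℝ × ℝ → ℝ} (hb : Measurable b) (hbi : Integrable b)
    (hb0 : ∀ z, z ∉ ⋃ i, pcube (c i) (ρ i) → b z = 0)
    (hbQ : ∀ i, ∫ z in pcube (c i) (ρ i), b z = 0) :
    ∫⁻ w in (⋃ i, {w | c i - w ∈ pbox (ρ i)})ᶜ, ‖corr K b w‖ₑ ≤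
      B * ∑' i, ∫⁻ z in pcube (c i) (ρ i), ‖b z‖ₑ := by
  have hKm := hK.measurable
  have hpt : ∀ w, ‖corr K b w‖ₑ ≤
      ∑' i, ∫⁻ y in pcube (c i) (ρ i), ‖K (y - w) - K (c i - w)‖ₑ * ‖b y‖ₑ := by
    intro w
    have h_int := integrable_corr_aux hKm hK.bounded hbi w
    have h1 : corr K b w = ∑' i, ∫ y in pcube (c i) (ρ i), K (y - w) * b y := by
      rw [corr_eq, ← integral_iUnion (fun i => measurableSet_pcube _ _) hd h_int.integrableOn,
        setIntegral_eq_integral_of_forall_compl_eq_zero]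
      intro z hz
      rw [hb0 z hz, mul_zero]
    rw [h1]
    refine (enorm_tsum_le_tsum_enorm).trans (ENNReal.tsum_le_tsum fun i => ?_)
    have h2 : ∫ y in pcube (c i) (ρ i), K (y - w) * b y =
        ∫ y in pcube (c i) (ρ i), (K (y - w) - K (c i - w)) * b y := by
      simp only [sub_mul]
      rw [integral_sub h_int.integrableOn (hbi.integrableOn.const_mul _), integral_const_mul,
        hbQ, mul_zero, sub_zero]
    rw [h2]
    refine (enorm_integral_le_lintegral_enorm _).trans (le_of_eq ?_)
    simp only [enorm_mul]
  calc _ ≤ ∫⁻ w in (⋃ i, {w | c i - w ∈ pbox (ρ i)})ᶜ,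
        ∑' i, ∫⁻ y in pcube (c i) (ρ i), ‖K (y - w) - K (c i - w)‖ₑ * ‖b y‖ₑ :=
        lintegral_mono hpt
    _ = ∑' i, ∫⁻ w in (⋃ i, {w | c i - w ∈ pbox (ρ i)})ᶜ,
        ∫⁻ y in pcube (c i) (ρ i), ‖K (y - w) - K (c i - w)‖ₑ * ‖b y‖ₑ := by
        apply lintegral_tsum
        intro i
        apply Measurable.aemeasurable
        apply Measurable.lintegral_prod_right'
          (f := fun q : (ℝ × ℝ) × (ℝ × ℝ) => ‖K (q.2 - q.1) - K (c i - q.1)‖ₑ * ‖b q.2‖ₑ)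
        fun_prop
    _ ≤ ∑' i, B * ∫⁻ z in pcube (c i) (ρ i), ‖b z‖ₑ := by
        apply ENNReal.tsum_le_tsum
        intro i
        refine le_trans (lintegral_mono_set ?_) (lintegral_cube_hormander hK hb (c i) (hρ i))
        exact compl_subset_compl.2 (subset_iUnion (fun i => {w | c i - w ∈ pbox (ρ i)}) i)
    _ = _ := ENNReal.tsum_mul_left

/-- Weak-type estimate at height `α`, in the form used for interpolation. -/
theorem weak_type {K : ℝ × ℝ → ℝ} {A B : ℝ≥0} (hK : IsCZKernel K A B)
    {f : ℝ × ℝ → ℝ} (hf : Continuous f) (hfi : Integrable f)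
    {α : ℝ} (hα : 0 < α) :
    ENNReal.ofReal α ^ 2 * volume {w | α < |corr K f w|} ≤
      (512 * A + 64 * B + 32) * ((∫⁻ z in {z | |f z| ≤ α}, ‖f z‖ₑ ^ 2) +
        ENNReal.ofReal α * ∫⁻ z in {z | α / 2 < |f z|}, ‖f z‖ₑ) := by
  obtain ⟨ι, _, c, ρ, hρ, hd, hlow, hup, hoff⟩ := exists_stopping_cubes hf hfi hα
  set a := ENNReal.ofReal α with ha
  have ha0 : a ≠ 0 := by simp [ha, hα]
  have hat : a ≠ ⊤ := ENNReal.ofReal_ne_top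
  set Q : ι → Set (ℝ × ℝ) := fun i => pcube (c i) (ρ i) with hQ
  have hQm : ∀ i, MeasurableSet (Q i) := fun i => measurableSet_pcube _ _
  have hQ0 : ∀ i, volume (Q i) ≠ 0 := fun i => by
    have := hρ i
    simp [hQ, volume_pcube]; positivity
  have hQt : ∀ i, volume (Q i) ≠ ⊤ := fun i => by simp [hQ, volume_pcube]
  obtain ⟨g, b, hgm, hbm, hgb, hout, hb0, hgQ, hbQ⟩ :=
    exists_good_bad hf.measurable hfi hQm hd hQ0 hQt
  set Ω := ⋃ i, Q i with hΩ
  have hΩm : MeasurableSet Ω := MeasurableSet.iUnion hQm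
  have hΩvol : volume Ω = ∑' i, volume (Q i) := measure_iUnion hd hQm
  have hΩf : ∫⁻ z in Ω, ‖f z‖ₑ = ∑' i, ∫⁻ z in Q i, ‖f z‖ₑ := lintegral_iUnion hQm hd _
  have hg8 : ∀ z ∈ Ω, ‖g z‖ₑ ≤ 8 * a := by
    intro z hz
    obtain ⟨i, hi⟩ := mem_iUnion.1 hz
    have := (hgQ i z hi).trans (hup i)
    rwa [ENNReal.mul_le_mul_iff_left (hQ0 i) (hQt i)] at this
  have hg1 : ∀ z, z ∉ Ω → |g z| ≤ α := by
    intro z hz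
    rw [(hout z hz).1]
    apply hoff
    simpa [hΩ] using hz
  have hgbd : ∀ z, |g z| ≤ 8 * α := by
    intro z
    by_cases hz : z ∈ Ω
    · have := hg8 z hz
      rw [Real.enorm_eq_ofReal_abs, ha, show (8 : ℝ≥0∞) = ENNReal.ofReal 8 by simp,
        ← ENNReal.ofReal_mul (by norm_num)] at this
      exact (ENNReal.ofReal_le_ofReal_iff (by positivity)).1 this
    · linarith [hg1 z hz]
  -- measure of the union of stopping cubes
  have hΩlow : a * volume Ω ≤ ∫⁻ z in Ω, ‖f z‖ₑ := by
    rw [hΩvol, hΩf, ← ENNReal.tsum_mul_left]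
    exact ENNReal.tsum_le_tsum hlow
  have hΩt : volume Ω ≠ ⊤ := by
    intro h
    rw [h, ENNReal.mul_top ha0] at hΩlow
    exact (lt_of_le_of_lt (hΩlow.trans (setLIntegral_le_lintegral _ _)) hfi.2).ne rfl
  set X := ∫⁻ z in {z | |f z| ≤ α}, ‖f z‖ₑ ^ 2 with hX
  set Y := ∫⁻ z in {z | α / 2 < |f z|}, ‖f z‖ₑ with hY
  have hlevel : MeasurableSet {z | α / 2 < |f z|} :=
    measurableSet_lt measurable_const hf.abs.measurable
  have hΩY : a * volume Ω ≤ 2 * Y := by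
    have h1 : ∫⁻ z in Ω, ‖f z‖ₑ ≤ Y + a / 2 * volume Ω := by
      rw [← lintegral_inter_add_sdiff _ Ω hlevel]
      gcongr
      · exact lintegral_mono_set inter_subset_right
      · calc ∫⁻ z in Ω \ {z | α / 2 < |f z|}, ‖f z‖ₑ
            ≤ ∫⁻ z in Ω \ {z | α / 2 < |f z|}, a / 2 := by
              apply setLIntegral_mono' (hΩm.diff hlevel)
              intro z hz
              have : |f z| ≤ α / 2 := by simpa using hz.2
              rw [Real.enorm_eq_ofReal_abs, ha, show (2 : ℝ≥0∞) = ENNReal.ofReal 2 by simp,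
                ← ENNReal.ofReal_div_of_pos (by norm_num)]
              exact ENNReal.ofReal_le_ofReal this
          _ = a / 2 * volume (Ω \ {z | α / 2 < |f z|}) := setLIntegral_const _ _
          _ ≤ _ := by gcongr; exact sdiff_subset
    have h2 : a * volume Ω = a / 2 * volume Ω + a / 2 * volume Ω := by
      rw [← add_mul, ENNReal.add_halves]
    have h3 : a / 2 * volume Ω ≤ Y := by
      have := hΩlow.trans h1
      rw [h2] at this
      exact (ENNReal.add_le_add_iff_right
        (ENNReal.mul_ne_top (ENNReal.div_ne_top hat (by norm_num)) hΩt)).1 this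
    rw [h2, two_mul]
    gcongr
  -- integrability
  have hbL : ∑' i, ∫⁻ z in Q i, ‖b z‖ₑ ≤ 16 * (a * volume Ω) := by
    calc ∑' i, ∫⁻ z in Q i, ‖b z‖ₑ ≤ ∑' i, 16 * a * volume (Q i) := by
          apply ENNReal.tsum_le_tsum
          intro i
          refine (hbQ i).trans ?_
          calc 2 * ∫⁻ z in Q i, ‖f z‖ₑ ≤ 2 * (8 * a * volume (Q i)) := by
                gcongr; exact hup i
            _ = _ := by ring
      _ = _ := by rw [ENNReal.tsum_mul_left, ← hΩvol, mul_assoc]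
  have hbi : Integrable b := by
    refine ⟨hbm.aestronglyMeasurable, ?_⟩
    have : ∫⁻ z, ‖b z‖ₑ = ∫⁻ z in Ω, ‖b z‖ₑ := by
      rw [← lintegral_indicator hΩm]
      apply lintegral_congr
      intro z
      by_cases hz : z ∈ Ω
      · rw [indicator_of_mem hz]
      · rw [indicator_of_notMem hz, (hout z hz).2, enorm_zero]
    rw [HasFiniteIntegral, this, lintegral_iUnion hQm hd]
    refine hbL.trans_lt (ENNReal.mul_lt_top (by simp) (ENNReal.mul_lt_top hat.lt_top hΩt.lt_top))
  have hgi : Integrable g := by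
    have : g = fun z => f z - b z := by ext z; rw [hgb z]; ring
    rw [this]
    exact hfi.sub hbi
  have hsplit : ∀ w, corr K f w = corr K g w + corr K b w := by
    intro w
    rw [← corr_add hK.measurable hK.bounded hgi hbi]
    simp only [corr, hgb]
  -- good part
  have hgood : ∫⁻ z, ‖g z‖ₑ ^ 2 ≤ X + 64 * (a * (a * volume Ω)) := by
    rw [← lintegral_add_compl _ hΩm, add_comm]
    gcongr
    · calc ∫⁻ z in Ωᶜ, ‖g z‖ₑ ^ 2 = ∫⁻ z in Ωᶜ, ‖f z‖ₑ ^ 2 :=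
            setLIntegral_congr_fun hΩm.compl fun z hz => by simp only [(hout z hz).1]
        _ ≤ X := by
            apply lintegral_mono_set
            intro z hz
            have := hg1 z hz
            rwa [(hout z hz).1] at this
    · calc ∫⁻ z in Ω, ‖g z‖ₑ ^ 2 ≤ ∫⁻ z in Ω, (8 * a) ^ 2 := by
            apply setLIntegral_mono' hΩm
            intro z hz
            gcongr
            exact hg8 z hz
        _ = _ := by rw [setLIntegral_const]; ring
  have hTg : (a / 2) ^ 2 * volume {w | α / 2 ≤ |corr K g w|} ≤
      A * (X + 64 * (a * (a * volume Ω))) := by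
    calc _ ≤ (a / 2) ^ 2 * volume {w | (a / 2) ^ 2 ≤ ‖corr K g w‖ₑ ^ 2} := by
          refine mul_le_mul_right (measure_mono fun w hw => ?_) _
          rw [mem_ofPred_eq] at hw ⊢
          gcongr
          rw [Real.enorm_eq_ofReal_abs, ha, show (2 : ℝ≥0∞) = ENNReal.ofReal 2 by simp,
                ← ENNReal.ofReal_div_of_pos (by norm_num)]
          exact ENNReal.ofReal_le_ofReal hw
      _ ≤ ∫⁻ w, ‖corr K g w‖ₑ ^ 2 := mul_meas_ge_le_lintegral₀
          ((aestronglyMeasurable_corr hK.measurable hgm.aestronglyMeasurable).enorm.pow_const 2) _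
      _ ≤ A * ∫⁻ w, ‖g w‖ₑ ^ 2 := hK.l2 g hgi ⟨_, hgbd⟩
      _ ≤ _ := by gcongr
  -- bad part
  set Ω' := ⋃ i, {w | c i - w ∈ pbox (ρ i)} with hΩ'
  have hΩ'm : MeasurableSet Ω' := MeasurableSet.iUnion fun i =>
    (measurableSet_pbox _).preimage (by fun_prop : Measurable fun w => c i - w)
  have hΩ'vol : volume Ω' ≤ 16 * volume Ω := by
    calc volume Ω' ≤ ∑' i, volume {w | c i - w ∈ pbox (ρ i)} := measure_iUnion_le _
      _ = ∑' i, 16 * volume (Q i) := by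
          congr 1
          ext i
          have : volume {w | c i - w ∈ pbox (ρ i)} = volume (pbox (ρ i)) :=
            (Measure.measurePreserving_sub_left volume (c i)).measure_preimage
              (measurableSet_pbox _).nullMeasurableSet
          rw [this, volume_pbox, hQ, volume_pcube]
      _ = _ := by rw [ENNReal.tsum_mul_left, hΩvol]
  have hTb : a / 2 * volume ({w | α / 2 ≤ |corr K b w|} ∩ Ω'ᶜ) ≤ B * (16 * (a * volume Ω)) := by
    have hm := (aestronglyMeasurable_corr hK.measurable hbm.aestronglyMeasurable).enorm
    calc _ ≤ a / 2 * (volume.restrict Ω'ᶜ) {w | a / 2 ≤ ‖corr K b w‖ₑ} := by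
          rw [Measure.restrict_apply' hΩ'm.compl]
          refine mul_le_mul_right (measure_mono (inter_subset_inter_left _ fun w hw => ?_)) _
          rw [mem_ofPred_eq] at hw ⊢
          rw [Real.enorm_eq_ofReal_abs, ha,
            show (2 : ℝ≥0∞) = ENNReal.ofReal 2 by simp,
            ← ENNReal.ofReal_div_of_pos (by norm_num)]
          exact ENNReal.ofReal_le_ofReal hw
      _ ≤ ∫⁻ w in Ω'ᶜ, ‖corr K b w‖ₑ := mul_meas_ge_le_lintegral₀ hm.restrict _
      _ ≤ B * ∑' i, ∫⁻ z in Q i, ‖b z‖ₑ :=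
          lintegral_corr_bad hK hρ hd hbm hbi (fun z hz => (hout z hz).2) hb0
      _ ≤ _ := by gcongr
  have hcover : {w | α < |corr K f w|} ⊆ {w | α / 2 ≤ |corr K g w|} ∪
      (Ω' ∪ ({w | α / 2 ≤ |corr K b w|} ∩ Ω'ᶜ)) := by
    intro w hw
    by_cases h1 : α / 2 ≤ |corr K g w|
    · exact Or.inl h1
    · by_cases h2 : w ∈ Ω'
      · exact Or.inr (Or.inl h2)
      · refine Or.inr (Or.inr ⟨?_, h2⟩)
        simp only [mem_ofPred_eq, hsplit] at hw ⊢
        push Not at h1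
        linarith [abs_add_le (corr K g w) (corr K b w)]
  have hhalf : a = 2 * (a / 2) := by
    rw [ENNReal.mul_div_cancel (by norm_num) (by norm_num)]
  calc a ^ 2 * volume {w | α < |corr K f w|}
      ≤ a ^ 2 * (volume {w | α / 2 ≤ |corr K g w|} +
        (volume Ω' + volume ({w | α / 2 ≤ |corr K b w|} ∩ Ω'ᶜ))) := by
        gcongr
        refine (measure_mono hcover).trans ((measure_union_le _ _).trans ?_)
        gcongr
        exact measure_union_le _ _
    _ = 4 * ((a / 2) ^ 2 * volume {w | α / 2 ≤ |corr K g w|}) + a * (a * volume Ω') +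
        2 * (a * (a / 2 * volume ({w | α / 2 ≤ |corr K b w|} ∩ Ω'ᶜ))) := by
        rw [mul_add, mul_add]
        have h4 : ∀ V : ℝ≥0∞, a ^ 2 * V = 4 * ((a / 2) ^ 2 * V) := fun V => by
          calc a ^ 2 * V = (2 * (a / 2)) ^ 2 * V := by rw [← hhalf]
            _ = _ := by ring
        have h2 : ∀ V : ℝ≥0∞, a ^ 2 * V = 2 * (a * (a / 2 * V)) := fun V => by
          calc a ^ 2 * V = a * (2 * (a / 2)) * V := by rw [← hhalf, pow_two]
            _ = _ := by ring
        rw [h4 (volume {w | α / 2 ≤ |corr K g w|}),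
          h2 (volume ({w | α / 2 ≤ |corr K b w|} ∩ Ω'ᶜ))]
        ring
    _ ≤ 4 * (A * (X + 64 * (a * (a * volume Ω)))) + a * (a * (16 * volume Ω)) +
        2 * (a * (B * (16 * (a * volume Ω)))) := by gcongr
    _ = 4 * A * X + (256 * A + 16 + 32 * B) * (a * (a * volume Ω)) := by ring
    _ ≤ 4 * A * X + (256 * A + 16 + 32 * B) * (a * (2 * Y)) := by gcongr
    _ ≤ (512 * A + 64 * B + 32) * X + (256 * A + 16 + 32 * B) * (a * (2 * Y)) := by
        gcongr
        refine le_trans ?_ (le_trans le_self_add le_self_add)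
        gcongr
        norm_num
    _ = _ := by ring

theorem lintegral_Ici_rpow {q a : ℝ} (hq : q < -1) (ha : 0 < a) :
    ∫⁻ t in Ici a, ENNReal.ofReal (t ^ q) = ENNReal.ofReal (a ^ (q + 1) / (-(q + 1))) := by
  rw [setLIntegral_congr Ioi_ae_eq_Ici.symm, ← ofReal_integral_eq_lintegral_ofReal
    (integrableOn_Ioi_rpow_of_lt hq ha), integral_Ioi_rpow_of_lt hq ha]
  · congr 1; rw [div_neg, neg_div]
  · exact (ae_restrict_mem measurableSet_Ioi).mono fun t ht =>
      Real.rpow_nonneg (ha.le.trans (le_of_lt ht)) _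

theorem lintegral_Ioo_rpow {q a : ℝ} (hq : -1 < q) (ha : 0 ≤ a) :
    ∫⁻ t in Ioo 0 a, ENNReal.ofReal (t ^ q) = ENNReal.ofReal (a ^ (q + 1) / (q + 1)) := by
  rw [setLIntegral_congr Ioo_ae_eq_Ioc, ← ofReal_integral_eq_lintegral_ofReal,
    ← intervalIntegral.integral_of_le ha, integral_rpow (Or.inl hq), Real.zero_rpow, sub_zero]
  · linarith
  · exact (intervalIntegrable_iff_integrableOn_Ioc_of_le ha).1
      (intervalIntegral.intervalIntegrable_rpow' hq)
  · exact (ae_restrict_mem measurableSet_Ioc).mono fun t ht => Real.rpow_nonneg ht.1.le _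

/-- The constant in the strong-type estimate for exponents below `2`. -/
noncomputable def lowConst (p : ℝ) (A B : ℝ≥0) : ℝ≥0 :=
  p.toNNReal * ((512 * A + 64 * B + 32) *
    ((1 / (2 - p)).toNNReal + (2 ^ (p - 1) / (p - 1)).toNNReal))

theorem lintegral_Ioi_level_low {f : ℝ × ℝ → ℝ} (hf : Measurable f) {p : ℝ} (hp1 : 1 < p)
    (hp2 : p < 2) :
    ∫⁻ t in Ioi (0 : ℝ), (∫⁻ z in {z | |f z| ≤ t}, ‖f z‖ₑ ^ 2) * ENNReal.ofReal (t ^ (p - 3)) ≤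
      ENNReal.ofReal (1 / (2 - p)) * ∫⁻ z, ‖f z‖ₑ ^ p := by
  have hset : MeasurableSet {q : ℝ × (ℝ × ℝ) | |f q.2| ≤ q.1} :=
    measurableSet_le (by fun_prop) (by fun_prop)
  have h1 : ∀ t : ℝ, (∫⁻ z in {z | |f z| ≤ t}, ‖f z‖ₑ ^ 2) * ENNReal.ofReal (t ^ (p - 3)) =
      ∫⁻ z, {q : ℝ × (ℝ × ℝ) | |f q.2| ≤ q.1}.indicator
        (fun q => ‖f q.2‖ₑ ^ 2 * ENNReal.ofReal (q.1 ^ (p - 3))) (t, z) := by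
    intro t
    have hs : MeasurableSet {z | |f z| ≤ t} := measurableSet_le (by fun_prop) (by fun_prop)
    rw [← lintegral_mul_const _ (by fun_prop), ← lintegral_indicator hs]
    rfl
  simp only [h1]
  rw [lintegral_lintegral_swap]
  · rw [← lintegral_const_mul _ (by fun_prop)]
    apply lintegral_mono
    intro z
    simp only
    by_cases hz : f z = 0
    · simp [hz, indicator]
    have hz' : 0 < |f z| := abs_pos.2 hz
    calc _ = ∫⁻ t in Ioi (0 : ℝ), (Ici |f z|).indicator
            (fun t => ‖f z‖ₑ ^ 2 * ENNReal.ofReal (t ^ (p - 3))) t := rfl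
      _ ≤ ∫⁻ t, (Ici |f z|).indicator
            (fun t => ‖f z‖ₑ ^ 2 * ENNReal.ofReal (t ^ (p - 3))) t :=
          setLIntegral_le_lintegral _ _
      _ = ‖f z‖ₑ ^ 2 * ENNReal.ofReal (|f z| ^ (p - 3 + 1) / (-(p - 3 + 1))) := by
          rw [lintegral_indicator measurableSet_Ici, lintegral_const_mul _ (by fun_prop),
            lintegral_Ici_rpow (by linarith) hz']
      _ = _ := by
          rw [Real.enorm_eq_ofReal_abs, ENNReal.ofReal_rpow_of_pos hz',
            ← ENNReal.ofReal_pow hz'.le, ← ENNReal.ofReal_mul (by positivity),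
            ← ENNReal.ofReal_mul (by apply div_nonneg <;> linarith)]
          congr 1
          have : |f z| ^ p = |f z| ^ 2 * |f z| ^ (p - 3 + 1) := by
            rw [← Real.rpow_natCast, ← Real.rpow_add hz']
            congr 1; push_cast; ring
          rw [this, show -(p - 3 + 1) = 2 - p by ring]
          ring
  · exact (Measurable.indicator (by fun_prop) hset).aemeasurable

theorem lintegral_Ioi_level_high {f : ℝ × ℝ → ℝ} (hf : Measurable f) {p : ℝ} (hp1 : 1 < p) :
    ∫⁻ t in Ioi (0 : ℝ), (∫⁻ z in {z | t / 2 < |f z|}, ‖f z‖ₑ) * ENNReal.ofReal (t ^ (p - 2)) ≤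
      ENNReal.ofReal (2 ^ (p - 1) / (p - 1)) * ∫⁻ z, ‖f z‖ₑ ^ p := by
  have hset : MeasurableSet {q : ℝ × (ℝ × ℝ) | q.1 / 2 < |f q.2|} :=
    measurableSet_lt (by fun_prop) (by fun_prop)
  have h1 : ∀ t : ℝ, (∫⁻ z in {z | t / 2 < |f z|}, ‖f z‖ₑ) * ENNReal.ofReal (t ^ (p - 2)) =
      ∫⁻ z, {q : ℝ × (ℝ × ℝ) | q.1 / 2 < |f q.2|}.indicator
        (fun q => ‖f q.2‖ₑ * ENNReal.ofReal (q.1 ^ (p - 2))) (t, z) := by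
    intro t
    have hs : MeasurableSet {z | t / 2 < |f z|} := measurableSet_lt (by fun_prop) (by fun_prop)
    rw [← lintegral_mul_const _ (by fun_prop), ← lintegral_indicator hs]
    rfl
  simp only [h1]
  rw [lintegral_lintegral_swap]
  · rw [← lintegral_const_mul _ (by fun_prop)]
    apply lintegral_mono
    intro z
    simp only
    by_cases hz : f z = 0
    · simp [hz, indicator]
    have hz' : 0 < |f z| := abs_pos.2 hz
    refine le_of_eq ?_
    calc _ = ∫⁻ t in Ioi (0 : ℝ), (Iio (2 * |f z|)).indicator
            (fun t => ‖f z‖ₑ * ENNReal.ofReal (t ^ (p - 2))) t := by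
          apply lintegral_congr
          intro t
          have : t / 2 < |f z| ↔ t < 2 * |f z| := by
            rw [div_lt_iff₀ (by norm_num), mul_comm]
          simp only [indicator, mem_ofPred_eq, mem_Iio, this]
      _ = ‖f z‖ₑ * ENNReal.ofReal ((2 * |f z|) ^ (p - 2 + 1) / (p - 2 + 1)) := by
          rw [setLIntegral_indicator measurableSet_Iio, lintegral_const_mul _ (by fun_prop),
            Iio_inter_Ioi, lintegral_Ioo_rpow (by linarith) (by positivity)]
      _ = ENNReal.ofReal (2 ^ (p - 1) / (p - 1)) * ‖f z‖ₑ ^ p := by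
          rw [Real.enorm_eq_ofReal_abs, ENNReal.ofReal_rpow_of_pos hz',
            ← ENNReal.ofReal_mul (by positivity),
            ← ENNReal.ofReal_mul (by apply div_nonneg (by positivity); linarith)]
          congr 1
          have : |f z| ^ p = |f z| * |f z| ^ (p - 1) := by
            conv_rhs => rw [← Real.rpow_one_add' hz'.le (by linarith)]
            congr 1; ring
          rw [this, show p - 2 + 1 = p - 1 by ring, Real.mul_rpow (by norm_num) hz'.le]
          ring
  · exact (Measurable.indicator (by fun_prop) hset).aemeasurable

/-- Strong type below `2`, continuous integrable functions. -/
theorem strong_low_continuous {K : ℝ × ℝ → ℝ} {A B : ℝ≥0} (hK : IsCZKernel K A B)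
    {f : ℝ × ℝ → ℝ} (hf : Continuous f) (hfi : Integrable f) {p : ℝ} (hp1 : 1 < p)
    (hp2 : p < 2) :
    ∫⁻ w, ‖corr K f w‖ₑ ^ p ≤ lowConst p A B * ∫⁻ z, ‖f z‖ₑ ^ p := by
  have hm := aestronglyMeasurable_corr hK.measurable hf.aestronglyMeasurable
  have hfm := hf.measurable
  set D : ℝ≥0∞ := 512 * A + 64 * B + 32 with hD
  have hlayer := lintegral_rpow_eq_lintegral_meas_lt_mul (μ := volume)
    (f := fun w => |corr K f w|) (ae_of_all _ fun w => abs_nonneg _)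
    (hm.aemeasurable.abs) (p := p) (by linarith)
  have hl : ∫⁻ w, ‖corr K f w‖ₑ ^ p = ∫⁻ w, ENNReal.ofReal (|corr K f w| ^ p) := by
    apply lintegral_congr
    intro w
    rw [Real.enorm_eq_ofReal_abs, ENNReal.ofReal_rpow_of_nonneg (abs_nonneg _) (by linarith)]
  rw [hl, hlayer]
  have hpt : ∀ t ∈ Ioi (0 : ℝ),
      volume {a | t < |corr K f a|} * ENNReal.ofReal (t ^ (p - 1)) ≤
      D * ((∫⁻ z in {z | |f z| ≤ t}, ‖f z‖ₑ ^ 2) * ENNReal.ofReal (t ^ (p - 3)) +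
        (∫⁻ z in {z | t / 2 < |f z|}, ‖f z‖ₑ) * ENNReal.ofReal (t ^ (p - 2))) := by
    intro t ht
    have ht : 0 < t := ht
    have hw := weak_type hK hf hfi ht
    have e1 : ENNReal.ofReal (t ^ (p - 1)) =
        ENNReal.ofReal t ^ 2 * ENNReal.ofReal (t ^ (p - 3)) := by
      rw [← ENNReal.ofReal_pow ht.le, ← ENNReal.ofReal_mul (by positivity)]
      congr 1
      rw [← Real.rpow_natCast, ← Real.rpow_add ht]
      congr 1; push_cast; ring
    have e2 : ENNReal.ofReal (t ^ (p - 2)) =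
        ENNReal.ofReal t * ENNReal.ofReal (t ^ (p - 3)) := by
      rw [← ENNReal.ofReal_mul ht.le]
      congr 1
      nth_rw 2 [← Real.rpow_one t]
      rw [← Real.rpow_add ht]
      congr 1; ring
    calc _ = ENNReal.ofReal t ^ 2 * volume {a | t < |corr K f a|} *
          ENNReal.ofReal (t ^ (p - 3)) := by rw [e1]; ring
      _ ≤ _ * ENNReal.ofReal (t ^ (p - 3)) := mul_le_mul_left hw _
      _ = _ := by rw [e2, hD]; ring
  have hmeas : Measurable fun t : ℝ =>
      (∫⁻ z in {z | |f z| ≤ t}, ‖f z‖ₑ ^ 2) * ENNReal.ofReal (t ^ (p - 3)) := by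
    apply Measurable.mul _ (by fun_prop)
    have : (fun t : ℝ => ∫⁻ z in {z | |f z| ≤ t}, ‖f z‖ₑ ^ 2) = fun t => ∫⁻ z,
        {q : ℝ × (ℝ × ℝ) | |f q.2| ≤ q.1}.indicator (fun q => ‖f q.2‖ₑ ^ 2) (t, z) := by
      ext t
      rw [← lintegral_indicator (measurableSet_le (by fun_prop) (by fun_prop))]
      rfl
    rw [this]
    apply Measurable.lintegral_prod_right'
    exact Measurable.indicator (by fun_prop) (measurableSet_le (by fun_prop) (by fun_prop))
  calc _ ≤ ENNReal.ofReal p * ∫⁻ t in Ioi (0 : ℝ),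
        D * ((∫⁻ z in {z | |f z| ≤ t}, ‖f z‖ₑ ^ 2) * ENNReal.ofReal (t ^ (p - 3)) +
        (∫⁻ z in {z | t / 2 < |f z|}, ‖f z‖ₑ) * ENNReal.ofReal (t ^ (p - 2))) := by
        gcongr 1
        exact setLIntegral_mono' measurableSet_Ioi hpt
    _ = ENNReal.ofReal p * (D * (
        (∫⁻ t in Ioi (0 : ℝ),
          (∫⁻ z in {z | |f z| ≤ t}, ‖f z‖ₑ ^ 2) * ENNReal.ofReal (t ^ (p - 3))) +
        ∫⁻ t in Ioi (0 : ℝ),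
          (∫⁻ z in {z | t / 2 < |f z|}, ‖f z‖ₑ) * ENNReal.ofReal (t ^ (p - 2)))) := by
        rw [lintegral_const_mul' _ _ (by rw [hD]; finiteness), lintegral_add_left hmeas]
    _ ≤ ENNReal.ofReal p * (D * (
        ENNReal.ofReal (1 / (2 - p)) * (∫⁻ z, ‖f z‖ₑ ^ p) +
        ENNReal.ofReal (2 ^ (p - 1) / (p - 1)) * ∫⁻ z, ‖f z‖ₑ ^ p)) := by
        gcongr
        · exact lintegral_Ioi_level_low hfm hp1 hp2
        · exact lintegral_Ioi_level_high hfm hp1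
    _ = _ := by
        simp only [lowConst, ENNReal.ofReal, hD]
        push_cast
        ring

section LpNorms

variable {X : Type*} [MeasurableSpace X] {μ : Measure X}

theorem eLpNorm_ofReal_eq {f : X → ℝ} {p : ℝ} (hp : 0 < p) :
    eLpNorm f (ENNReal.ofReal p) μ = (∫⁻ x, ‖f x‖ₑ ^ p ∂μ) ^ (1 / p) := by
  rw [eLpNorm_eq_lintegral_rpow_enorm_toReal (by simpa using hp) ENNReal.ofReal_ne_top,
    ENNReal.toReal_ofReal hp.le]

theorem memLp_of_integrable_of_bounded {f : X → ℝ} (hf : Integrable f μ)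
    (hb : ∃ M, ∀ x, |f x| ≤ M) {p : ℝ} (hp : 1 ≤ p) : MemLp f (ENNReal.ofReal p) μ := by
  obtain ⟨M, hM⟩ := hb
  refine ⟨hf.1, ?_⟩
  rw [eLpNorm_ofReal_eq (by linarith)]
  refine ENNReal.rpow_lt_top_of_nonneg (by positivity) (ne_of_lt ?_)
  calc ∫⁻ x, ‖f x‖ₑ ^ p ∂μ ≤ ∫⁻ x, ENNReal.ofReal M ^ (p - 1) * ‖f x‖ₑ ∂μ := by
        apply lintegral_mono
        intro x
        simp only
        calc ‖f x‖ₑ ^ p = ‖f x‖ₑ ^ (p - 1) * ‖f x‖ₑ := by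
              conv_rhs => rw [← ENNReal.rpow_one ‖f x‖ₑ, ← ENNReal.rpow_mul, one_mul,
                ← ENNReal.rpow_add_of_nonneg _ _ (by linarith) (by linarith)]
              congr 1; ring
          _ ≤ _ := by
              gcongr
              rw [Real.enorm_eq_ofReal_abs]
              exact ENNReal.ofReal_le_ofReal (hM x)
    _ = ENNReal.ofReal M ^ (p - 1) * ∫⁻ x, ‖f x‖ₑ ∂μ := by
        rw [lintegral_const_mul' _ _
          (ENNReal.rpow_ne_top_of_nonneg (by linarith) ENNReal.ofReal_ne_top)]
    _ < ⊤ := ENNReal.mul_lt_top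
        (ENNReal.rpow_lt_top_of_nonneg (by linarith) ENNReal.ofReal_ne_top) hf.2

/-- `corr K` is bounded on `L^p` with constant `C`, tested on bounded integrable functions. -/
def HasLpBound (K : ℝ × ℝ → ℝ) (p : ℝ) (C : ℝ≥0) : Prop :=
  ∀ f : ℝ × ℝ → ℝ, Integrable f → (∃ M, ∀ z, |f z| ≤ M) →
    eLpNorm (corr K f) (ENNReal.ofReal p) ≤ C * eLpNorm f (ENNReal.ofReal p)

theorem lintegral_le_iff_eLpNorm_le {f : X → ℝ} {g : X → ℝ} {p : ℝ} (hp : 0 < p) (C : ℝ≥0) :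
    ∫⁻ x, ‖f x‖ₑ ^ p ∂μ ≤ C * ∫⁻ x, ‖g x‖ₑ ^ p ∂μ ↔
      eLpNorm f (ENNReal.ofReal p) μ ≤ (C ^ (1 / p) : ℝ≥0) * eLpNorm g (ENNReal.ofReal p) μ := by
  rw [eLpNorm_ofReal_eq hp, eLpNorm_ofReal_eq hp, ENNReal.coe_rpow_of_nonneg _ (by positivity),
    ← ENNReal.mul_rpow_of_nonneg _ _ (by positivity),
    ENNReal.rpow_le_rpow_iff (by positivity)]

end LpNorms

/-- Hölder bound for `corr K f` at a point. -/
theorem enorm_corr_le {K f : ℝ × ℝ → ℝ} (hK : Measurable K) (hf : AEStronglyMeasurable f)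
    {p q : ℝ} (hpq : p.HolderConjugate q) (w : ℝ × ℝ) :
    ‖corr K f w‖ₑ ≤ eLpNorm K (ENNReal.ofReal q) * eLpNorm f (ENNReal.ofReal p) := by
  rw [eLpNorm_ofReal_eq hpq.pos, eLpNorm_ofReal_eq hpq.symm.pos, corr_eq]
  refine (enorm_integral_le_lintegral_enorm _).trans ?_
  simp only [enorm_mul]
  have h := ENNReal.lintegral_mul_le_Lp_mul_Lq (volume : Measure (ℝ × ℝ)) hpq.symm
    (f := fun y => ‖K (y - w)‖ₑ) (g := fun y => ‖f y‖ₑ) (by fun_prop) (by fun_prop)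
  refine h.trans (le_of_eq ?_)
  rw [lintegral_sub_right_eq_self (fun y => ‖K y‖ₑ ^ q) w]

theorem HasLpBound.of_smooth {K : ℝ × ℝ → ℝ} (hK : Measurable K) (hKi : Integrable K)
    (hb : ∃ M, ∀ z, |K z| ≤ M) {p : ℝ} (hp : 1 < p) {C : ℝ≥0}
    (h : ∀ f : ℝ × ℝ → ℝ, ContDiff ℝ (⊤ : ℕ∞) f → HasCompactSupport f →
      eLpNorm (corr K f) (ENNReal.ofReal p) ≤ C * eLpNorm f (ENNReal.ofReal p)) :
    HasLpBound K p C := by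
  intro f hfi hfb
  have hpq : p.HolderConjugate (p / (p - 1)) := Real.HolderConjugate.conjExponent hp
  have hfp := memLp_of_integrable_of_bounded hfi hfb hp.le
  have hp1 : (1 : ℝ≥0∞) ≤ ENNReal.ofReal p := by simpa using hp.le
  choose g hgc hgs hg using fun n : ℕ =>
    hfp.exist_eLpNorm_sub_le ENNReal.ofReal_ne_top hp1 (ε := 1 / ((n : ℝ) + 1)) (by positivity)
  have hlim0 : Tendsto (fun n : ℕ => ENNReal.ofReal (1 / ((n : ℝ) + 1))) atTop (𝓝 0) := by
    have := ENNReal.tendsto_ofReal tendsto_one_div_add_atTop_nhds_zero_nat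
    simpa using this
  have hgi : ∀ n, Integrable (g n) := fun n =>
    (hgs n).continuous.integrable_of_hasCompactSupport (hgc n)
  have hKq : eLpNorm K (ENNReal.ofReal (p / (p - 1))) ≠ ⊤ :=
    (memLp_of_integrable_of_bounded hKi hb hpq.symm.lt.le).2.ne
  have hpt : ∀ w, Tendsto (fun n => corr K (g n) w) atTop (𝓝 (corr K f w)) := by
    intro w
    rw [tendsto_iff_edist_tendsto_0]
    refine tendsto_of_tendsto_of_tendsto_of_le_of_le tendsto_const_nhds
      (h := fun n : ℕ => eLpNorm K (ENNReal.ofReal (p / (p - 1))) *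
        ENNReal.ofReal (1 / ((n : ℝ) + 1))) ?_ (fun _ => zero_le) ?_
    · have := ENNReal.Tendsto.const_mul hlim0 (Or.inr hKq)
      simpa using this
    · intro n
      simp only
      have : corr K f w - corr K (g n) w = corr K (f - g n) w := by
        simp only [corr_eq, Pi.sub_apply, mul_sub]
        exact (integral_sub (integrable_corr_aux hK hb hfi w)
          (integrable_corr_aux hK hb (hgi n) w)).symm
      rw [edist_comm, edist_eq_enorm_sub, this]
      exact (enorm_corr_le hK (hfi.sub (hgi n)).1 hpq w).trans (by gcongr; exact hg n)
  have hF := Lp.eLpNorm_lim_le_liminf_eLpNorm (p := ENNReal.ofReal p)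
    (fun n => aestronglyMeasurable_corr hK (hgi n).1) (corr K f) (ae_of_all _ hpt)
  refine hF.trans ?_
  have hle : ∀ n : ℕ, eLpNorm (corr K (g n)) (ENNReal.ofReal p) ≤
      C * (eLpNorm f (ENNReal.ofReal p) + ENNReal.ofReal (1 / ((n : ℝ) + 1))) := by
    intro n
    refine (h (g n) (hgs n) (hgc n)).trans ?_
    gcongr
    have : g n = f - (f - g n) := by simp
    rw [this]
    refine (eLpNorm_sub_le hfi.1 (hfi.sub (hgi n)).1 hp1).trans ?_
    gcongr
    simpa using hg n
  have hlim : Tendsto (fun n : ℕ =>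
      (C : ℝ≥0∞) * (eLpNorm f (ENNReal.ofReal p) + ENNReal.ofReal (1 / ((n : ℝ) + 1)))) atTop
      (𝓝 (C * eLpNorm f (ENNReal.ofReal p))) := by
    have := ENNReal.Tendsto.const_mul (a := C) (hlim0.const_add (eLpNorm f (ENNReal.ofReal p)))
      (Or.inr ENNReal.coe_ne_top)
    simpa using this
  rw [← hlim.liminf_eq]
  exact liminf_le_liminf (Eventually.of_forall hle)

theorem integrable_corr {K f : ℝ × ℝ → ℝ} (hK : Measurable K) (hKi : Integrable K)
    (hf : Integrable f) : Integrable (corr K f) := by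
  refine ⟨aestronglyMeasurable_corr hK hf.1, ?_⟩
  have hfm : AEMeasurable (fun y => ‖f y‖ₑ) := hf.1.enorm
  have h2 : AEMeasurable (fun z : (ℝ × ℝ) × (ℝ × ℝ) => ‖K (z.2 - z.1)‖ₑ * ‖f z.2‖ₑ)
      (volume.prod volume) :=
    (Measurable.aemeasurable (by fun_prop)).mul hf.1.comp_snd.enorm
  calc ∫⁻ w, ‖corr K f w‖ₑ ≤ ∫⁻ w, ∫⁻ y, ‖K (y - w)‖ₑ * ‖f y‖ₑ := by
        apply lintegral_mono
        intro w
        simp only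
        rw [corr_eq]
        refine (enorm_integral_le_lintegral_enorm _).trans (le_of_eq ?_)
        simp only [enorm_mul]
    _ = ∫⁻ y, ∫⁻ w, ‖K (y - w)‖ₑ * ‖f y‖ₑ := lintegral_lintegral_swap h2
    _ = (∫⁻ z, ‖K z‖ₑ) * ∫⁻ y, ‖f y‖ₑ := by
        rw [← lintegral_const_mul'' _ hfm]
        apply lintegral_congr
        intro y
        rw [lintegral_mul_const _ (by fun_prop), lintegral_sub_left_eq_self (fun z => ‖K z‖ₑ)]
    _ < ⊤ := ENNReal.mul_lt_top hKi.2 hf.2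

theorem bounded_corr {K f : ℝ × ℝ → ℝ} (hb : ∃ M, ∀ z, |K z| ≤ M) (hf : Integrable f) :
    ∃ M, ∀ w, |corr K f w| ≤ M := by
  obtain ⟨M, hM⟩ := hb
  refine ⟨M * ∫ y, |f y|, fun w => ?_⟩
  rw [corr_eq, ← integral_const_mul]
  rw [← Real.norm_eq_abs]
  refine norm_integral_le_of_norm_le (hf.abs.const_mul M) (ae_of_all _ fun y => ?_)
  rw [norm_mul, Real.norm_eq_abs, Real.norm_eq_abs]
  exact mul_le_mul_of_nonneg_right (hM _) (abs_nonneg _)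

theorem integral_corr_mul {K f g : ℝ × ℝ → ℝ} (hK : Measurable K) (hb : ∃ M, ∀ z, |K z| ≤ M)
    (hf : Integrable f) (hg : Integrable g) :
    ∫ w, corr K f w * g w = ∫ y, f y * corr (fun z => K (-z)) g y := by
  obtain ⟨M, hM⟩ := hb
  simp only [corr_eq, ← integral_mul_const, ← integral_const_mul]
  rw [integral_integral_swap]
  · refine integral_congr_ae (ae_of_all _ fun y => integral_congr_ae (ae_of_all _ fun w => ?_))
    simp only [neg_sub]
    ring
  · have h := (hg.mul_prod hf).bdd_mul (c := M)
      (f := fun q : (ℝ × ℝ) × (ℝ × ℝ) => K (q.2 - q.1))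
      (Measurable.aestronglyMeasurable (by fun_prop)) (ae_of_all _ fun q => hM _)
    refine h.congr (ae_of_all _ fun q => ?_)
    simp only [Function.uncurry]
    ring

/-- Duality, for exponents `2 ≤ q`. -/
theorem HasLpBound.dual {K : ℝ × ℝ → ℝ} (hK : Measurable K) (hKi : Integrable K)
    (hb : ∃ M, ∀ z, |K z| ≤ M) {p q : ℝ} (hpq : p.HolderConjugate q) (hq : 2 ≤ q) {C : ℝ≥0}
    (h : HasLpBound K p C) : HasLpBound (fun z => K (-z)) q C := by
  intro g hgi hgb
  set u := corr (fun z => K (-z)) g with hu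
  have hK' : Measurable fun z => K (-z) := by fun_prop
  have hKi' : Integrable fun z => K (-z) := hKi.comp_neg
  have hb' : ∃ M, ∀ z, |K (-z)| ≤ M := hb.imp fun M hM z => hM _
  have hui : Integrable u := integrable_corr hK' hKi' hgi
  have hub : ∃ M, ∀ z, |u z| ≤ M := bounded_corr hb' hgi
  obtain ⟨M, hM⟩ := hub
  have hM0 : 0 ≤ M := (abs_nonneg _).trans (hM 0)
  have hpm : (q - 1) * p = q := hpq.symm.sub_one_mul_conj
  set f : ℝ × ℝ → ℝ := fun z => |u z| ^ (q - 2) * u z with hf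
  have hcoef : ∀ z, ‖|u z| ^ (q - 2)‖ ≤ M ^ (q - 2) := fun z => by
    rw [Real.norm_of_nonneg (by positivity)]
    exact Real.rpow_le_rpow (abs_nonneg _) (hM z) (by linarith)
  have hfi : Integrable f := hui.bdd_mul (c := M ^ (q - 2))
    ((hui.1.aemeasurable.abs.pow_const _).aestronglyMeasurable) (ae_of_all _ hcoef)
  have hfb : ∃ M, ∀ z, |f z| ≤ M := by
    refine ⟨M ^ (q - 2) * M, fun z => ?_⟩
    rw [hf, abs_mul]
    exact mul_le_mul (hcoef z) (hM z) (abs_nonneg _) (by positivity)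
  have habs : ∀ z, ‖f z‖ₑ = ‖u z‖ₑ ^ (q - 1) := by
    intro z
    rw [Real.enorm_eq_ofReal_abs, Real.enorm_eq_ofReal_abs,
      ENNReal.ofReal_rpow_of_nonneg (abs_nonneg _) (by linarith), hf, abs_mul,
      abs_of_nonneg (Real.rpow_nonneg (abs_nonneg _) _),
      ← Real.rpow_add_one' (abs_nonneg _) (by linarith)]
    congr 2; ring
  have hfu : ∀ z, ENNReal.ofReal (f z * u z) = ‖u z‖ₑ ^ q := by
    intro z
    rw [Real.enorm_eq_ofReal_abs, ENNReal.ofReal_rpow_of_nonneg (abs_nonneg _) (by linarith), hf]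
    congr 1
    simp only
    rw [mul_assoc, ← pow_two, ← sq_abs, ← Real.rpow_natCast,
      ← Real.rpow_add' (abs_nonneg _) (by push_cast; linarith)]
    congr 1; push_cast; ring
  have hfu0 : ∀ z, 0 ≤ f z * u z := fun z => by
    rw [hf]; simp only; rw [mul_assoc]; exact mul_nonneg (by positivity) (mul_self_nonneg _)
  set Y := ∫⁻ z, ‖u z‖ₑ ^ q with hY
  have hYt : Y ≠ ⊤ := by
    have h1 := (memLp_of_integrable_of_bounded hui ⟨M, hM⟩ (p := q) (by linarith)).2
    rw [eLpNorm_ofReal_eq (by linarith)] at h1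
    intro h2
    rw [← hY, h2, ENNReal.top_rpow_of_pos (by apply one_div_pos.2; linarith)] at h1
    exact lt_irrefl _ h1
  have hkey : Y ≤ C * Y ^ (1 / p) * eLpNorm g (ENNReal.ofReal q) := by
    have h1 : Y = ENNReal.ofReal (∫ z, f z * u z) := by
      rw [ofReal_integral_eq_lintegral_ofReal _ (ae_of_all _ hfu0)]
      · simp only [hfu, hY]
      · exact hui.bdd_mul hfi.1 (ae_of_all _ hfb.choose_spec)
    calc Y = ENNReal.ofReal (∫ w, corr K f w * g w) := by
          rw [h1, ← integral_corr_mul hK hb hfi hgi]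
      _ ≤ ‖∫ w, corr K f w * g w‖ₑ := by
          rw [Real.enorm_eq_ofReal_abs]
          exact ENNReal.ofReal_le_ofReal (le_abs_self _)
      _ ≤ ∫⁻ w, ‖corr K f w‖ₑ * ‖g w‖ₑ := by
          refine (enorm_integral_le_lintegral_enorm _).trans (le_of_eq ?_)
          simp only [enorm_mul]
      _ ≤ eLpNorm (corr K f) (ENNReal.ofReal p) * eLpNorm g (ENNReal.ofReal q) := by
          rw [eLpNorm_ofReal_eq hpq.pos, eLpNorm_ofReal_eq hpq.symm.pos]
          exact ENNReal.lintegral_mul_le_Lp_mul_Lq _ hpq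
            (aestronglyMeasurable_corr hK hfi.1).enorm hgi.1.enorm
      _ ≤ C * eLpNorm f (ENNReal.ofReal p) * eLpNorm g (ENNReal.ofReal q) := by
          gcongr
          exact h f hfi hfb
      _ = _ := by
          rw [eLpNorm_ofReal_eq hpq.pos]
          simp only [habs, ← ENNReal.rpow_mul, hpm, hY]
  rw [eLpNorm_ofReal_eq (by linarith), ← hY]
  by_cases hY0 : Y = 0
  · rw [hY0, ENNReal.zero_rpow_of_pos (by apply one_div_pos.2; linarith)]
    exact zero_le
  have hsum : 1 / p + 1 / q = 1 := by simpa using hpq.inv_add_inv_eq_one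
  have hYp : Y ^ (1 / p) ≠ 0 := by
    rw [Ne, ENNReal.rpow_eq_zero_iff]; simp [hY0, hYt]
  have hYp' : Y ^ (1 / p) ≠ ⊤ := ENNReal.rpow_ne_top_of_nonneg (by
    have := hpq.pos; positivity) hYt
  have h3 : Y = Y ^ (1 / p) * Y ^ (1 / q) := by
    rw [← ENNReal.rpow_add _ _ hY0 hYt, hsum, ENNReal.rpow_one]
  rw [← ENNReal.mul_le_mul_iff_right hYp hYp', ← h3]
  refine hkey.trans (le_of_eq (by ring))

theorem IsCZKernel.hasLpBound_two {K : ℝ × ℝ → ℝ} {A B : ℝ≥0} (hK : IsCZKernel K A B) :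
    HasLpBound K 2 (A ^ (1 / (2 : ℝ))) := by
  intro f hf hb
  rw [← lintegral_le_iff_eLpNorm_le (by norm_num)]
  simpa using hK.l2 f hf hb

theorem IsCZKernel.reflect {K : ℝ × ℝ → ℝ} {A B : ℝ≥0} (hK : IsCZKernel K A B) :
    IsCZKernel (fun z => K (-z)) A B where
  measurable := hK.measurable.comp measurable_neg
  bounded := hK.bounded.imp fun M hM z => hM _
  integrable := hK.integrable.comp_neg
  l2 f hf hb := by
    have := hK.hasLpBound_two.dual hK.measurable hK.integrable hK.bounded
      Real.HolderConjugate.two_two le_rfl f hf hb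
    rw [← lintegral_le_iff_eLpNorm_le (by norm_num)] at this
    simpa using this
  hormander ρ hρ η h1 h2 := by
    have hs : MeasurableSet (pbox ρ)ᶜ := (measurableSet_pbox ρ).compl
    rw [← lintegral_indicator hs, ← lintegral_neg_eq_self]
    refine le_trans (le_of_eq ?_) (hK.hormander ρ hρ (-η) (by simpa using h1) (by simpa using h2))
    rw [← lintegral_indicator hs]
    apply lintegral_congr
    intro z
    have : -z ∈ (pbox ρ)ᶜ ↔ z ∈ (pbox ρ)ᶜ := by
      simp only [pbox, mem_compl_iff, mem_prod, Prod.fst_neg, Prod.snd_neg, mem_Ioo]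
      refine not_congr ⟨?_, ?_⟩ <;> rintro ⟨⟨_, _⟩, _, _⟩ <;>
        exact ⟨⟨by linarith, by linarith⟩, by linarith, by linarith⟩
    by_cases hz : z ∈ (pbox ρ)ᶜ
    · simp only [indicator_of_mem hz, indicator_of_mem (this.2 hz), neg_add, neg_neg]
    · rw [indicator_of_notMem hz, indicator_of_notMem (fun h => hz (this.1 h))]

theorem IsCZKernel.hasLpBound_low {K : ℝ × ℝ → ℝ} {A B : ℝ≥0} (hK : IsCZKernel K A B) {p : ℝ}
    (hp1 : 1 < p) (hp2 : p < 2) : HasLpBound K p (lowConst p A B ^ (1 / p)) := by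
  refine HasLpBound.of_smooth hK.measurable hK.integrable hK.bounded hp1 fun f hf hc => ?_
  rw [← lintegral_le_iff_eLpNorm_le (by linarith)]
  exact strong_low_continuous hK hf.continuous (hf.continuous.integrable_of_hasCompactSupport hc)
    hp1 hp2

/-- The Calderón–Zygmund theorem, with constants uniform over the kernel class. -/
theorem exists_hasLpBound {p : ℝ} (hp : 1 < p) (A B : ℝ≥0) :
    ∃ C : ℝ≥0, ∀ K : ℝ × ℝ → ℝ, IsCZKernel K A B → HasLpBound K p C := by
  rcases lt_trichotomy p 2 with h | rfl | h
  · exact ⟨_, fun K hK => hK.hasLpBound_low hp h⟩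
  · exact ⟨_, fun K hK => hK.hasLpBound_two⟩
  · have hpq : p.HolderConjugate (p / (p - 1)) := Real.HolderConjugate.conjExponent hp
    refine ⟨lowConst (p / (p - 1)) A B ^ (1 / (p / (p - 1))), fun K hK => ?_⟩
    have hlt : p / (p - 1) < 2 := by rw [div_lt_iff₀ (by linarith)]; linarith
    have := (hK.reflect.hasLpBound_low hpq.symm.lt hlt).dual hK.reflect.measurable
      hK.reflect.integrable hK.reflect.bounded hpq.symm h.le
    simpa using this

/-- The one-dimensional heat kernel. -/
noncomputable def gk (s z : ℝ) : ℝ := (√(4 * Real.pi * s))⁻¹ * Real.exp (-z ^ 2 / (4 * s))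

/-- The second spatial (equivalently, first time) derivative of the heat kernel. -/
noncomputable def hk (s z : ℝ) : ℝ := (z ^ 2 / (4 * s ^ 2) - 1 / (2 * s)) * gk s z

theorem measurable_gk : Measurable fun q : ℝ × ℝ => gk q.1 q.2 := by
  unfold gk; fun_prop

theorem measurable_hk : Measurable fun q : ℝ × ℝ => hk q.1 q.2 := by
  unfold hk gk; fun_prop

theorem gk_nonneg (s z : ℝ) : 0 ≤ gk s z := by unfold gk; positivity

theorem hasDerivAt_gk_right {s : ℝ} (hs : 0 < s) (z : ℝ) :
    HasDerivAt (gk s) (-(z / (2 * s)) * gk s z) z := by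
  have h1 : HasDerivAt (fun z : ℝ => -z ^ 2 / (4 * s)) (-(z / (2 * s))) z := by
    refine (((hasDerivAt_pow 2 z).neg).div_const (4 * s)).congr_deriv ?_
    push_cast
    field_simp
    ring
  refine (h1.exp.const_mul ((√(4 * Real.pi * s))⁻¹)).congr_deriv ?_
  unfold gk
  ring

theorem hasDerivAt_gk_right_deriv {s : ℝ} (hs : 0 < s) (z : ℝ) :
    HasDerivAt (fun z => -(z / (2 * s)) * gk s z) (hk s z) z := by
  have h1 : HasDerivAt (fun z : ℝ => -(z / (2 * s))) (-(1 / (2 * s))) z :=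
    ((hasDerivAt_id z).div_const (2 * s)).neg
  refine (h1.mul (hasDerivAt_gk_right hs z)).congr_deriv ?_
  unfold hk
  field_simp
  ring

theorem hasDerivAt_gk_left {s : ℝ} (hs : 0 < s) (z : ℝ) :
    HasDerivAt (fun s => gk s z) (hk s z) s := by
  have hπ := Real.pi_pos
  have hpos : 0 < 4 * Real.pi * s := by positivity
  have h1 : HasDerivAt (fun s : ℝ => (√(4 * Real.pi * s))⁻¹)
      (-(1 / (2 * s)) * (√(4 * Real.pi * s))⁻¹) s := by
    have h0 : HasDerivAt (fun s : ℝ => 4 * Real.pi * s) (4 * Real.pi) s := by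
      simpa using (hasDerivAt_id s).const_mul (4 * Real.pi)
    refine ((h0.sqrt hpos.ne').inv (Real.sqrt_pos.2 hpos).ne').congr_deriv ?_
    have hsq : √(4 * Real.pi * s) ^ 2 = 4 * Real.pi * s := Real.sq_sqrt hpos.le
    have h0 := (Real.sqrt_pos.2 hpos).ne'
    rw [hsq]
    field_simp
  have h2 : HasDerivAt (fun s : ℝ => Real.exp (-z ^ 2 / (4 * s)))
      (Real.exp (-z ^ 2 / (4 * s)) * (z ^ 2 / (4 * s ^ 2))) s := by
    have h0 : HasDerivAt (fun s : ℝ => 4 * s) 4 s := by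
      simpa using (hasDerivAt_id s).const_mul (4 : ℝ)
    have h3 : HasDerivAt (fun s : ℝ => -z ^ 2 / (4 * s)) (z ^ 2 / (4 * s ^ 2)) s := by
      refine ((hasDerivAt_const s (-z ^ 2)).div h0 (by positivity)).congr_deriv ?_
      field_simp
      ring
    exact h3.exp
  refine (h1.mul h2).congr_deriv ?_
  unfold hk gk
  ring

theorem hasDerivAt_hk_right {s : ℝ} (hs : 0 < s) (z : ℝ) :
    HasDerivAt (hk s) ((3 * z / (4 * s ^ 2) - z ^ 3 / (8 * s ^ 3)) * gk s z) z := by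
  have h1 : HasDerivAt (fun z : ℝ => z ^ 2 / (4 * s ^ 2) - 1 / (2 * s)) (z / (2 * s ^ 2)) z := by
    refine (((hasDerivAt_pow 2 z).div_const (4 * s ^ 2)).sub_const (1 / (2 * s))).congr_deriv ?_
    push_cast
    field_simp
    ring
  refine (h1.mul (hasDerivAt_gk_right hs z)).congr_deriv ?_
  field_simp
  ring

theorem hasDerivAt_hk_left {s : ℝ} (hs : 0 < s) (z : ℝ) :
    HasDerivAt (fun s => hk s z)
      ((z ^ 4 / (16 * s ^ 4) - 3 * z ^ 2 / (4 * s ^ 3) + 3 / (4 * s ^ 2)) * gk s z) s := by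
  have h1 : HasDerivAt (fun s : ℝ => z ^ 2 / (4 * s ^ 2) - 1 / (2 * s))
      (-z ^ 2 / (2 * s ^ 3) + 1 / (2 * s ^ 2)) s := by
    have h0 : HasDerivAt (fun s : ℝ => 2 * s) 2 s := by
      simpa using (hasDerivAt_id s).const_mul (2 : ℝ)
    have ha := (hasDerivAt_const s (z ^ 2)).div ((hasDerivAt_pow 2 s).const_mul 4)
      (by positivity)
    have hb := (hasDerivAt_const s (1 : ℝ)).div h0 (by positivity)
    refine (ha.sub hb).congr_deriv ?_
    push_cast
    field_simp
    ring
  refine (h1.mul (hasDerivAt_gk_left hs z)).congr_deriv ?_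
  unfold hk
  field_simp
  ring

theorem gk_le {s : ℝ} (hs : 0 < s) (z : ℝ) :
    gk s z ≤ 18432 * ((√s)⁻¹ * (s ^ 4 / (s + z ^ 2) ^ 4)) := by
  set u := z ^ 2 / (4 * s) with hu
  have hu0 : 0 ≤ u := by positivity
  have h1 : (1 + u) ^ 4 ≤ 72 * Real.exp u := by
    have h := Real.pow_div_factorial_le_exp (1 + u) (by positivity) 4
    rw [div_le_iff₀ (by positivity), Real.exp_add] at h
    have h3 := Real.exp_one_lt_three
    have : Real.exp 1 * Real.exp u ≤ 3 * Real.exp u := by gcongr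
    norm_num [Nat.factorial] at h
    linarith
  have h2 : Real.exp (-z ^ 2 / (4 * s)) ≤ 72 / (1 + u) ^ 4 := by
    rw [neg_div, Real.exp_neg, le_div_iff₀ (by positivity), inv_mul_le_iff₀ (Real.exp_pos _)]
    linarith
  have h3 : (√(4 * Real.pi * s))⁻¹ ≤ (√s)⁻¹ := by
    gcongr
    nlinarith [Real.pi_gt_three]
  have h4 : 72 / (1 + u) ^ 4 ≤ 18432 * (s ^ 4 / (s + z ^ 2) ^ 4) := by
    have : 1 + u = (4 * s + z ^ 2) / (4 * s) := by rw [hu]; field_simp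
    rw [this, div_pow, div_div_eq_mul_div, mul_pow]
    rw [← mul_div_assoc]
    gcongr ?_ / ?_
    · linarith
    · gcongr; linarith
  unfold gk
  calc _ ≤ (√s)⁻¹ * (18432 * (s ^ 4 / (s + z ^ 2) ^ 4)) := by
        gcongr
        exact h2.trans h4
    _ = _ := by ring

theorem abs_hk_le {s : ℝ} (hs : 0 < s) (z : ℝ) :
    |hk s z| ≤ 18432 * ((√s)⁻¹ * (s + z ^ 2)⁻¹) := by
  have hm : 0 < s + z ^ 2 := by positivity
  have h1 : |z ^ 2 / (4 * s ^ 2) - 1 / (2 * s)| ≤ (s + z ^ 2) / s ^ 2 := by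
    have h2 : (s + z ^ 2) / s ^ 2 = z ^ 2 / s ^ 2 + 1 / s := by field_simp; ring
    have h3 : z ^ 2 / (4 * s ^ 2) = z ^ 2 / s ^ 2 / 4 := by field_simp
    have h4 : 1 / (2 * s) = 1 / s / 2 := by field_simp
    have h5 : 0 ≤ z ^ 2 / s ^ 2 := by positivity
    have h6 : 0 ≤ 1 / s := by positivity
    rw [h2, h3, h4, abs_le]
    constructor <;> linarith
  unfold hk
  rw [abs_mul, abs_of_nonneg (gk_nonneg s z)]
  calc _ ≤ (s + z ^ 2) / s ^ 2 * (18432 * ((√s)⁻¹ * (s ^ 4 / (s + z ^ 2) ^ 4))) :=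
        mul_le_mul h1 (gk_le hs z) (gk_nonneg _ _) (by positivity)
    _ = 18432 * ((√s)⁻¹ * (s ^ 2 / (s + z ^ 2) ^ 3)) := by field_simp
    _ ≤ _ := by
        gcongr
        rw [div_le_iff₀ (by positivity), pow_succ' (s + z ^ 2), inv_mul_cancel_left₀ hm.ne']
        gcongr
        linarith [sq_nonneg z]

theorem abs_hk_le_cube {s : ℝ} (hs : 0 < s) {z : ℝ} (hz : z ≠ 0) :
    |hk s z| ≤ 18432 * (|z| ^ 3)⁻¹ := by
  have hz' : 0 < |z| := abs_pos.2 hz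
  have hm : 0 < s + z ^ 2 := by positivity
  have hr := Real.sqrt_pos.2 hs
  have hrs : √s ^ 2 = s := Real.sq_sqrt hs.le
  have h1 : |z ^ 2 / (4 * s ^ 2) - 1 / (2 * s)| ≤ (s + z ^ 2) / s ^ 2 := by
    have h2 : (s + z ^ 2) / s ^ 2 = z ^ 2 / s ^ 2 + 1 / s := by field_simp; ring
    have h3 : z ^ 2 / (4 * s ^ 2) = z ^ 2 / s ^ 2 / 4 := by field_simp
    have h4 : 1 / (2 * s) = 1 / s / 2 := by field_simp
    have h5 : 0 ≤ z ^ 2 / s ^ 2 := by positivity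
    have h6 : 0 ≤ 1 / s := by positivity
    rw [h2, h3, h4, abs_le]
    constructor <;> linarith
  unfold hk
  rw [abs_mul, abs_of_nonneg (gk_nonneg s z)]
  have hmr : √s * |z| ≤ s + z ^ 2 := by
    nlinarith [sq_nonneg (√s - |z|), sq_abs z]
  calc _ ≤ (s + z ^ 2) / s ^ 2 * (18432 * ((√s)⁻¹ * (s ^ 4 / (s + z ^ 2) ^ 4))) :=
        mul_le_mul h1 (gk_le hs z) (gk_nonneg _ _) (by positivity)
    _ = 18432 * ((√s)⁻¹ * (s ^ 2 / (s + z ^ 2) ^ 3)) := by field_simp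
    _ = 18432 * (√s ^ 3 / (s + z ^ 2) ^ 3) := by
        congr 1
        nth_rw 2 [← hrs]
        field_simp
    _ ≤ 18432 * (√s ^ 3 / (√s * |z|) ^ 3) := by gcongr
    _ = _ := by rw [mul_pow]; field_simp

theorem abs_hk_right_deriv_le {s : ℝ} (hs : 0 < s) (z : ℝ) :
    |(3 * z / (4 * s ^ 2) - z ^ 3 / (8 * s ^ 3)) * gk s z| ≤
      18432 * (s⁻¹ * (s + z ^ 2)⁻¹) := by
  have hm : 0 < s + z ^ 2 := by positivity
  have hr := Real.sqrt_pos.2 hs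
  have hrs : √s ^ 2 = s := Real.sq_sqrt hs.le
  have h1 : |3 * z / (4 * s ^ 2) - z ^ 3 / (8 * s ^ 3)| ≤ |z| * ((s + z ^ 2) / s ^ 3) := by
    have : 3 * z / (4 * s ^ 2) - z ^ 3 / (8 * s ^ 3) = z * ((6 * s - z ^ 2) / (8 * s ^ 3)) := by
      field_simp
      ring
    rw [this, abs_mul]
    gcongr
    rw [abs_div, abs_of_pos (by positivity : 0 < 8 * s ^ 3), div_le_div_iff₀ (by positivity)
      (by positivity)]
    have : |6 * s - z ^ 2| ≤ 8 * (s + z ^ 2) := by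
      rw [abs_le]; constructor <;> nlinarith [sq_nonneg z]
    calc _ ≤ 8 * (s + z ^ 2) * s ^ 3 := by gcongr
      _ = _ := by ring
  have hmr : √s * |z| ≤ s + z ^ 2 := by
    nlinarith [sq_nonneg (√s - |z|), sq_abs z]
  rw [abs_mul, abs_of_nonneg (gk_nonneg s z)]
  calc _ ≤ |z| * ((s + z ^ 2) / s ^ 3) * (18432 * ((√s)⁻¹ * (s ^ 4 / (s + z ^ 2) ^ 4))) :=
        mul_le_mul h1 (gk_le hs z) (gk_nonneg _ _) (by positivity)
    _ = 18432 * ((√s * |z|) * ((√s ^ 2)⁻¹ * s) * (s + z ^ 2)⁻¹ * (s + z ^ 2)⁻¹ *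
        (s + z ^ 2)⁻¹) := by field_simp
    _ = 18432 * ((√s * |z|) * (s + z ^ 2)⁻¹ * (s + z ^ 2)⁻¹ * (s + z ^ 2)⁻¹) := by
        rw [hrs, inv_mul_cancel₀ hs.ne', mul_one]
    _ ≤ 18432 * ((s + z ^ 2) * (s + z ^ 2)⁻¹ * s⁻¹ * (s + z ^ 2)⁻¹) := by
        gcongr
        linarith [sq_nonneg z]
    _ = _ := by rw [mul_inv_cancel₀ hm.ne', one_mul]

theorem abs_hk_left_deriv_le {s : ℝ} (hs : 0 < s) (z : ℝ) :
    |(z ^ 4 / (16 * s ^ 4) - 3 * z ^ 2 / (4 * s ^ 3) + 3 / (4 * s ^ 2)) * gk s z| ≤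
      18432 * ((√s)⁻¹ * s⁻¹ * (s + z ^ 2)⁻¹) := by
  have hm : 0 < s + z ^ 2 := by positivity
  have hr := Real.sqrt_pos.2 hs
  have h1 : |z ^ 4 / (16 * s ^ 4) - 3 * z ^ 2 / (4 * s ^ 3) + 3 / (4 * s ^ 2)| ≤
      (s + z ^ 2) ^ 2 / s ^ 4 := by
    have : z ^ 4 / (16 * s ^ 4) - 3 * z ^ 2 / (4 * s ^ 3) + 3 / (4 * s ^ 2) =
        (z ^ 4 - 12 * s * z ^ 2 + 12 * s ^ 2) / (16 * s ^ 4) := by field_simp; ring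
    rw [this, abs_div, abs_of_pos (by positivity : 0 < 16 * s ^ 4), div_le_div_iff₀ (by positivity)
      (by positivity)]
    have : |z ^ 4 - 12 * s * z ^ 2 + 12 * s ^ 2| ≤ 16 * (s + z ^ 2) ^ 2 := by
      have h2 : 0 ≤ s * z ^ 2 := by positivity
      rw [abs_le]; constructor <;> nlinarith [sq_nonneg (z ^ 2), sq_nonneg s]
    calc _ ≤ 16 * (s + z ^ 2) ^ 2 * s ^ 4 := by gcongr
      _ = _ := by ring
  rw [abs_mul, abs_of_nonneg (gk_nonneg s z)]
  calc _ ≤ (s + z ^ 2) ^ 2 / s ^ 4 * (18432 * ((√s)⁻¹ * (s ^ 4 / (s + z ^ 2) ^ 4))) :=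
        mul_le_mul h1 (gk_le hs z) (gk_nonneg _ _) (by positivity)
    _ = 18432 * ((√s)⁻¹ * (s + z ^ 2)⁻¹ * (s + z ^ 2)⁻¹) := by field_simp
    _ ≤ 18432 * ((√s)⁻¹ * s⁻¹ * (s + z ^ 2)⁻¹) := by
        gcongr
        linarith [sq_nonneg z]

theorem integrable_gk {s : ℝ} (hs : 0 < s) : Integrable (gk s) := by
  have := (integrable_exp_neg_mul_sq (b := 1 / (4 * s)) (by positivity)).const_mul
    ((√(4 * Real.pi * s))⁻¹)
  convert this using 2 with z
  unfold gk
  congr 2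
  ring

theorem integral_gk {s : ℝ} (hs : 0 < s) : ∫ z, gk s z = 1 := by
  have hπ := Real.pi_pos
  have h : ∀ z, gk s z = (√(4 * Real.pi * s))⁻¹ * Real.exp (-(1 / (4 * s)) * z ^ 2) := by
    intro z
    unfold gk
    congr 2
    ring
  simp only [h]
  rw [integral_const_mul, integral_gaussian, show Real.pi / (1 / (4 * s)) = 4 * Real.pi * s by
    field_simp]
  exact inv_mul_cancel₀ (Real.sqrt_pos.2 (by positivity)).ne'

theorem integrable_inv_add_sq {s : ℝ} (hs : 0 < s) : Integrable fun z : ℝ => (s + z ^ 2)⁻¹ := by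
  have hr := Real.sqrt_pos.2 hs
  have h := (integrable_inv_one_add_sq.comp_div hr.ne').const_mul s⁻¹
  refine h.congr (ae_of_all _ fun z => ?_)
  simp only
  rw [div_pow, Real.sq_sqrt hs.le]
  field_simp

theorem integral_inv_add_sq {s : ℝ} (hs : 0 < s) :
    ∫ z : ℝ, (s + z ^ 2)⁻¹ = Real.pi * (√s)⁻¹ := by
  have hr := Real.sqrt_pos.2 hs
  have h : ∀ z : ℝ, (s + z ^ 2)⁻¹ = s⁻¹ * (1 + (z / √s) ^ 2)⁻¹ := by
    intro z
    rw [div_pow, Real.sq_sqrt hs.le]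
    field_simp
  simp only [h]
  rw [integral_const_mul, Measure.integral_comp_div (fun x : ℝ => (1 + x ^ 2)⁻¹),
    integral_univ_inv_one_add_sq, abs_of_pos hr, smul_eq_mul]
  nth_rw 1 [← Real.sq_sqrt hs.le]
  field_simp

theorem lintegral_inv_add_sq {s : ℝ} (hs : 0 < s) :
    ∫⁻ z : ℝ, ENNReal.ofReal (s + z ^ 2)⁻¹ = ENNReal.ofReal (Real.pi * (√s)⁻¹) := by
  rw [← ofReal_integral_eq_lintegral_ofReal (integrable_inv_add_sq hs)
    (ae_of_all _ fun z => by positivity), integral_inv_add_sq hs]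

theorem integrable_hk {s : ℝ} (hs : 0 < s) : Integrable (hk s) := by
  refine ((integrable_inv_add_sq hs).const_mul (18432 * (√s)⁻¹)).mono'
    (measurable_hk.comp (measurable_prodMk_left (x := s))).aestronglyMeasurable
    (ae_of_all _ fun z => ?_)
  rw [Real.norm_eq_abs, mul_assoc]
  exact abs_hk_le hs z

/-- The truncated kernel `1_{[ε,N]}(s) ∂²_z G_s(z)`. -/
noncomputable def kern (ε N : ℝ) (y : ℝ × ℝ) : ℝ := (Icc ε N).indicator (fun s => hk s y.2) y.1

theorem measurable_kern (ε N : ℝ) : Measurable (kern ε N) := by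
  have : kern ε N = {y : ℝ × ℝ | y.1 ∈ Icc ε N}.indicator (fun y => hk y.1 y.2) := by
    ext y
    rfl
  rw [this]
  exact measurable_hk.indicator (measurableSet_Icc.preimage measurable_fst)

theorem abs_kern_le {ε : ℝ} (hε : 0 < ε) (N : ℝ) (y : ℝ × ℝ) :
    |kern ε N y| ≤ (Icc ε N).indicator (fun _ => 18432 * (√ε)⁻¹) y.1 * (ε + y.2 ^ 2)⁻¹ := by
  unfold kern
  by_cases h : y.1 ∈ Icc ε N
  · rw [indicator_of_mem h, indicator_of_mem h]
    have h1 : 0 < y.1 := hε.trans_le h.1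
    refine (abs_hk_le h1 y.2).trans ?_
    rw [mul_assoc]
    have := Real.sqrt_pos.2 hε
    gcongr
    · exact h.1
    · exact h.1
  · rw [indicator_of_notMem h, indicator_of_notMem h]
    simp

theorem bounded_kern {ε : ℝ} (hε : 0 < ε) (N : ℝ) : ∃ M, ∀ y, |kern ε N y| ≤ M := by
  refine ⟨18432 * (√ε)⁻¹ * ε⁻¹, fun y => (abs_kern_le hε N y).trans ?_⟩
  gcongr
  · exact indicator_le_self' (fun _ _ => by positivity) _
  · linarith [sq_nonneg y.2]

theorem integrable_kern {ε : ℝ} (hε : 0 < ε) (N : ℝ) : Integrable (kern ε N) := by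
  have h1 : Integrable ((Icc ε N).indicator (fun _ => 18432 * (√ε)⁻¹)) :=
    (integrable_indicator_iff measurableSet_Icc).2 (integrableOn_const (by simp))
  refine (h1.mul_prod (integrable_inv_add_sq hε)).mono'
    (measurable_kern ε N).aestronglyMeasurable (ae_of_all _ fun y => ?_)
  exact abs_kern_le hε N y

theorem abs_hk_sub_right_le {s ρ x y : ℝ} (hs : 0 < s) (hy : |y| ≤ ρ) (hρ : 2 * ρ ^ 2 ≤ 2 * s) :
    |hk s (x + y) - hk s x| ≤ 18432 * 4 * (ρ * s⁻¹ * (s + x ^ 2)⁻¹) := by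
  have hρ0 : 0 ≤ ρ := (abs_nonneg _).trans hy
  have hy' := abs_le.1 hy
  have h := (convex_Icc (x - ρ) (x + ρ)).norm_image_sub_le_of_norm_hasDerivWithin_le
    (C := 18432 * 4 * (s⁻¹ * (s + x ^ 2)⁻¹)) (x := x) (y := x + y)
    (fun ξ _ => (hasDerivAt_hk_right hs ξ).hasDerivWithinAt) ?_
    ⟨by linarith, by linarith⟩ ⟨by linarith, by linarith⟩
  · rw [Real.norm_eq_abs, Real.norm_eq_abs, add_sub_cancel_left] at h
    calc _ ≤ _ := h
      _ ≤ 18432 * 4 * (s⁻¹ * (s + x ^ 2)⁻¹) * ρ := by gcongr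
      _ = _ := by ring
  · intro ξ hξ
    refine (abs_hk_right_deriv_le hs ξ).trans ?_
    have h1 : |x - ξ| ≤ ρ := abs_le.2 ⟨by linarith [hξ.2], by linarith [hξ.1]⟩
    have h2 : (x - ξ) ^ 2 ≤ ρ ^ 2 := sq_le_sq' (by linarith [(abs_le.1 h1).1])
      (by linarith [(abs_le.1 h1).2])
    have h3 : (s + ξ ^ 2)⁻¹ ≤ 4 * (s + x ^ 2)⁻¹ := by
      rw [← div_eq_mul_inv, inv_eq_one_div, div_le_div_iff₀ (by positivity) (by positivity)]
      nlinarith [sq_nonneg (x - 2 * ξ)]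
    calc _ ≤ 18432 * (s⁻¹ * (4 * (s + x ^ 2)⁻¹)) := by gcongr
      _ = _ := by ring

theorem abs_hk_sub_left_le {s ρ x σ : ℝ} (hs : 0 < s) (hσ : |σ| ≤ ρ ^ 2) (hρ : 2 * ρ ^ 2 ≤ s) :
    |hk (s + σ) x - hk s x| ≤ 18432 * 8 * (ρ ^ 2 * ((√s)⁻¹ * s⁻¹) * (s + x ^ 2)⁻¹) := by
  have hσ' := abs_le.1 hσ
  have h := (convex_Icc (s / 2) (2 * s)).norm_image_sub_le_of_norm_hasDerivWithin_le
    (f := fun s => hk s x) (C := 18432 * 8 * ((√s)⁻¹ * s⁻¹ * (s + x ^ 2)⁻¹)) (x := s) (y := s + σ)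
    (fun ξ hξ => (hasDerivAt_hk_left (by linarith [hξ.1]) x).hasDerivWithinAt) ?_
    ⟨by linarith, by linarith⟩ ⟨by linarith, by linarith⟩
  · rw [Real.norm_eq_abs, Real.norm_eq_abs, add_sub_cancel_left] at h
    calc _ ≤ _ := h
      _ ≤ 18432 * 8 * ((√s)⁻¹ * s⁻¹ * (s + x ^ 2)⁻¹) * ρ ^ 2 := by gcongr
      _ = _ := by ring
  · intro ξ hξ
    have hξ0 : 0 < ξ := by linarith [hξ.1]
    refine (abs_hk_left_deriv_le hξ0 x).trans ?_
    have h1 : ξ⁻¹ ≤ 2 * s⁻¹ := by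
      rw [← div_eq_mul_inv, inv_eq_one_div, div_le_div_iff₀ (by positivity) (by positivity)]
      linarith [hξ.1]
    have h2 : (ξ + x ^ 2)⁻¹ ≤ 2 * (s + x ^ 2)⁻¹ := by
      rw [← div_eq_mul_inv, inv_eq_one_div, div_le_div_iff₀ (by positivity) (by positivity)]
      nlinarith [hξ.1]
    have h3 : (√ξ)⁻¹ ≤ 2 * (√s)⁻¹ := by
      have := Real.sqrt_pos.2 hξ0
      have := Real.sqrt_pos.2 hs
      rw [← div_eq_mul_inv, inv_eq_one_div, div_le_div_iff₀ (by positivity) (by positivity),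
        one_mul]
      rw [Real.sqrt_le_left (by positivity), mul_pow, Real.sq_sqrt hξ0.le]
      linarith [hξ.1]
    calc _ ≤ 18432 * (2 * (√s)⁻¹ * (2 * s⁻¹) * (2 * (s + x ^ 2)⁻¹)) := by gcongr
      _ = _ := by ring

theorem abs_hk_sub_le {s ρ x y σ : ℝ} (hs : 0 < s) (hσ : |σ| ≤ ρ ^ 2) (hy : |y| ≤ ρ)
    (hρ : 2 * ρ ^ 2 ≤ s) :
    |hk (s + σ) (x + y) - hk s x| ≤
      18432 * 16 * ((ρ * s⁻¹ + ρ ^ 2 * ((√s)⁻¹ * s⁻¹)) * (s + x ^ 2)⁻¹) := by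
  have hσ' := abs_le.1 hσ
  have hρ0 : 0 ≤ ρ := (abs_nonneg _).trans hy
  have hs' : s / 2 ≤ s + σ := by linarith
  have hs'0 : 0 < s + σ := by linarith
  have h1 := abs_hk_sub_right_le (x := x) hs'0 hy (by linarith)
  have h2 := abs_hk_sub_left_le (x := x) hs hσ hρ
  have h3 : (s + σ)⁻¹ ≤ 2 * s⁻¹ := by
    rw [← div_eq_mul_inv, inv_eq_one_div, div_le_div_iff₀ (by positivity) (by positivity)]
    linarith
  have h4 : (s + σ + x ^ 2)⁻¹ ≤ 2 * (s + x ^ 2)⁻¹ := by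
    rw [← div_eq_mul_inv, inv_eq_one_div, div_le_div_iff₀ (by positivity) (by positivity)]
    nlinarith
  have h5 : 18432 * 4 * (ρ * (s + σ)⁻¹ * (s + σ + x ^ 2)⁻¹) ≤
      18432 * 16 * (ρ * s⁻¹ * (s + x ^ 2)⁻¹) := by
    calc _ ≤ 18432 * 4 * (ρ * (2 * s⁻¹) * (2 * (s + x ^ 2)⁻¹)) := by gcongr
      _ = _ := by ring
  have h6 : 0 ≤ ρ ^ 2 * ((√s)⁻¹ * s⁻¹) * (s + x ^ 2)⁻¹ := by positivity
  have h7 : |hk (s + σ) (x + y) - hk s x| ≤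
      |hk (s + σ) (x + y) - hk (s + σ) x| + |hk (s + σ) x - hk s x| := abs_sub_le _ _ _
  rw [add_mul]
  linarith

/-- Times at which a shift by at most `ρ²` may cross the truncation. -/
def edgeSet (ε N ρ : ℝ) : Set ℝ :=
  Icc (ε - ρ ^ 2) (ε + ρ ^ 2) ∪ Icc (N - ρ ^ 2) (N + ρ ^ 2)

theorem volume_edgeSet_le (ε N ρ : ℝ) : volume (edgeSet ε N ρ) ≤ ENNReal.ofReal (4 * ρ ^ 2) := by
  refine (measure_union_le _ _).trans ?_
  rw [Real.volume_Icc, Real.volume_Icc, ← ENNReal.ofReal_add (by nlinarith) (by nlinarith)]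
  apply ENNReal.ofReal_le_ofReal
  linarith

theorem kern_diff_far {ε N ρ s x σ y : ℝ} (hs : 0 < s) (hσ : |σ| ≤ ρ ^ 2)
    (hy : |y| ≤ ρ) (hρ : 2 * ρ ^ 2 ≤ s) :
    |kern ε N ((s, x) + (σ, y)) - kern ε N (s, x)| ≤
      18432 * 16 * ((ρ * s⁻¹ + ρ ^ 2 * ((√s)⁻¹ * s⁻¹)) * (s + x ^ 2)⁻¹) +
      (edgeSet ε N ρ).indicator (fun s => 18432 * ((√s)⁻¹ * (s + x ^ 2)⁻¹)) s := by
  have hσ' := abs_le.1 hσ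
  have h1 := abs_hk_sub_le (x := x) hs hσ hy hρ
  have h2 := abs_hk_le hs x
  have hρ0 : 0 ≤ ρ := (abs_nonneg _).trans hy
  have h3 : 0 ≤ (edgeSet ε N ρ).indicator (fun s => 18432 * ((√s)⁻¹ * (s + x ^ 2)⁻¹)) s :=
    indicator_apply_nonneg fun _ => by positivity
  have h4 := abs_nonneg (hk (s + σ) (x + y) - hk s x)
  unfold kern
  simp only [Prod.mk_add_mk]
  by_cases ha : s + σ ∈ Icc ε N <;> by_cases hb : s ∈ Icc ε N
  · rw [indicator_of_mem ha, indicator_of_mem hb]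
    linarith
  · rw [indicator_of_mem ha, indicator_of_notMem hb, sub_zero, indicator_of_mem]
    · have := abs_sub_abs_le_abs_sub (hk (s + σ) (x + y)) (hk s x)
      linarith
    · rw [mem_Icc, not_and_or, not_le, not_le] at hb
      rcases hb with hb | hb
      · exact Or.inl ⟨by linarith [ha.1], by linarith [ha.1]⟩
      · exact Or.inr ⟨by linarith [ha.2], by linarith [ha.2]⟩
  · rw [indicator_of_notMem ha, indicator_of_mem hb, zero_sub, abs_neg, indicator_of_mem]
    · linarith
    · rw [mem_Icc, not_and_or, not_le, not_le] at ha
      rcases ha with ha | ha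
      · exact Or.inl ⟨by linarith [hb.1], by linarith [hb.1]⟩
      · exact Or.inr ⟨by linarith [hb.2], by linarith [hb.2]⟩
  · rw [indicator_of_notMem ha, indicator_of_notMem hb, sub_zero, abs_zero]
    linarith

theorem abs_kern_le_cube {ε : ℝ} (hε : 0 < ε) (N : ℝ) {y : ℝ × ℝ} (hy : y.2 ≠ 0) :
    |kern ε N y| ≤ 18432 * (|y.2| ^ 3)⁻¹ := by
  unfold kern
  by_cases h : y.1 ∈ Icc ε N
  · rw [indicator_of_mem h]
    exact abs_hk_le_cube (hε.trans_le h.1) hy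
  · rw [indicator_of_notMem h, abs_zero]
    positivity

theorem kern_diff_near {ε N ρ s x σ y : ℝ} (hε : 0 < ε) (hρ : 0 < ρ)
    (hy : |y| ≤ ρ) (hx : 2 * ρ ≤ |x|) :
    |kern ε N ((s, x) + (σ, y)) - kern ε N (s, x)| ≤ 18432 * 9 * (|x| ^ 3)⁻¹ := by
  have hx0 : 0 < |x| := by linarith
  have hxy : |x| / 2 ≤ |x + y| := by
    have := abs_sub_abs_le_abs_sub x (-y)
    rw [abs_neg, sub_neg_eq_add] at this
    linarith
  have hxy0 : 0 < |x + y| := by linarith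
  have h1 := abs_kern_le_cube hε N (y := (s, x)) (abs_pos.1 hx0)
  have h2 := abs_kern_le_cube hε N (y := (s, x) + (σ, y)) (abs_pos.1 hxy0)
  simp only [Prod.mk_add_mk] at h1 h2 ⊢
  have h3 : (|x + y| ^ 3)⁻¹ ≤ 8 * (|x| ^ 3)⁻¹ := by
    calc _ ≤ ((|x| / 2) ^ 3)⁻¹ := by gcongr
      _ = _ := by field_simp; norm_num
  have := abs_sub (kern ε N (s + σ, x + y)) (kern ε N (s, x))
  linarith

theorem kern_diff_neg {ε N ρ s x σ y : ℝ} (hε : 0 < ε) (hσ : |σ| ≤ ρ ^ 2) (hs : s ≤ -(2 * ρ ^ 2)) :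
    kern ε N ((s, x) + (σ, y)) - kern ε N (s, x) = 0 := by
  have hσ' := abs_le.1 hσ
  unfold kern
  rw [indicator_of_notMem, indicator_of_notMem, sub_zero]
  · simp only [mem_Icc, not_and_or, not_le]
    left; nlinarith [sq_nonneg ρ]
  · simp only [Prod.mk_add_mk, mem_Icc, not_and_or, not_le]
    left; nlinarith [sq_nonneg ρ]

theorem inv_sqrt_mul_inv {s : ℝ} (hs : 0 < s) : (√s)⁻¹ * s⁻¹ = s ^ (-(3 / 2) : ℝ) := by
  rw [Real.rpow_neg hs.le, ← mul_inv, Real.sqrt_eq_rpow, ← Real.rpow_add_one hs.ne']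
  norm_num

theorem lintegral_inv_cube {ρ : ℝ} (hρ : 0 < ρ) :
    ∫⁻ x in {x : ℝ | 2 * ρ ≤ |x|}, ENNReal.ofReal (|x| ^ 3)⁻¹ = ENNReal.ofReal ((4 * ρ ^ 2)⁻¹) := by
  have hset : {x : ℝ | 2 * ρ ≤ |x|} = Ici (2 * ρ) ∪ Iic (-(2 * ρ)) := by
    ext x
    simp only [mem_ofPred_eq, mem_union, mem_Ici, mem_Iic, le_abs]
    rw [le_neg (a := x)]
  have hpos : ∫⁻ x in Ici (2 * ρ), ENNReal.ofReal (|x| ^ 3)⁻¹ = ENNReal.ofReal ((8 * ρ ^ 2)⁻¹) := by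
    calc _ = ∫⁻ x in Ici (2 * ρ), ENNReal.ofReal (x ^ (-3 : ℝ)) := by
          apply setLIntegral_congr_fun measurableSet_Ici
          intro x hx
          have hx0 : 0 < x := by have : 2 * ρ ≤ x := hx; linarith
          simp only
          rw [abs_of_pos hx0, Real.rpow_neg hx0.le]
          norm_cast
      _ = _ := by
          rw [lintegral_Ici_rpow (by norm_num) (by positivity)]
          congr 1
          rw [show (-3 + 1 : ℝ) = -2 by norm_num, Real.rpow_neg (by positivity)]
          norm_cast
          field_simp
          norm_num
  have hneg : ∫⁻ x in Iic (-(2 * ρ)), ENNReal.ofReal (|x| ^ 3)⁻¹ =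
      ENNReal.ofReal ((8 * ρ ^ 2)⁻¹) := by
    rw [← hpos, ← lintegral_indicator measurableSet_Ici, ← lintegral_indicator measurableSet_Iic,
      ← lintegral_neg_eq_self]
    apply lintegral_congr
    intro x
    simp only [indicator, mem_Iic, mem_Ici, neg_le_neg_iff, abs_neg]
  have hd : Disjoint (Ici (2 * ρ)) (Iic (-(2 * ρ))) := by
    rw [Set.disjoint_left]
    intro x h1 h2
    have h1 : 2 * ρ ≤ x := h1
    have h2 : x ≤ -(2 * ρ) := h2
    linarith
  rw [hset, lintegral_union measurableSet_Iic hd, hpos, hneg,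
    ← ENNReal.ofReal_add (by positivity) (by positivity)]
  congr 1
  field_simp
  norm_num

/-- Far-in-time part of the Hörmander integral. -/
theorem lintegral_far_le (ε N : ℝ) {ρ : ℝ} (hρ : 0 < ρ) :
    ∫⁻ z in Ici (2 * ρ ^ 2) ×ˢ (univ : Set ℝ), ENNReal.ofReal (
      18432 * 16 * ((ρ * z.1⁻¹ + ρ ^ 2 * ((√z.1)⁻¹ * z.1⁻¹)) * (z.1 + z.2 ^ 2)⁻¹) +
      (edgeSet ε N ρ).indicator (fun s => 18432 * ((√s)⁻¹ * (s + z.2 ^ 2)⁻¹)) z.1) ≤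
      ENNReal.ofReal (18432 * 16 * 5 * Real.pi) := by
  have hπ := Real.pi_pos
  have hE : MeasurableSet (edgeSet ε N ρ) := measurableSet_Icc.union measurableSet_Icc
  have hρ2 : 0 < 2 * ρ ^ 2 := by positivity
  set C : ℝ := 18432 * 16 * Real.pi with hC
  have hC0 : 0 < C := by positivity
  rw [Measure.volume_eq_prod, ← Measure.prod_restrict, Measure.restrict_univ, lintegral_prod]
  swap
  · apply Measurable.aemeasurable
    apply Measurable.ennreal_ofReal
    apply Measurable.add (by fun_prop)
    have : (fun z : ℝ × ℝ => (edgeSet ε N ρ).indicator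
        (fun s => 18432 * ((√s)⁻¹ * (s + z.2 ^ 2)⁻¹)) z.1) =
        {z : ℝ × ℝ | z.1 ∈ edgeSet ε N ρ}.indicator
        (fun z => 18432 * ((√z.1)⁻¹ * (z.1 + z.2 ^ 2)⁻¹)) := by
      ext z; rfl
    rw [this]
    exact Measurable.indicator (by fun_prop) (hE.preimage measurable_fst)
  have hin : ∀ s ∈ Ici (2 * ρ ^ 2), ∫⁻ x : ℝ, ENNReal.ofReal (
      18432 * 16 * ((ρ * s⁻¹ + ρ ^ 2 * ((√s)⁻¹ * s⁻¹)) * (s + x ^ 2)⁻¹) +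
      (edgeSet ε N ρ).indicator (fun s => 18432 * ((√s)⁻¹ * (s + x ^ 2)⁻¹)) s) ≤
      ENNReal.ofReal (C * ρ) * ENNReal.ofReal (s ^ (-(3 / 2) : ℝ)) +
      ENNReal.ofReal (C * ρ ^ 2) * ENNReal.ofReal (s ^ (-2 : ℝ)) +
      (edgeSet ε N ρ).indicator (fun _ => ENNReal.ofReal (C * (2 * ρ ^ 2)⁻¹)) s := by
    intro s hs
    have hs' : 2 * ρ ^ 2 ≤ s := hs
    have hs0 : 0 < s := by linarith
    have hr := Real.sqrt_pos.2 hs0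
    have hrr : (√s)⁻¹ * (√s)⁻¹ = s⁻¹ := by rw [← mul_inv, Real.mul_self_sqrt hs0.le]
    set I : ℝ := (edgeSet ε N ρ).indicator (fun _ => 18432 * (√s)⁻¹) s with hI
    have hI0 : 0 ≤ I := indicator_apply_nonneg fun _ => by positivity
    have e1 : ∀ x : ℝ, 18432 * 16 * ((ρ * s⁻¹ + ρ ^ 2 * ((√s)⁻¹ * s⁻¹)) * (s + x ^ 2)⁻¹) +
        (edgeSet ε N ρ).indicator (fun s => 18432 * ((√s)⁻¹ * (s + x ^ 2)⁻¹)) s =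
        (18432 * 16 * (ρ * s⁻¹ + ρ ^ 2 * ((√s)⁻¹ * s⁻¹)) + I) * (s + x ^ 2)⁻¹ := by
      intro x
      rw [hI]
      by_cases h : s ∈ edgeSet ε N ρ
      · rw [indicator_of_mem h, indicator_of_mem h]; ring
      · rw [indicator_of_notMem h, indicator_of_notMem h]; ring
    simp only [e1]
    have hcoef : 0 ≤ 18432 * 16 * (ρ * s⁻¹ + ρ ^ 2 * ((√s)⁻¹ * s⁻¹)) + I := by positivity
    simp only [ENNReal.ofReal_mul hcoef]
    rw [lintegral_const_mul' _ _ ENNReal.ofReal_ne_top, lintegral_inv_add_sq hs0,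
      ← ENNReal.ofReal_mul hcoef]
    have e2 : (18432 * 16 * (ρ * s⁻¹ + ρ ^ 2 * ((√s)⁻¹ * s⁻¹)) + I) * (Real.pi * (√s)⁻¹) =
        C * ρ * ((√s)⁻¹ * s⁻¹) + C * ρ ^ 2 * (((√s)⁻¹ * (√s)⁻¹) * s⁻¹) +
        I * (Real.pi * (√s)⁻¹) := by rw [hC]; ring
    have e3 : s⁻¹ * s⁻¹ = s ^ (-2 : ℝ) := by
      rw [Real.rpow_neg hs0.le]; norm_cast; rw [pow_two, mul_inv]
    rw [e2, hrr, inv_sqrt_mul_inv hs0, e3, ENNReal.ofReal_add (by positivity) (by positivity),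
      ENNReal.ofReal_add (by positivity) (by positivity), ENNReal.ofReal_mul (by positivity),
      ENNReal.ofReal_mul (q := s ^ (-2 : ℝ)) (by positivity)]
    gcongr
    rw [hI]
    by_cases h : s ∈ edgeSet ε N ρ
    · rw [indicator_of_mem h, indicator_of_mem h]
      apply ENNReal.ofReal_le_ofReal
      calc 18432 * (√s)⁻¹ * (Real.pi * (√s)⁻¹) = 18432 * Real.pi * ((√s)⁻¹ * (√s)⁻¹) := by ring
        _ = 18432 * Real.pi * s⁻¹ := by rw [hrr]
        _ ≤ C * (2 * ρ ^ 2)⁻¹ := by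
          gcongr
          rw [hC]
          nlinarith
    · rw [indicator_of_notMem h, zero_mul, ENNReal.ofReal_zero]
      exact zero_le
  calc _ ≤ ∫⁻ s in Ici (2 * ρ ^ 2), (ENNReal.ofReal (C * ρ) * ENNReal.ofReal (s ^ (-(3 / 2) : ℝ)) +
      ENNReal.ofReal (C * ρ ^ 2) * ENNReal.ofReal (s ^ (-2 : ℝ)) +
      (edgeSet ε N ρ).indicator (fun _ => ENNReal.ofReal (C * (2 * ρ ^ 2)⁻¹)) s) :=
        setLIntegral_mono' measurableSet_Ici hin
    _ = ENNReal.ofReal (C * ρ) *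
        ENNReal.ofReal ((2 * ρ ^ 2) ^ (-(3 / 2) + 1 : ℝ) / (-(-(3 / 2) + 1))) +
      ENNReal.ofReal (C * ρ ^ 2) * ENNReal.ofReal ((2 * ρ ^ 2) ^ (-2 + 1 : ℝ) / (-(-2 + 1))) +
      ∫⁻ s in Ici (2 * ρ ^ 2),
        (edgeSet ε N ρ).indicator (fun _ => ENNReal.ofReal (C * (2 * ρ ^ 2)⁻¹)) s := by
        rw [lintegral_add_left (by fun_prop), lintegral_add_left (by fun_prop),
          lintegral_const_mul _ (by fun_prop), lintegral_const_mul _ (by fun_prop),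
          lintegral_Ici_rpow (by norm_num) hρ2, lintegral_Ici_rpow (by norm_num) hρ2]
    _ ≤ ENNReal.ofReal (2 * C) + ENNReal.ofReal C + ENNReal.ofReal (2 * C) := by
        gcongr ?_ + ?_ + ?_
        · rw [← ENNReal.ofReal_mul (by positivity)]
          apply ENNReal.ofReal_le_ofReal
          have h1 : (2 * ρ ^ 2) ^ (-(3 / 2) + 1 : ℝ) ≤ ρ⁻¹ := by
            rw [show (-(3 / 2) + 1 : ℝ) = -(1 / 2) by norm_num, Real.rpow_neg hρ2.le,
              ← Real.sqrt_eq_rpow]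
            gcongr
            exact Real.le_sqrt_of_sq_le (by nlinarith)
          calc _ ≤ C * ρ * (ρ⁻¹ / (-(-(3 / 2) + 1))) := by
                gcongr
            _ = 2 * C := by field_simp; norm_num
        · rw [← ENNReal.ofReal_mul (by positivity)]
          apply ENNReal.ofReal_le_ofReal
          rw [show (-2 + 1 : ℝ) = -1 by norm_num, Real.rpow_neg_one]
          field_simp
          norm_num
        · calc _ ≤ ∫⁻ s,
              (edgeSet ε N ρ).indicator (fun _ => ENNReal.ofReal (C * (2 * ρ ^ 2)⁻¹)) s :=
                setLIntegral_le_lintegral _ _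
            _ = ENNReal.ofReal (C * (2 * ρ ^ 2)⁻¹) * volume (edgeSet ε N ρ) := by
                rw [lintegral_indicator hE, setLIntegral_const]
            _ ≤ ENNReal.ofReal (C * (2 * ρ ^ 2)⁻¹) * ENNReal.ofReal (4 * ρ ^ 2) := by
                gcongr; exact volume_edgeSet_le _ _ _
            _ = _ := by
                rw [← ENNReal.ofReal_mul (by positivity)]
                congr 1
                field_simp
                norm_num
    _ = _ := by
        rw [← ENNReal.ofReal_add (by positivity) (by positivity),
          ← ENNReal.ofReal_add (by positivity) (by positivity)]
        congr 1
        rw [hC]; ring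

/-- The Hörmander constant of the truncated heat kernels. -/
noncomputable def heatB : ℝ≥0 := (18432 * 16 * 5 * Real.pi + 18432 * 9).toNNReal

theorem kern_hormander {ε N : ℝ} (hε : 0 < ε) {ρ : ℝ} (hρ : 0 < ρ) (η : ℝ × ℝ)
    (h1 : |η.1| ≤ ρ ^ 2) (h2 : |η.2| ≤ ρ) :
    ∫⁻ z in (pbox ρ)ᶜ, ‖kern ε N (z + η) - kern ε N z‖ₑ ≤ heatB := by
  have hρ2 : 0 < 2 * ρ ^ 2 := by positivity
  set S₁ : Set (ℝ × ℝ) := Ici (2 * ρ ^ 2) ×ˢ univ with hS₁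
  set S₂ : Set (ℝ × ℝ) := Icc (-(2 * ρ ^ 2)) (2 * ρ ^ 2) ×ˢ {x : ℝ | 2 * ρ ≤ |x|} with hS₂
  set S₃ : Set (ℝ × ℝ) := Iic (-(2 * ρ ^ 2)) ×ˢ univ with hS₃
  have hm2 : MeasurableSet {x : ℝ | 2 * ρ ≤ |x|} := measurableSet_le (by fun_prop) (by fun_prop)
  have hmS₁ : MeasurableSet S₁ := measurableSet_Ici.prod MeasurableSet.univ
  have hmS₂ : MeasurableSet S₂ := measurableSet_Icc.prod hm2
  have hmS₃ : MeasurableSet S₃ := measurableSet_Iic.prod MeasurableSet.univ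
  have hcov : (pbox ρ)ᶜ ⊆ S₁ ∪ (S₂ ∪ S₃) := by
    rintro ⟨s, x⟩ hz
    simp only [pbox, mem_compl_iff, mem_prod, mem_Ioo] at hz
    simp only [hS₁, hS₂, hS₃, mem_union, mem_prod, mem_Ici, mem_univ, and_true, mem_Icc, mem_Iic,
      mem_ofPred_eq]
    by_contra! hcon
    obtain ⟨ha, hb, hc⟩ := hcon
    have hd := abs_lt.1 (hb ⟨hc.le, ha.le⟩)
    exact hz ⟨⟨hc, ha⟩, hd.1, hd.2⟩
  have b1 : ∫⁻ z in S₁, ‖kern ε N (z + η) - kern ε N z‖ₑ ≤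
      ENNReal.ofReal (18432 * 16 * 5 * Real.pi) := by
    refine le_trans (setLIntegral_mono' hmS₁ ?_) (lintegral_far_le ε N hρ)
    rintro ⟨s, x⟩ hz
    have hs : 2 * ρ ^ 2 ≤ s := hz.1
    rw [Real.enorm_eq_ofReal_abs]
    exact ENNReal.ofReal_le_ofReal (kern_diff_far (by linarith) h1 h2 hs)
  have b2 : ∫⁻ z in S₂, ‖kern ε N (z + η) - kern ε N z‖ₑ ≤ ENNReal.ofReal (18432 * 9) := by
    calc _ ≤ ∫⁻ z in S₂, ENNReal.ofReal (18432 * 9) * ENNReal.ofReal (|z.2| ^ 3)⁻¹ := by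
          apply setLIntegral_mono' hmS₂
          rintro ⟨s, x⟩ hz
          rw [Real.enorm_eq_ofReal_abs, ← ENNReal.ofReal_mul (by norm_num)]
          exact ENNReal.ofReal_le_ofReal (kern_diff_near hε hρ h2 hz.2)
      _ = ENNReal.ofReal (18432 * 9) * (ENNReal.ofReal ((4 * ρ ^ 2)⁻¹) *
            ENNReal.ofReal (4 * ρ ^ 2)) := by
          rw [lintegral_const_mul _ (by fun_prop), hS₂, Measure.volume_eq_prod,
            ← Measure.prod_restrict, lintegral_prod _ (by fun_prop)]
          simp only [lintegral_inv_cube hρ]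
          rw [setLIntegral_const, Real.volume_Icc]
          congr 4
          ring
      _ = _ := by
          rw [← ENNReal.ofReal_mul (by positivity), inv_mul_cancel₀ (by positivity)]
          simp
  have b3 : ∫⁻ z in S₃, ‖kern ε N (z + η) - kern ε N z‖ₑ = 0 := by
    rw [setLIntegral_congr_fun (g := fun _ => 0) hmS₃]
    · simp
    · rintro ⟨s, x⟩ hz
      simp only
      rw [kern_diff_neg hε h1 hz.1, enorm_zero]
  calc _ ≤ ∫⁻ z in S₁ ∪ (S₂ ∪ S₃), ‖kern ε N (z + η) - kern ε N z‖ₑ := lintegral_mono_set hcov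
    _ ≤ _ := (lintegral_union_le _ _ _).trans (add_le_add_right (lintegral_union_le _ _ _) _)
    _ ≤ ENNReal.ofReal (18432 * 16 * 5 * Real.pi) + (ENNReal.ofReal (18432 * 9) + 0) := by
        rw [b3]; gcongr
    _ = heatB := by
        rw [add_zero, ← ENNReal.ofReal_add (by positivity) (by positivity)]
        rfl

section DirectionalDerivative

variable {E : Type*} [NormedAddCommGroup E] [NormedSpace ℝ E]

/-- The derivative of `f` in the direction `v`. -/
noncomputable def dd (v : E) (f : E → ℝ) (w : E) : ℝ := fderiv ℝ f w v

theorem contDiff_dd (v : E) {f : E → ℝ} (hf : ContDiff ℝ (⊤ : ℕ∞) f) :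
    ContDiff ℝ (⊤ : ℕ∞) (dd v f) :=
  (hf.fderiv_right (m := (⊤ : ℕ∞)) (by simp)).clm_apply contDiff_const

theorem hasCompactSupport_dd (v : E) {f : E → ℝ} (hf : HasCompactSupport f) :
    HasCompactSupport (dd v f) := hf.fderiv_apply ℝ v

theorem dd_comm (v w : E) {f : E → ℝ} (hf : ContDiff ℝ (⊤ : ℕ∞) f) :
    dd v (dd w f) = dd w (dd v f) := by
  have h (a b : E) (x : E) : dd a (dd b f) x = fderiv ℝ (fderiv ℝ f) x a b := by
    have h1 : DifferentiableAt ℝ (fderiv ℝ f) x :=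
      ((hf.fderiv_right (m := (⊤ : ℕ∞)) (by simp)).differentiable (by simp)).differentiableAt
    unfold dd
    rw [fderiv_clm_apply h1 (differentiableAt_const b)]
    simp
  ext x
  rw [h, h]
  exact ((contDiff_infty.1 hf 2).contDiffAt.isSymmSndFDerivAt (by simp)) v w

theorem hasDerivAt_line {f : E → ℝ} (hf : ContDiff ℝ (⊤ : ℕ∞) f) (v w : E) (t : ℝ) :
    HasDerivAt (fun t : ℝ => f (w + t • v)) (dd v f (w + t • v)) t := by
  have h1 : HasFDerivAt f (fderiv ℝ f (w + t • v)) (w + t • v) :=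
    (hf.differentiable (by simp)).differentiableAt.hasFDerivAt
  have h2 : HasDerivAt (fun t : ℝ => w + t • v) v t := by
    simpa using ((hasDerivAt_id t).smul_const v).const_add w
  exact h1.comp_hasDerivAt t h2

end DirectionalDerivative

theorem exists_bound_of_hasCompactSupport {E : Type*} [NormedAddCommGroup E] {f : E → ℝ} (hf : Continuous f)
    (hc : HasCompactSupport f) : ∃ M, ∀ z, |f z| ≤ M := by
  obtain ⟨M, hM⟩ := hc.exists_bound_of_continuous hf
  exact ⟨M, hM⟩

theorem integral_corr_dd_mul {K f g : ℝ × ℝ → ℝ} (hK : Measurable K) (hKi : Integrable K)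
    (hKb : ∃ M, ∀ z, |K z| ≤ M) (v : ℝ × ℝ)
    (hf : ContDiff ℝ (⊤ : ℕ∞) f) (hfc : HasCompactSupport f)
    (hg : ContDiff ℝ (⊤ : ℕ∞) g) (hgc : HasCompactSupport g) :
    ∫ w, corr K f w * corr K (dd v g) w = -∫ w, corr K (dd v f) w * corr K g w := by
  have key {h : ℝ × ℝ → ℝ} (hh : ContDiff ℝ (⊤ : ℕ∞) h) (hhc : HasCompactSupport h) :
      Differentiable ℝ (corr K h) ∧ ∀ w, fderiv ℝ (corr K h) w v = corr K (dd v h) w := by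
    have hconv (φ : ℝ × ℝ → ℝ) : corr K φ =
        convolution (fun z => K (-z)) φ (ContinuousLinearMap.mul ℝ ℝ) volume := by
      ext w
      rw [convolution, corr, ← integral_neg_eq_self]
      simp [sub_eq_add_neg]
    have hl : LocallyIntegrable (fun z => K (-z)) := hKi.comp_neg.locallyIntegrable
    have hd := hhc.hasFDerivAt_convolution_right (ContinuousLinearMap.mul ℝ ℝ) hl
      (hh.of_le (by simp))
    rw [hconv]
    refine ⟨fun w => (hd w).differentiableAt, fun w => ?_⟩
    rw [(hd w).fderiv, convolution_precompR_apply _ hl (hhc.fderiv ℝ)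
      (hh.continuous_fderiv (by simp)), hconv]
    rfl
  have int {h₁ h₂ : ℝ × ℝ → ℝ} (hh₁ : ContDiff ℝ (⊤ : ℕ∞) h₁) (hhc₁ : HasCompactSupport h₁)
      (hh₂ : ContDiff ℝ (⊤ : ℕ∞) h₂) (hhc₂ : HasCompactSupport h₂) :
      Integrable fun w => corr K h₁ w * corr K h₂ w := by
    have h1 := hh₁.continuous.integrable_of_hasCompactSupport hhc₁ (μ := volume)
    have h2 := hh₂.continuous.integrable_of_hasCompactSupport hhc₂ (μ := volume)
    obtain ⟨M, hM⟩ := bounded_corr hKb h1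
    exact (integrable_corr hK hKi h2).bdd_mul (c := M) (aestronglyMeasurable_corr hK h1.1)
      (ae_of_all _ hM)
  obtain ⟨hf1, hf2⟩ := key hf hfc
  obtain ⟨hg1, hg2⟩ := key hg hgc
  simp only [← hf2, ← hg2]
  apply integral_mul_fderiv_eq_neg_fderiv_mul_of_integrable
  · simp only [hf2]
    exact int (contDiff_dd v hf) (hasCompactSupport_dd v hfc) hg hgc
  · simp only [hg2]
    exact int hf hfc (contDiff_dd v hg) (hasCompactSupport_dd v hgc)
  · exact int hf hfc hg hgc
  · exact fun x _ => hf1 x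
  · exact fun x _ => hg1 x

theorem integral_corr_dd_dd_mul_eq_zero {K f : ℝ × ℝ → ℝ} (hK : Measurable K)
    (hKi : Integrable K) (hKb : ∃ M, ∀ z, |K z| ≤ M) (v v' : ℝ × ℝ)
    (hf : ContDiff ℝ (⊤ : ℕ∞) f) (hfc : HasCompactSupport f) :
    ∫ w, corr K (dd v (dd v f)) w * corr K (dd v' f) w = 0 := by
  have hv := contDiff_dd v hf
  have hvc := hasCompactSupport_dd v hfc
  have h1 := integral_corr_dd_mul hK hKi hKb v hv hvc (contDiff_dd v' hf)
    (hasCompactSupport_dd v' hfc)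
  have h2 := integral_corr_dd_mul hK hKi hKb v' hv hvc hv hvc
  rw [dd_comm v v' hf] at h1
  have h3 : ∫ w, corr K (dd v' (dd v f)) w * corr K (dd v f) w =
      ∫ w, corr K (dd v f) w * corr K (dd v' (dd v f)) w :=
    integral_congr_ae (ae_of_all _ fun w => mul_comm _ _)
  linarith

/-- The truncated heat kernel `1_{[ε,N]}(s) G_s(z)`. -/
noncomputable def gkern (ε N : ℝ) (y : ℝ × ℝ) : ℝ := (Icc ε N).indicator (fun s => gk s y.2) y.1

theorem measurable_gkern (ε N : ℝ) : Measurable (gkern ε N) := by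
  have : gkern ε N = {y : ℝ × ℝ | y.1 ∈ Icc ε N}.indicator (fun y => gk y.1 y.2) := by
    ext y
    rfl
  rw [this]
  exact measurable_gk.indicator (measurableSet_Icc.preimage measurable_fst)

theorem gk_le_inv {ε s : ℝ} (hε : 0 < ε) (hs : ε ≤ s) (z : ℝ) :
    gk s z ≤ 18432 * (√ε)⁻¹ * (s * (ε + z ^ 2)⁻¹) := by
  have h1 : 0 < s := hε.trans_le hs
  have := Real.sqrt_pos.2 hε
  refine (gk_le h1 z).trans ?_
  rw [mul_assoc]
  have h2 : s ^ 4 / (s + z ^ 2) ^ 4 ≤ s * (ε + z ^ 2)⁻¹ := by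
    have h3 : s / (s + z ^ 2) ≤ 1 := by
      rw [div_le_one (by positivity)]
      linarith [sq_nonneg z]
    calc s ^ 4 / (s + z ^ 2) ^ 4 = (s / (s + z ^ 2)) ^ 3 * (s / (s + z ^ 2)) := by
          rw [← div_pow]; ring
      _ ≤ 1 * (s / (s + z ^ 2)) := by
          gcongr
          exact pow_le_one₀ (by positivity) h3
      _ ≤ s * (ε + z ^ 2)⁻¹ := by
          rw [one_mul, div_eq_mul_inv]
          gcongr
  gcongr

theorem abs_gkern_le {ε N : ℝ} (hε : 0 < ε) (y : ℝ × ℝ) :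
    |gkern ε N y| ≤ (Icc ε N).indicator (fun _ => 18432 * (√ε)⁻¹ * N) y.1 * (ε + y.2 ^ 2)⁻¹ := by
  unfold gkern
  by_cases h : y.1 ∈ Icc ε N
  · rw [indicator_of_mem h, indicator_of_mem h, abs_of_nonneg (gk_nonneg _ _)]
    refine (gk_le_inv hε h.1 y.2).trans ?_
    rw [← mul_assoc]
    gcongr
    exact h.2
  · rw [indicator_of_notMem h, indicator_of_notMem h]
    simp

theorem bounded_gkern {ε : ℝ} (hε : 0 < ε) (N : ℝ) : ∃ M, ∀ y, |gkern ε N y| ≤ M := by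
  refine ⟨18432 * (√ε)⁻¹ * |N| * ε⁻¹, fun y => (abs_gkern_le hε y).trans ?_⟩
  have h : (Icc ε N).indicator (fun _ => 18432 * (√ε)⁻¹ * N) y.1 ≤ 18432 * (√ε)⁻¹ * |N| := by
    by_cases h : y.1 ∈ Icc ε N
    · rw [indicator_of_mem h]
      gcongr
      exact le_abs_self N
    · rw [indicator_of_notMem h]
      positivity
  gcongr
  linarith [sq_nonneg y.2]

theorem integrable_gkern {ε : ℝ} (hε : 0 < ε) (N : ℝ) : Integrable (gkern ε N) := by
  have h1 : Integrable ((Icc ε N).indicator (fun _ => 18432 * (√ε)⁻¹ * N)) :=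
    (integrable_indicator_iff measurableSet_Icc).2 (integrableOn_const (by simp))
  refine (h1.mul_prod (integrable_inv_add_sq hε)).mono'
    (measurable_gkern ε N).aestronglyMeasurable (ae_of_all _ fun y => ?_)
  exact abs_gkern_le hε y

theorem integral_hk_mul {s : ℝ} (hs : 0 < s) {φ φ' φ'' : ℝ → ℝ}
    (h1 : ∀ z, HasDerivAt φ (φ' z) z) (h2 : ∀ z, HasDerivAt φ' (φ'' z) z)
    (hc : Continuous φ'') (hφ : HasCompactSupport φ) (hφ' : HasCompactSupport φ')
    (hφ'' : HasCompactSupport φ'') :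
    ∫ z, hk s z * φ z = ∫ z, gk s z * φ'' z := by
  have c0 : Continuous φ := continuous_iff_continuousAt.2 fun z => (h1 z).continuousAt
  have c1 : Continuous φ' := continuous_iff_continuousAt.2 fun z => (h2 z).continuousAt
  have g0 : Continuous (gk s) :=
    continuous_iff_continuousAt.2 fun z => (hasDerivAt_gk_right hs z).continuousAt
  have g1 : Continuous fun z => -(z / (2 * s)) * gk s z := by fun_prop
  have g2 : Continuous (hk s) :=
    continuous_iff_continuousAt.2 fun z => (hasDerivAt_hk_right hs z).continuousAt
  have e1 := integral_mul_deriv_eq_deriv_mul_of_integrable (u := gk s) (v := φ') (v' := φ'')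
    (fun z _ => hasDerivAt_gk_right hs z) (fun z _ => h2 z)
    ((g0.mul hc).integrable_of_hasCompactSupport hφ''.mul_left)
    ((g1.mul c1).integrable_of_hasCompactSupport hφ'.mul_left)
    ((g0.mul c1).integrable_of_hasCompactSupport hφ'.mul_left)
  have e2 := integral_mul_deriv_eq_deriv_mul_of_integrable
    (u := fun z => -(z / (2 * s)) * gk s z) (v := φ) (v' := φ')
    (fun z _ => hasDerivAt_gk_right_deriv hs z) (fun z _ => h1 z)
    ((g1.mul c1).integrable_of_hasCompactSupport hφ'.mul_left)
    ((g2.mul c0).integrable_of_hasCompactSupport hφ.mul_left)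
    ((g1.mul c0).integrable_of_hasCompactSupport hφ.mul_left)
  linarith

theorem hasCompactSupport_slice {f : ℝ × ℝ → ℝ} (hfc : HasCompactSupport f) (w : ℝ × ℝ) (s : ℝ) :
    HasCompactSupport fun z => f (w + (s, z)) := by
  have he : Topology.IsClosedEmbedding fun z : ℝ => w + (s, z) :=
    (Isometry.of_dist_eq fun a b => by simp [Prod.dist_eq]).isClosedEmbedding
  exact hfc.comp_isClosedEmbedding he

theorem hasDerivAt_slice_right {f : ℝ × ℝ → ℝ} (hf : ContDiff ℝ (⊤ : ℕ∞) f) (w : ℝ × ℝ) (s z : ℝ) :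
    HasDerivAt (fun z => f (w + (s, z))) (dd (0, 1) f (w + (s, z))) z := by
  have h := hasDerivAt_line hf (0, 1) (w + (s, 0)) z
  have e (z : ℝ) : w + (s, 0) + z • ((0, 1) : ℝ × ℝ) = w + (s, z) := by
    ext <;> simp [add_assoc]
  simpa only [e] using h

theorem hasDerivAt_slice_left {f : ℝ × ℝ → ℝ} (hf : ContDiff ℝ (⊤ : ℕ∞) f) (w : ℝ × ℝ) (s z : ℝ) :
    HasDerivAt (fun s => f (w + (s, z))) (dd (1, 0) f (w + (s, z))) s := by
  have h := hasDerivAt_line hf (1, 0) (w + (0, z)) s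
  have e (s : ℝ) : w + (0, z) + s • ((1, 0) : ℝ × ℝ) = w + (s, z) := by
    ext <;> simp [add_comm]
  simpa only [e] using h

theorem integrable_mul_shift {K f : ℝ × ℝ → ℝ} (hKi : Integrable K)
    (hf : Continuous f) (hfc : HasCompactSupport f) (w : ℝ × ℝ) :
    Integrable fun y => K y * f (w + y) := by
  obtain ⟨M, hM⟩ := exists_bound_of_hasCompactSupport hf hfc
  exact hKi.mul_bdd (c := M) (by fun_prop) (ae_of_all _ fun y => hM _)

theorem corr_kern_eq {ε N : ℝ} (hε : 0 < ε) {f : ℝ × ℝ → ℝ} (hf : ContDiff ℝ (⊤ : ℕ∞) f)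
    (hfc : HasCompactSupport f) (w : ℝ × ℝ) :
    corr (kern ε N) f w = corr (gkern ε N) (dd (0, 1) (dd (0, 1) f)) w := by
  have hf1 := contDiff_dd (0, 1) hf
  have hf2 := contDiff_dd (0, 1) hf1
  have hc1 := hasCompactSupport_dd (0, 1) hfc
  have hc2 := hasCompactSupport_dd (0, 1) hc1
  unfold corr
  rw [Measure.volume_eq_prod, integral_prod _ (integrable_mul_shift (integrable_kern hε N)
      hf.continuous hfc w), integral_prod _ (integrable_mul_shift (integrable_gkern hε N)
      hf2.continuous hc2 w)]
  congr 1
  ext s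
  unfold kern gkern
  by_cases hs : s ∈ Icc ε N
  · simp only [indicator_of_mem hs]
    exact integral_hk_mul (hε.trans_le hs.1) (fun z => hasDerivAt_slice_right hf w s z)
      (fun z => hasDerivAt_slice_right hf1 w s z)
      (hf2.continuous.comp (by fun_prop)) (hasCompactSupport_slice hfc w s)
      (hasCompactSupport_slice hc1 w s) (hasCompactSupport_slice hc2 w s)
  · simp only [indicator_of_notMem hs, zero_mul]

/-- The heat average `∫ G_s(z) f(w + (s, z)) dz`. -/
noncomputable def heatAv (s : ℝ) (f : ℝ × ℝ → ℝ) (w : ℝ × ℝ) : ℝ := ∫ z, gk s z * f (w + (s, z))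

theorem integrable_gk_mul {s : ℝ} (hs : 0 < s) {f : ℝ × ℝ → ℝ} (hf : Continuous f)
    (hfc : HasCompactSupport f) (w : ℝ × ℝ) : Integrable fun z => gk s z * f (w + (s, z)) := by
  obtain ⟨M, hM⟩ := exists_bound_of_hasCompactSupport hf hfc
  exact (integrable_gk hs).mul_bdd (c := M) (by fun_prop) (ae_of_all _ fun y => hM _)

/-- Duhamel's identity for the one-dimensional heat kernel. -/
theorem corr_kern_add {ε N : ℝ} (hε : 0 < ε) (hN : ε ≤ N) {f : ℝ × ℝ → ℝ}
    (hf : ContDiff ℝ (⊤ : ℕ∞) f) (hfc : HasCompactSupport f) (w : ℝ × ℝ) :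
    corr (kern ε N) f w + corr (gkern ε N) (dd (1, 0) f) w = heatAv N f w - heatAv ε f w := by
  have hf1 := contDiff_dd (1, 0) hf
  have hc1 := hasCompactSupport_dd (1, 0) hfc
  have i1 := integrable_mul_shift (integrable_kern hε N) hf.continuous hfc w
  have i2 := integrable_mul_shift (integrable_gkern hε N) hf1.continuous hc1 w
  have i12 : Integrable fun y => kern ε N y * f (w + y) + gkern ε N y * dd (1, 0) f (w + y) :=
    i1.add i2
  unfold corr heatAv
  rw [← integral_add i1 i2, Measure.volume_eq_prod, integral_prod_symm _ i12,
    ← integral_sub (integrable_gk_mul (hε.trans_le hN) hf.continuous hfc w)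
      (integrable_gk_mul hε hf.continuous hfc w)]
  congr 1
  ext z
  have hd (s : ℝ) (hs : 0 < s) : HasDerivAt (fun s => gk s z * f (w + (s, z)))
      (hk s z * f (w + (s, z)) + gk s z * dd (1, 0) f (w + (s, z))) s :=
    (hasDerivAt_gk_left hs z).mul (hasDerivAt_slice_left hf w s z)
  have h1 := intervalIntegral.integral_eq_sub_of_hasDerivAt (a := ε) (b := N)
    (fun s hs => hd s (by rw [uIcc_of_le hN] at hs; exact hε.trans_le hs.1)) ?_
  · rw [← h1, intervalIntegral.integral_of_le hN, ← integral_Icc_eq_integral_Ioc,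
      ← integral_indicator measurableSet_Icc]
    congr 1
    ext s
    unfold kern gkern
    by_cases hs : s ∈ Icc ε N
    · simp only [indicator_of_mem hs]
    · simp only [indicator_of_notMem hs, zero_mul, add_zero]
  · apply ContinuousOn.intervalIntegrable
    intro s hs
    rw [uIcc_of_le hN] at hs
    have hs0 := hε.trans_le hs.1
    have cf : ContinuousAt (fun s => f (w + (s, z))) s :=
      (hf.continuous.comp (by fun_prop : Continuous fun s : ℝ => w + (s, z))).continuousAt
    have cf1 : ContinuousAt (fun s => dd (1, 0) f (w + (s, z))) s :=
      (hf1.continuous.comp (by fun_prop : Continuous fun s : ℝ => w + (s, z))).continuousAt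
    exact (((hasDerivAt_hk_left hs0 z).continuousAt.mul cf).add
      ((hasDerivAt_gk_left hs0 z).continuousAt.mul cf1)).continuousWithinAt

theorem heatAv_sq_le {s : ℝ} (hs : 0 < s) {f : ℝ × ℝ → ℝ} (hf : Continuous f)
    (hfc : HasCompactSupport f) (w : ℝ × ℝ) :
    heatAv s f w ^ 2 ≤ ∫ z, gk s z * f (w + (s, z)) ^ 2 := by
  obtain ⟨m, hm⟩ : ∃ m, heatAv s f w = m := ⟨_, rfl⟩
  have i0 := integrable_gk hs
  have i1 := integrable_gk_mul hs hf hfc w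
  have hc2 : HasCompactSupport fun w => f w ^ 2 := hfc.comp_left (g := fun x => x ^ 2) (by simp)
  have i2 : Integrable fun z => gk s z * f (w + (s, z)) ^ 2 :=
    integrable_gk_mul (f := fun w => f w ^ 2) hs (hf.pow 2) hc2 w
  have h0 : 0 ≤ ∫ z, gk s z * (f (w + (s, z)) - m) ^ 2 :=
    integral_nonneg fun z => mul_nonneg (gk_nonneg _ _) (sq_nonneg _)
  have h1 : ∫ z, gk s z * (f (w + (s, z)) - m) ^ 2 =
      (∫ z, gk s z * f (w + (s, z)) ^ 2) - 2 * m * heatAv s f w + m ^ 2 * ∫ z, gk s z := by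
    have i3 : Integrable fun z => gk s z * f (w + (s, z)) ^ 2 - 2 * m * (gk s z * f (w + (s, z))) :=
      i2.sub (i1.const_mul _)
    unfold heatAv
    rw [← integral_const_mul, ← integral_const_mul, ← integral_sub i2 (i1.const_mul _),
      ← integral_add i3 (i0.const_mul _)]
    congr 1
    ext z
    ring
  rw [integral_gk hs, hm] at h1
  rw [hm]
  rw [h1] at h0
  nlinarith

theorem lintegral_heatAv_sq_le {s : ℝ} (hs : 0 < s) {f : ℝ × ℝ → ℝ} (hf : Continuous f)
    (hfc : HasCompactSupport f) :
    ∫⁻ w, ‖heatAv s f w‖ₑ ^ 2 ≤ ∫⁻ w, ‖f w‖ₑ ^ 2 := by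
  have hg : Measurable (gk s) := measurable_gk.comp (measurable_prodMk_left)
  calc ∫⁻ w, ‖heatAv s f w‖ₑ ^ 2
      ≤ ∫⁻ w, ∫⁻ z, ‖gk s z‖ₑ * ‖f (w + (s, z))‖ₑ ^ 2 := by
        apply lintegral_mono
        intro w
        have h1 := heatAv_sq_le hs hf hfc w
        have h2 : ‖heatAv s f w‖ₑ ^ 2 = ‖heatAv s f w ^ 2‖ₑ := by rw [enorm_pow]
        calc ‖heatAv s f w‖ₑ ^ 2 ≤ ‖∫ z, gk s z * f (w + (s, z)) ^ 2‖ₑ := by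
              rw [h2, Real.enorm_eq_ofReal_abs, Real.enorm_eq_ofReal_abs, abs_of_nonneg (sq_nonneg _)]
              exact ENNReal.ofReal_le_ofReal (h1.trans (le_abs_self _))
          _ ≤ ∫⁻ z, ‖gk s z * f (w + (s, z)) ^ 2‖ₑ := enorm_integral_le_lintegral_enorm _
          _ = ∫⁻ z, ‖gk s z‖ₑ * ‖f (w + (s, z))‖ₑ ^ 2 := by simp only [enorm_mul, enorm_pow]
    _ = ∫⁻ z, ‖gk s z‖ₑ * ∫⁻ w, ‖f w‖ₑ ^ 2 := by
        have := hf.measurable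
        rw [lintegral_lintegral_swap (by fun_prop)]
        apply lintegral_congr
        intro z
        rw [lintegral_const_mul _ (by fun_prop)]
        congr 1
        exact lintegral_add_right_eq_self (fun w => ‖f w‖ₑ ^ 2) (s, z)
    _ = ∫⁻ w, ‖f w‖ₑ ^ 2 := by
        rw [lintegral_mul_const _ (by fun_prop)]
        have : ∫⁻ z, ‖gk s z‖ₑ = 1 := by
          rw [← ofReal_integral_norm_eq_lintegral_enorm (integrable_gk hs)]
          simp only [Real.norm_eq_abs, abs_of_nonneg (gk_nonneg _ _), integral_gk hs,
            ENNReal.ofReal_one]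
        rw [this, one_mul]

theorem kern_l2 {ε N : ℝ} (hε : 0 < ε) (hN : ε ≤ N) {f : ℝ × ℝ → ℝ}
    (hf : ContDiff ℝ (⊤ : ℕ∞) f) (hfc : HasCompactSupport f) :
    ∫⁻ w, ‖corr (kern ε N) f w‖ₑ ^ 2 ≤ 4 * ∫⁻ w, ‖f w‖ₑ ^ 2 := by
  set f₂ := dd (0, 1) (dd (0, 1) f) with hf₂
  set ft := dd (1, 0) f with hft
  have i2 : Integrable f₂ := (contDiff_dd _ (contDiff_dd _ hf)).continuous.integrable_of_hasCompactSupport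
    (hasCompactSupport_dd _ (hasCompactSupport_dd _ hfc))
  have it : Integrable ft := (contDiff_dd _ hf).continuous.integrable_of_hasCompactSupport
    (hasCompactSupport_dd _ hfc)
  have hG := measurable_gkern ε N
  have hGi := integrable_gkern hε N
  have hGb := bounded_gkern hε N
  set a := corr (gkern ε N) f₂ with ha
  set b := corr (gkern ε N) ft with hb
  have hai : Integrable a := integrable_corr hG hGi i2
  have hbi : Integrable b := integrable_corr hG hGi it
  obtain ⟨Ma, hMa⟩ : ∃ M, ∀ w, |a w| ≤ M := bounded_corr hGb i2
  obtain ⟨Mb, hMb⟩ : ∃ M, ∀ w, |b w| ≤ M := bounded_corr hGb it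
  have haa : Integrable fun w => a w ^ 2 := by
    simp only [pow_two]; exact hai.bdd_mul (c := Ma) hai.1 (ae_of_all _ hMa)
  have hab : Integrable fun w => a w * b w := hbi.bdd_mul (c := Ma) hai.1 (ae_of_all _ hMa)
  have hbb : Integrable fun w => b w ^ 2 := by
    simp only [pow_two]; exact hbi.bdd_mul (c := Mb) hbi.1 (ae_of_all _ hMb)
  have h0 : ∫ w, a w * b w = 0 := integral_corr_dd_dd_mul_eq_zero hG hGi hGb _ _ hf hfc
  have hss : Integrable fun w => (a w + b w) ^ 2 := by
    have : (fun w => (a w + b w) ^ 2) = fun w => a w ^ 2 + 2 * (a w * b w) + b w ^ 2 := by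
      ext w; ring
    rw [this]
    exact (haa.add (hab.const_mul 2)).add hbb
  have h1 : ∫ w, a w ^ 2 ≤ ∫ w, (a w + b w) ^ 2 := by
    have : ∫ w, (a w + b w) ^ 2 = (∫ w, a w ^ 2) + 2 * (∫ w, a w * b w) + ∫ w, b w ^ 2 := by
      have i3 : Integrable fun w => a w ^ 2 + 2 * (a w * b w) := haa.add (hab.const_mul 2)
      rw [← integral_const_mul, ← integral_add haa (hab.const_mul 2), ← integral_add i3 hbb]
      congr 1
      ext w
      ring
    have h3 : 0 ≤ ∫ w, b w ^ 2 := integral_nonneg fun w => sq_nonneg _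
    linarith
  have conv {g : ℝ × ℝ → ℝ} (hg : Integrable fun w => g w ^ 2) :
      ∫⁻ w, ‖g w‖ₑ ^ 2 = ENNReal.ofReal (∫ w, g w ^ 2) := by
    rw [ofReal_integral_eq_lintegral_ofReal hg (ae_of_all _ fun w => sq_nonneg _)]
    apply lintegral_congr
    intro w
    rw [← enorm_pow, Real.enorm_eq_ofReal (sq_nonneg _)]
  have hmeas (s : ℝ) : AEMeasurable fun w => ‖heatAv s f w‖ₑ ^ 2 := by
    have h : StronglyMeasurable fun w : ℝ × ℝ => heatAv s f w := by
      have hg : Measurable (gk s) := measurable_gk.comp (measurable_prodMk_left)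
      have hfm := hf.continuous.measurable
      have : StronglyMeasurable fun q : (ℝ × ℝ) × ℝ => gk s q.2 * f (q.1 + (s, q.2)) :=
        (by fun_prop : Measurable fun q : (ℝ × ℝ) × ℝ => gk s q.2 * f (q.1 + (s, q.2))).stronglyMeasurable
      exact this.integral_prod_right
    exact (h.measurable.enorm.pow_const 2).aemeasurable
  calc ∫⁻ w, ‖corr (kern ε N) f w‖ₑ ^ 2 = ∫⁻ w, ‖a w‖ₑ ^ 2 := by
        apply lintegral_congr
        intro w
        rw [corr_kern_eq hε hf hfc]
    _ ≤ ∫⁻ w, ‖a w + b w‖ₑ ^ 2 := by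
        rw [conv haa, conv hss]
        exact ENNReal.ofReal_le_ofReal h1
    _ ≤ ∫⁻ w, (2 * ‖heatAv N f w‖ₑ ^ 2 + 2 * ‖heatAv ε f w‖ₑ ^ 2) := by
        apply lintegral_mono
        intro w
        have h2 : a w + b w = heatAv N f w - heatAv ε f w := by
          rw [ha, hb, ← corr_kern_add hε hN hf hfc, corr_kern_eq hε hf hfc]
        simp only [h2, ← enorm_pow, Real.enorm_eq_ofReal (sq_nonneg _)]
        rw [show (2 : ℝ≥0∞) = ENNReal.ofReal 2 by simp, ← ENNReal.ofReal_mul (by norm_num),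
          ← ENNReal.ofReal_mul (by norm_num), ← ENNReal.ofReal_add (by positivity) (by positivity)]
        apply ENNReal.ofReal_le_ofReal
        nlinarith [sq_nonneg (heatAv N f w + heatAv ε f w)]
    _ = 2 * (∫⁻ w, ‖heatAv N f w‖ₑ ^ 2) + 2 * ∫⁻ w, ‖heatAv ε f w‖ₑ ^ 2 := by
        rw [lintegral_add_left' ((hmeas N).const_mul 2), lintegral_const_mul'' _ (hmeas N),
          lintegral_const_mul'' _ (hmeas ε)]
    _ ≤ 2 * (∫⁻ w, ‖f w‖ₑ ^ 2) + 2 * ∫⁻ w, ‖f w‖ₑ ^ 2 := by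
        gcongr 2 * ?_ + 2 * ?_
        · exact lintegral_heatAv_sq_le (hε.trans_le hN) hf.continuous hfc
        · exact lintegral_heatAv_sq_le hε hf.continuous hfc
    _ = 4 * ∫⁻ w, ‖f w‖ₑ ^ 2 := by
        rw [← add_mul]; norm_num

theorem isCZKernel_kern {ε N : ℝ} (hε : 0 < ε) (hN : ε ≤ N) : IsCZKernel (kern ε N) 4 heatB where
  measurable := measurable_kern ε N
  bounded := bounded_kern hε N
  integrable := integrable_kern hε N
  l2 f hf hb := by
    have h : HasLpBound (kern ε N) 2 (4 ^ (1 / (2 : ℝ))) := by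
      apply HasLpBound.of_smooth (measurable_kern ε N) (integrable_kern hε N) (bounded_kern hε N)
        (by norm_num)
      intro g hg hgc
      rw [← lintegral_le_iff_eLpNorm_le (by norm_num)]
      simpa using kern_l2 hε hN hg hgc
    have := (lintegral_le_iff_eLpNorm_le (by norm_num) 4).2 (h f hf hb)
    simpa using this
  hormander ρ hρ η h1 h2 := kern_hormander hε hρ η h1 h2

/-- The truncated heat kernels are bounded on `L^p`, uniformly in the truncation. -/
theorem exists_hasLpBound_kern {p : ℝ} (hp : 1 < p) :
    ∃ C : ℝ≥0, ∀ ε N : ℝ, 0 < ε → ε ≤ N → HasLpBound (kern ε N) p C := by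
  obtain ⟨C, hC⟩ := exists_hasLpBound hp 4 heatB
  exact ⟨C, fun ε N hε hN => hC _ (isCZKernel_kern hε hN)⟩

section Transference

variable {d : ℕ}

/-- A slab transversal to `q`, which meets each line parallel to `q` in unit parameter length. -/
def slab (q : Fin d → ℝ) (i : Fin d) : Set (Fin d → ℝ) := {x | x i / q i ∈ Ico (0 : ℝ) 1}

theorem measurableSet_slab (q : Fin d → ℝ) (i : Fin d) : MeasurableSet (slab q i) :=
  measurableSet_Ico.preimage (by fun_prop)

theorem lintegral_slab {q : Fin d → ℝ} {i : Fin d} (hq : q i ≠ 0) (x : Fin d → ℝ) :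
    ∫⁻ z : ℝ, (slab q i).indicator 1 (x - z • q) = 1 := by
  have h : (fun z : ℝ => (slab q i).indicator (1 : (Fin d → ℝ) → ℝ≥0∞) (x - z • q)) =
      (Ioc (x i / q i - 1) (x i / q i)).indicator 1 := by
    ext z
    have : x - z • q ∈ slab q i ↔ z ∈ Ioc (x i / q i - 1) (x i / q i) := by
      have e : (x i - z * q i) / q i = x i / q i - z := by field_simp
      simp only [slab, mem_ofPred_eq, Pi.sub_apply, Pi.smul_apply, smul_eq_mul, e, mem_Ico, mem_Ioc]
      constructor <;> rintro ⟨h1, h2⟩ <;> constructor <;> linarith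
    by_cases hz : z ∈ Ioc (x i / q i - 1) (x i / q i)
    · rw [indicator_of_mem (this.2 hz), indicator_of_mem hz]; rfl
    · rw [indicator_of_notMem (fun h => hz (this.1 h)), indicator_of_notMem hz]
  rw [h, lintegral_indicator_one measurableSet_Ioc, Real.volume_Ioc]
  simp

theorem lintegral_fiber {q : Fin d → ℝ} {i : Fin d} (hq : q i ≠ 0) {X : ℝ → Fin d → ℝ}
    (hX : Measurable X) {g : ℝ × (Fin d → ℝ) → ℝ≥0∞} (hg : Measurable g) :
    ∫⁻ x in slab q i, ∫⁻ y : ℝ × ℝ, g (y.1, x + y.2 • q + X y.1) = ∫⁻ w, g w := by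
  have hs := measurableSet_slab q i
  have hone : Measurable ((slab q i).indicator (1 : (Fin d → ℝ) → ℝ≥0∞)) :=
    measurable_one.indicator hs
  calc ∫⁻ x in slab q i, ∫⁻ y : ℝ × ℝ, g (y.1, x + y.2 • q + X y.1)
      = ∫⁻ x, ∫⁻ y : ℝ × ℝ, (slab q i).indicator 1 x * g (y.1, x + y.2 • q + X y.1) := by
        rw [← lintegral_indicator hs]
        apply lintegral_congr
        intro x
        rw [lintegral_const_mul _ (by fun_prop)]
        by_cases hx : x ∈ slab q i
        · simp [hx]
        · simp [hx]
    _ = ∫⁻ y : ℝ × ℝ, ∫⁻ x, (slab q i).indicator 1 x * g (y.1, x + y.2 • q + X y.1) :=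
        lintegral_lintegral_swap (by fun_prop)
    _ = ∫⁻ y : ℝ × ℝ, ∫⁻ x, (slab q i).indicator 1 (x - X y.1 - y.2 • q) * g (y.1, x) := by
        apply lintegral_congr
        intro y
        rw [← lintegral_add_right_eq_self (fun x => (slab q i).indicator 1 (x - X y.1 - y.2 • q) *
          g (y.1, x)) (y.2 • q + X y.1)]
        apply lintegral_congr
        intro x
        congr 2
        · abel
        · rw [add_assoc]
    _ = ∫⁻ t, ∫⁻ z, ∫⁻ x, (slab q i).indicator 1 (x - X t - z • q) * g (t, x) := by
        rw [Measure.volume_eq_prod, lintegral_prod]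
        have : Measurable fun r : (ℝ × ℝ) × (Fin d → ℝ) =>
            (slab q i).indicator (1 : (Fin d → ℝ) → ℝ≥0∞) (r.2 - X r.1.1 - r.1.2 • q) *
              g (r.1.1, r.2) := by fun_prop
        exact this.lintegral_prod_right'.aemeasurable
    _ = ∫⁻ t, ∫⁻ x, g (t, x) := by
        apply lintegral_congr
        intro t
        rw [lintegral_lintegral_swap (by fun_prop)]
        apply lintegral_congr
        intro x
        rw [lintegral_mul_const _ (by fun_prop), lintegral_slab hq, one_mul]
    _ = ∫⁻ w, g w := by
        rw [Measure.volume_eq_prod, lintegral_prod _ hg.aemeasurable]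

/-- The operator `f ↦ ∫ K(s, z) f(t + s, x + z q + X(t + s) - X(t))` attached to a path `X`. -/
noncomputable def shiftOp (K : ℝ × ℝ → ℝ) (q : Fin d → ℝ) (X : ℝ → Fin d → ℝ)
    (f : ℝ × (Fin d → ℝ) → ℝ) (w : ℝ × (Fin d → ℝ)) : ℝ :=
  ∫ y : ℝ × ℝ, K y * f (w.1 + y.1, w.2 + y.2 • q + (X (w.1 + y.1) - X w.1))

theorem measurable_shiftOp {K : ℝ × ℝ → ℝ} (hK : Measurable K) (q : Fin d → ℝ)
    {X : ℝ → Fin d → ℝ} (hX : Measurable X) {f : ℝ × (Fin d → ℝ) → ℝ} (hf : Measurable f) :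
    Measurable (shiftOp K q X f) := by
  have : StronglyMeasurable fun r : (ℝ × (Fin d → ℝ)) × (ℝ × ℝ) =>
      K r.2 * f (r.1.1 + r.2.1, r.1.2 + r.2.2 • q + (X (r.1.1 + r.2.1) - X r.1.1)) :=
    (by fun_prop : Measurable fun r : (ℝ × (Fin d → ℝ)) × (ℝ × ℝ) =>
      K r.2 * f (r.1.1 + r.2.1, r.1.2 + r.2.2 • q + (X (r.1.1 + r.2.1) - X r.1.1))).stronglyMeasurable
  exact this.integral_prod_right.measurable

/-- Transference: `shiftOp K q X` inherits the `L^p` bound of `corr K`. -/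
theorem HasLpBound.shiftOp {K : ℝ × ℝ → ℝ} (hK : Measurable K) {p : ℝ} (hp : 0 < p) {C : ℝ≥0}
    (h : HasLpBound K p C) {q : Fin d → ℝ} (hq : q ≠ 0) {X : ℝ → Fin d → ℝ} (hX : Measurable X)
    {f : ℝ × (Fin d → ℝ) → ℝ} (hf : Measurable f) (hfi : Integrable f)
    (hfb : ∃ M, ∀ w, |f w| ≤ M) :
    eLpNorm (shiftOp K q X f) (ENNReal.ofReal p) ≤ C * eLpNorm f (ENNReal.ofReal p) := by
  obtain ⟨i, hi⟩ : ∃ i, q i ≠ 0 := by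
    by_contra! hc
    exact hq (funext hc)
  have hC : (C ^ p) ^ (1 / p) = C := by
    rw [← NNReal.rpow_mul, mul_one_div_cancel hp.ne', NNReal.rpow_one]
  rw [← hC, ← lintegral_le_iff_eLpNorm_le hp]
  have hT := measurable_shiftOp hK q hX hf
  rw [← lintegral_fiber hi hX (g := fun w => ‖ParabolicLp.shiftOp K q X f w‖ₑ ^ p) (by fun_prop),
    ← lintegral_fiber hi hX (g := fun w => ‖f w‖ₑ ^ p) (by fun_prop),
    ← lintegral_const_mul' _ _ (by simp)]
  have hfin : ∫⁻ x in slab q i, ∫⁻ y : ℝ × ℝ, ‖f (y.1, x + y.2 • q + X y.1)‖ₑ < ∞ := by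
    rw [lintegral_fiber hi hX (g := fun w => ‖f w‖ₑ) (by fun_prop)]
    exact hfi.2
  have hmeas : Measurable fun x : Fin d → ℝ => ∫⁻ y : ℝ × ℝ, ‖f (y.1, x + y.2 • q + X y.1)‖ₑ := by
    have : Measurable fun r : (Fin d → ℝ) × (ℝ × ℝ) =>
      ‖f (r.2.1, r.1 + r.2.2 • q + X r.2.1)‖ₑ := by fun_prop
    exact this.lintegral_prod_right'
  apply lintegral_mono_ae
  filter_upwards [ae_lt_top hmeas hfin.ne] with x hx
  set g : ℝ × ℝ → ℝ := fun y => f (y.1, x + y.2 • q + X y.1) with hg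
  have hgm : Measurable g := by fun_prop
  have e (y : ℝ × ℝ) : ParabolicLp.shiftOp K q X f (y.1, x + y.2 • q + X y.1) = corr K g y := by
    unfold ParabolicLp.shiftOp corr
    congr 1
    ext y'
    simp only [hg, Prod.fst_add, Prod.snd_add]
    congr 3
    rw [add_smul]
    abel
  simp only [e]
  obtain ⟨M, hM⟩ := hfb
  have := h g ⟨hgm.aestronglyMeasurable, hx⟩ ⟨M, fun y => hM _⟩
  rw [← hC, ← lintegral_le_iff_eLpNorm_le hp] at this
  exact this

end Transference

section Taylor

variable {E : Type*} [NormedAddCommGroup E] [NormedSpace ℝ E]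

theorem exists_dd_bound {f : E → ℝ} (hf : ContDiff ℝ (⊤ : ℕ∞) f) (hc : HasCompactSupport f) :
    ∃ M, 0 ≤ M ∧ ∀ v w, |dd v f w| ≤ M * ‖v‖ := by
  obtain ⟨M, hM⟩ := (hc.fderiv ℝ).exists_bound_of_continuous (hf.continuous_fderiv (by simp))
  exact ⟨M, (norm_nonneg _).trans (hM 0), fun v w => (fderiv ℝ f w).le_of_opNorm_le (hM w) v⟩

theorem dd_sum {ι : Type*} (s : Finset ι) (a : ι → ℝ) {g : ι → E → ℝ}
    (hg : ∀ i ∈ s, ContDiff ℝ (⊤ : ℕ∞) (g i)) (v : E) :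
    dd v (fun w => ∑ i ∈ s, a i * g i w) = fun w => ∑ i ∈ s, a i * dd v (g i) w := by
  ext w
  have hd : ∀ i ∈ s, DifferentiableAt ℝ (g i) w := fun i hi =>
    ((hg i hi).differentiable (by simp)).differentiableAt
  unfold dd
  rw [fderiv_fun_sum fun i hi => (hd i hi).const_mul (a i)]
  rw [_root_.sum_apply]
  apply Finset.sum_congr rfl
  intro i hi
  rw [fderiv_const_mul (hd i hi)]
  simp

theorem abs_symm_second_difference_le {f : E → ℝ} (hf : ContDiff ℝ (⊤ : ℕ∞) f) (v : E) {S : ℝ}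
    (hS : ∀ w, |dd v (dd v (dd v f)) w| ≤ S) (w : E) :
    |f (w + v) + f (w - v) - 2 * f w - dd v (dd v f) w| ≤ 2 * S := by
  have hS0 : 0 ≤ S := (abs_nonneg _).trans (hS w)
  have hf1 := contDiff_dd v hf
  have hf2 := contDiff_dd v hf1
  have neg {g : E → ℝ} (hg : ContDiff ℝ (⊤ : ℕ∞) g) (τ : ℝ) :
      HasDerivAt (fun τ : ℝ => g (w + (-τ) • v)) (-dd v g (w + (-τ) • v)) τ := by
    have := (hasDerivAt_line hg v w (-τ)).scomp τ (hasDerivAt_neg τ)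
    refine this.congr_deriv ?_
    simp
  have mvt {h h' : ℝ → ℝ} {B : ℝ} (hd : ∀ τ, HasDerivAt h (h' τ) τ)
      (hb : ∀ τ ∈ Icc (0 : ℝ) 1, |h' τ| ≤ B) (h0 : h 0 = 0) (hB : 0 ≤ B) :
      ∀ τ ∈ Icc (0 : ℝ) 1, |h τ| ≤ B := by
    intro τ hτ
    have := (convex_Icc (0 : ℝ) 1).norm_image_sub_le_of_norm_hasDerivWithin_le
      (fun τ _ => (hd τ).hasDerivWithinAt) hb ⟨le_rfl, zero_le_one⟩ hτ
    rw [h0, sub_zero, sub_zero, Real.norm_eq_abs, Real.norm_eq_abs, abs_of_nonneg hτ.1] at this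
    exact this.trans (mul_le_of_le_one_right hB hτ.2)
  set a := dd v (dd v f) w with ha
  have d2 (τ : ℝ) : HasDerivAt (fun τ : ℝ => dd v (dd v f) (w + τ • v) - a)
      (dd v (dd v (dd v f)) (w + τ • v)) τ := (hasDerivAt_line hf2 v w τ).sub_const a
  have d2' (τ : ℝ) : HasDerivAt (fun τ : ℝ => dd v (dd v f) (w + (-τ) • v) - a)
      (-dd v (dd v (dd v f)) (w + (-τ) • v)) τ := (neg hf2 τ).sub_const a
  have b2 := mvt d2 (fun τ _ => hS _) (by simp [ha]) hS0
  have b2' := mvt d2' (fun τ _ => by rw [abs_neg]; exact hS _) (by simp [ha]) hS0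
  have d1 (τ : ℝ) : HasDerivAt
      (fun τ : ℝ => dd v f (w + τ • v) - dd v f (w + (-τ) • v) - 2 * a * τ)
      ((dd v (dd v f) (w + τ • v) - a) + (dd v (dd v f) (w + (-τ) • v) - a)) τ := by
    refine (((hasDerivAt_line hf1 v w τ).sub (neg hf1 τ)).sub
      ((hasDerivAt_id τ).const_mul (2 * a))).congr_deriv ?_
    simp; ring
  have b1 := mvt d1 (B := 2 * S)
    (fun τ hτ => (abs_add_le _ _).trans (by linarith [b2 τ hτ, b2' τ hτ])) (by simp) (by linarith)
  have d0 (τ : ℝ) : HasDerivAt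
      (fun τ : ℝ => f (w + τ • v) + f (w + (-τ) • v) - 2 * f w - a * τ ^ 2)
      (dd v f (w + τ • v) - dd v f (w + (-τ) • v) - 2 * a * τ) τ := by
    refine ((((hasDerivAt_line hf v w τ).add (neg hf τ)).sub_const (2 * f w)).sub
      ((hasDerivAt_pow 2 τ).const_mul a)).congr_deriv ?_
    simp; ring
  have b0 := mvt d0 b1 (by simp; ring) (by linarith) 1 ⟨zero_le_one, le_rfl⟩
  simpa [sub_eq_add_neg] using b0

end Taylor

section Space

variable {d : ℕ}

/-- The spatial direction `(0, ξ)` in `ℝ × ℝᵈ`. -/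
def sp (ξ : Fin d → ℝ) : ℝ × (Fin d → ℝ) := (0, ξ)

/-- Second spatial partial derivatives. -/
noncomputable def dij (i j : Fin d) (g : ℝ × (Fin d → ℝ) → ℝ) : ℝ × (Fin d → ℝ) → ℝ :=
  dd (sp (Pi.single i 1)) (dd (sp (Pi.single j 1)) g)

theorem contDiff_dij (i j : Fin d) {g : ℝ × (Fin d → ℝ) → ℝ} (hg : ContDiff ℝ (⊤ : ℕ∞) g) :
    ContDiff ℝ (⊤ : ℕ∞) (dij i j g) := contDiff_dd _ (contDiff_dd _ hg)

theorem hasCompactSupport_dij (i j : Fin d) {g : ℝ × (Fin d → ℝ) → ℝ} (hg : HasCompactSupport g) :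
    HasCompactSupport (dij i j g) := hasCompactSupport_dd _ (hasCompactSupport_dd _ hg)

theorem dd_sp (ξ : Fin d → ℝ) (g : ℝ × (Fin d → ℝ) → ℝ) :
    dd (sp ξ) g = fun w => ∑ i, ξ i * dd (sp (Pi.single i 1)) g w := by
  ext w
  have h : sp ξ = ∑ i, ξ i • sp (Pi.single i (1 : ℝ)) := by
    ext j
    · simp [sp, Prod.fst_sum]
    · simp [sp, Prod.snd_sum, Finset.sum_apply, Pi.single_apply]
  unfold dd
  rw [h, map_sum]
  simp

theorem dd_sp_dd_sp (ξ η : Fin d → ℝ) {g : ℝ × (Fin d → ℝ) → ℝ} (hg : ContDiff ℝ (⊤ : ℕ∞) g)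
    (w : ℝ × (Fin d → ℝ)) :
    dd (sp ξ) (dd (sp η) g) w = ∑ i, ∑ j, ξ i * η j * dij i j g w := by
  rw [dd_sp ξ]
  apply Finset.sum_congr rfl
  intro i _
  rw [dd_sp η, dd_sum _ _ fun j _ => contDiff_dd _ hg, Finset.mul_sum]
  apply Finset.sum_congr rfl
  intro j _
  unfold dij
  ring

theorem exists_taylor_bound {g : ℝ × (Fin d → ℝ) → ℝ} (hg : ContDiff ℝ (⊤ : ℕ∞) g)
    (hc : HasCompactSupport g) :
    ∃ M, 0 ≤ M ∧ ∀ w (ξ : Fin d → ℝ),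
      |g (w + sp ξ) + g (w - sp ξ) - 2 * g w - ∑ i, ∑ j, ξ i * ξ j * dij i j g w| ≤
        M * ‖ξ‖ ^ 3 := by
  choose M hM0 hM using fun i j => exists_dd_bound (contDiff_dij i j hg) (hasCompactSupport_dij i j hc)
  refine ⟨2 * ∑ i, ∑ j, M i j, mul_nonneg zero_le_two
    (Finset.sum_nonneg fun i _ => Finset.sum_nonneg fun j _ => hM0 i j), fun w ξ => ?_⟩
  rw [← dd_sp_dd_sp ξ ξ hg]
  refine (abs_symm_second_difference_le hg (sp ξ) (S := (∑ i, ∑ j, M i j) * ‖ξ‖ ^ 3) ?_ w).trans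
    (le_of_eq (by ring))
  intro w
  have e : dd (sp ξ) (dd (sp ξ) g) =
      fun w => ∑ r : Fin d × Fin d, ξ r.1 * ξ r.2 * dij r.1 r.2 g w := by
    ext w
    rw [dd_sp_dd_sp ξ ξ hg, Fintype.sum_prod_type]
  rw [e, dd_sum _ _ fun r _ => contDiff_dij _ _ hg]
  simp only [Fintype.sum_prod_type]
  rw [Finset.sum_mul]
  refine (Finset.abs_sum_le_sum_abs _ _).trans (Finset.sum_le_sum fun i _ => ?_)
  rw [Finset.sum_mul]
  refine (Finset.abs_sum_le_sum_abs _ _).trans (Finset.sum_le_sum fun j _ => ?_)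
  have hn : ‖sp ξ‖ = ‖ξ‖ := by simp [sp, Prod.norm_def]
  have h1 := hM i j (sp ξ) w
  rw [hn] at h1
  rw [abs_mul, abs_mul]
  calc |ξ i| * |ξ j| * |dd (sp ξ) (dij i j g) w| ≤ ‖ξ‖ * ‖ξ‖ * (M i j * ‖ξ‖) := by
        gcongr
        · exact norm_le_pi_norm ξ i
        · exact norm_le_pi_norm ξ j
    _ = M i j * ‖ξ‖ ^ 3 := by ring

end Space

section HeatAlongLines

variable {d : ℕ}

/-- The restriction of `g` to the plane through `(0, y)` spanned by time and `q`. -/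
def fib (q y : Fin d → ℝ) (g : ℝ × (Fin d → ℝ) → ℝ) (r : ℝ × ℝ) : ℝ := g (r.1, y + r.2 • q)

theorem contDiff_fib (q y : Fin d → ℝ) {g : ℝ × (Fin d → ℝ) → ℝ} (hg : ContDiff ℝ (⊤ : ℕ∞) g) :
    ContDiff ℝ (⊤ : ℕ∞) (fib q y g) := by
  unfold fib
  fun_prop

theorem hasCompactSupport_fib {q : Fin d → ℝ} (hq : q ≠ 0) (y : Fin d → ℝ)
    {g : ℝ × (Fin d → ℝ) → ℝ} (hc : HasCompactSupport g) : HasCompactSupport (fib q y g) := by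
  have hinj : Function.Injective (LinearMap.prodMap (LinearMap.id : ℝ →ₗ[ℝ] ℝ)
      (LinearMap.toSpanSingleton ℝ (Fin d → ℝ) q)) := by
    rintro ⟨a, b⟩ ⟨a', b'⟩ h
    simp only [LinearMap.prodMap_apply, LinearMap.id_coe, id_eq,
      LinearMap.toSpanSingleton_apply, Prod.mk.injEq] at h
    rw [h.1, smul_left_injective ℝ hq h.2]
  have he := LinearMap.isClosedEmbedding_of_injective (LinearMap.ker_eq_bot.2 hinj)
  have he' := (Homeomorph.addLeft ((0 : ℝ), y)).isClosedEmbedding.comp he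
  have := hc.comp_isClosedEmbedding he'
  convert this using 1
  ext r
  simp [fib]

theorem dd_fib (q y : Fin d → ℝ) {g : ℝ × (Fin d → ℝ) → ℝ} (hg : ContDiff ℝ (⊤ : ℕ∞) g)
    (a b : ℝ) : dd (a, b) (fib q y g) = fib q y (dd (a, b • q) g) := by
  ext r
  have h1 := (hasDerivAt_line (contDiff_fib q y hg) (a, b) r 0)
  have h2 := (hasDerivAt_line hg (a, b • q) (r.1, y + r.2 • q) 0)
  simp only [zero_smul, add_zero] at h1 h2
  have e : (fun t : ℝ => fib q y g (r + t • (a, b))) =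
      fun t : ℝ => g ((r.1, y + r.2 • q) + t • (a, b • q)) := by
    ext t
    simp [fib, add_smul, mul_smul, add_assoc]
  rw [e] at h1
  exact h1.unique h2

/-- Averages against the heat kernel at time `τ`. -/
noncomputable def gav (τ : ℝ) (φ : ℝ → ℝ) : ℝ := ∫ z, gk τ z * φ z

/-- Bounded continuous functions. -/
def BddCont (φ : ℝ → ℝ) : Prop := Continuous φ ∧ ∃ M, ∀ z, |φ z| ≤ M

theorem BddCont.integrable {φ : ℝ → ℝ} (h : BddCont φ) {τ : ℝ} (hτ : 0 < τ) :
    Integrable fun z => gk τ z * φ z := by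
  obtain ⟨hc, M, hM⟩ := h
  exact (integrable_gk hτ).mul_bdd (c := M) hc.aestronglyMeasurable (ae_of_all _ hM)

theorem BddCont.add {φ ψ : ℝ → ℝ} (h : BddCont φ) (h' : BddCont ψ) :
    BddCont fun z => φ z + ψ z := by
  obtain ⟨hc, M, hM⟩ := h
  obtain ⟨hc', M', hM'⟩ := h'
  exact ⟨hc.add hc', M + M', fun z => (abs_add_le _ _).trans (add_le_add (hM z) (hM' z))⟩

theorem BddCont.const_mul {φ : ℝ → ℝ} (h : BddCont φ) (a : ℝ) : BddCont fun z => a * φ z := by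
  obtain ⟨hc, M, hM⟩ := h
  exact ⟨by fun_prop, |a| * M, fun z => by rw [abs_mul]; gcongr; exact hM z⟩

theorem BddCont.zero : BddCont fun _ => 0 := ⟨continuous_const, 0, fun _ => by simp⟩

theorem BddCont.sum {ι : Type*} (s : Finset ι) (a : ι → ℝ) {φ : ι → ℝ → ℝ}
    (h : ∀ i, BddCont (φ i)) : BddCont fun z => ∑ i ∈ s, a i * φ i z := by
  classical
  induction s using Finset.induction_on with
  | empty => simpa using BddCont.zero
  | insert i s hi ih =>
    simp only [Finset.sum_insert hi]
    exact ((h i).const_mul _).add ih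

theorem gav_add {τ : ℝ} (hτ : 0 < τ) {φ ψ : ℝ → ℝ} (h : BddCont φ) (h' : BddCont ψ) :
    gav τ (fun z => φ z + ψ z) = gav τ φ + gav τ ψ := by
  simp only [gav, mul_add]
  exact integral_add (h.integrable hτ) (h'.integrable hτ)

theorem gav_const_mul (τ a : ℝ) (φ : ℝ → ℝ) : gav τ (fun z => a * φ z) = a * gav τ φ := by
  simp only [gav, mul_left_comm _ a]
  exact integral_const_mul _ _

theorem gav_sum {τ : ℝ} (hτ : 0 < τ) {ι : Type*} (s : Finset ι) (a : ι → ℝ) {φ : ι → ℝ → ℝ}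
    (h : ∀ i, BddCont (φ i)) :
    gav τ (fun z => ∑ i ∈ s, a i * φ i z) = ∑ i ∈ s, a i * gav τ (φ i) := by
  classical
  induction s using Finset.induction_on with
  | empty => simp [gav]
  | insert i s hi ih =>
    simp only [Finset.sum_insert hi]
    rw [gav_add hτ ((h i).const_mul _) (BddCont.sum s a h), ih, gav_const_mul]

theorem abs_gav_le {τ : ℝ} (hτ : 0 < τ) {φ : ℝ → ℝ} {M : ℝ} (h : ∀ z, |φ z| ≤ M) :
    |gav τ φ| ≤ M := by
  have h1 : ‖∫ z, gk τ z * φ z‖ ≤ ∫ z, gk τ z * M := by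
    refine norm_integral_le_of_norm_le ((integrable_gk hτ).mul_const M) (ae_of_all _ fun z => ?_)
    rw [norm_mul, Real.norm_eq_abs, Real.norm_eq_abs, abs_of_nonneg (gk_nonneg _ _)]
    exact mul_le_mul_of_nonneg_left (h z) (gk_nonneg _ _)
  rw [integral_mul_const, integral_gk hτ, one_mul] at h1
  exact h1

theorem bddCont_slice {g : ℝ × (Fin d → ℝ) → ℝ} (hg : Continuous g) (hc : HasCompactSupport g)
    (q y : Fin d → ℝ) (s : ℝ) : BddCont fun z => g (s, y + z • q) := by
  obtain ⟨M, hM⟩ := exists_bound_of_hasCompactSupport hg hc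
  exact ⟨by fun_prop, M, fun z => hM _⟩

/-- The heat average in direction `q` of `g(s, ·)`, run for time `s - t`. -/
noncomputable def heatH (q : Fin d → ℝ) (t : ℝ) (g : ℝ × (Fin d → ℝ) → ℝ) (s : ℝ)
    (y : Fin d → ℝ) : ℝ := gav (s - t) fun z => g (s, y + z • q)

theorem heatH_eq_heatAv (q : Fin d → ℝ) (t : ℝ) (g : ℝ × (Fin d → ℝ) → ℝ) (s : ℝ)
    (y : Fin d → ℝ) : heatH q t g s y = heatAv (s - t) (fib q y g) (t, 0) := by
  simp [heatH, gav, heatAv, fib]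

theorem corr_gkern_fib {q : Fin d → ℝ} (hq : q ≠ 0) {t a b : ℝ} (ha : t < a) (hab : a ≤ b)
    {g : ℝ × (Fin d → ℝ) → ℝ} (hg : Continuous g) (hc : HasCompactSupport g) (y : Fin d → ℝ) :
    corr (gkern (a - t) (b - t)) (fib q y g) (t, 0) = ∫ s in a..b, heatH q t g s y := by
  have hgf : Continuous (fib q y g) := by unfold fib; fun_prop
  unfold corr
  rw [Measure.volume_eq_prod, integral_prod _ (integrable_mul_shift
    (integrable_gkern (sub_pos.2 ha) _) hgf (hasCompactSupport_fib hq y hc) (t, 0))]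
  rw [← integral_sub_right_eq_self _ t, intervalIntegral.integral_of_le hab,
    ← integral_Icc_eq_integral_Ioc, ← integral_indicator measurableSet_Icc]
  congr 1
  ext s
  unfold gkern
  by_cases hs : s ∈ Icc a b
  · have hs' : s - t ∈ Icc (a - t) (b - t) := ⟨by linarith [hs.1], by linarith [hs.2]⟩
    simp only [indicator_of_mem hs, indicator_of_mem hs']
    rw [heatH_eq_heatAv, heatAv]
  · have hs' : s - t ∉ Icc (a - t) (b - t) := fun h =>
      hs ⟨by linarith [h.1], by linarith [h.2]⟩
    simp only [indicator_of_notMem hs, indicator_of_notMem hs', zero_mul, integral_zero]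

/-- The backward heat operator `∂ₜ + ∂²_q`. -/
noncomputable def heatGen (q : Fin d → ℝ) (g : ℝ × (Fin d → ℝ) → ℝ) : ℝ × (Fin d → ℝ) → ℝ :=
  fun w => dd (1, 0) g w + dd (sp q) (dd (sp q) g) w

theorem contDiff_heatGen (q : Fin d → ℝ) {g : ℝ × (Fin d → ℝ) → ℝ}
    (hg : ContDiff ℝ (⊤ : ℕ∞) g) : ContDiff ℝ (⊤ : ℕ∞) (heatGen q g) :=
  (contDiff_dd _ hg).add (contDiff_dd _ (contDiff_dd _ hg))

theorem hasCompactSupport_heatGen (q : Fin d → ℝ) {g : ℝ × (Fin d → ℝ) → ℝ}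
    (hg : HasCompactSupport g) : HasCompactSupport (heatGen q g) :=
  (hasCompactSupport_dd _ hg).add (hasCompactSupport_dd _ (hasCompactSupport_dd _ hg))

theorem heatH_sub {q : Fin d → ℝ} (hq : q ≠ 0) {t a b : ℝ} (ha : t < a) (hab : a ≤ b)
    {g : ℝ × (Fin d → ℝ) → ℝ} (hg : ContDiff ℝ (⊤ : ℕ∞) g) (hc : HasCompactSupport g)
    (y : Fin d → ℝ) :
    heatH q t g b y - heatH q t g a y = ∫ s in a..b, heatH q t (heatGen q g) s y := by
  have hε : 0 < a - t := sub_pos.2 ha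
  have hN : a - t ≤ b - t := by linarith
  have hgf := contDiff_fib q y hg
  have hcf := hasCompactSupport_fib hq y hc
  have h := corr_kern_add hε hN hgf hcf (t, 0)
  rw [corr_kern_eq hε hgf hcf] at h
  rw [heatH_eq_heatAv, heatH_eq_heatAv, ← h,
    ← corr_gkern_fib hq ha hab (contDiff_heatGen q hg).continuous (hasCompactSupport_heatGen q hc)]
  have e1 : dd (0, 1) (fib q y g) = fib q y (dd (sp q) g) := by
    rw [dd_fib q y hg, one_smul]; rfl
  have e2 : dd (0, 1) (fib q y (dd (sp q) g)) = fib q y (dd (sp q) (dd (sp q) g)) := by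
    rw [dd_fib q y (contDiff_dd _ hg), one_smul]; rfl
  have e3 : dd (1, 0) (fib q y g) = fib q y (dd (1, 0) g) := by
    rw [dd_fib q y hg, zero_smul]
  rw [e1, e2, e3, add_comm]
  have i1 {f : ℝ × (Fin d → ℝ) → ℝ} (hf : Continuous f) (hfc : HasCompactSupport f) :
      Integrable (fib q y f) := by
    have : Continuous (fib q y f) := by unfold fib; fun_prop
    exact this.integrable_of_hasCompactSupport (hasCompactSupport_fib hq y hfc)
  exact (corr_add (measurable_gkern _ _) (bounded_gkern hε _)
    (i1 (contDiff_dd (1, 0) hg).continuous (hasCompactSupport_dd _ hc))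
    (i1 (contDiff_dd (sp q) (contDiff_dd (sp q) hg)).continuous
      (hasCompactSupport_dd _ (hasCompactSupport_dd _ hc))) (t, 0)).symm

theorem abs_heatH_le {q : Fin d → ℝ} {t s : ℝ} (hs : t < s) {g : ℝ × (Fin d → ℝ) → ℝ} {M : ℝ}
    (h : ∀ w, |g w| ≤ M) (y : Fin d → ℝ) : |heatH q t g s y| ≤ M :=
  abs_gav_le (sub_pos.2 hs) fun _ => h _

theorem exists_heatH_lip {q : Fin d → ℝ} (hq : q ≠ 0) {g : ℝ × (Fin d → ℝ) → ℝ}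
    (hg : ContDiff ℝ (⊤ : ℕ∞) g) (hc : HasCompactSupport g) :
    ∃ M, 0 ≤ M ∧ ∀ t a b, t < a → a ≤ b → ∀ y,
      |heatH q t g b y - heatH q t g a y| ≤ M * (b - a) := by
  obtain ⟨M, hM⟩ := exists_bound_of_hasCompactSupport (contDiff_heatGen q hg).continuous
    (hasCompactSupport_heatGen q hc)
  refine ⟨M, (abs_nonneg _).trans (hM 0), fun t a b ha hab y => ?_⟩
  rw [heatH_sub hq ha hab hg hc]
  have := intervalIntegral.norm_integral_le_of_norm_le_const (a := a) (b := b) (C := M)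
    (f := fun s => heatH q t (heatGen q g) s y) (fun s hs => by
      rw [uIoc_of_le hab] at hs
      exact abs_heatH_le (ha.trans hs.1) hM y)
  rwa [abs_of_nonneg (by linarith)] at this

theorem continuousOn_heatH {q : Fin d → ℝ} (hq : q ≠ 0) {g : ℝ × (Fin d → ℝ) → ℝ}
    (hg : ContDiff ℝ (⊤ : ℕ∞) g) (hc : HasCompactSupport g) (t : ℝ) (y : Fin d → ℝ) :
    ContinuousOn (fun s => heatH q t g s y) (Ioi t) := by
  obtain ⟨M, hM0, hM⟩ := exists_heatH_lip hq hg hc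
  have : LipschitzOnWith M.toNNReal (fun s => heatH q t g s y) (Ioi t) := by
    apply LipschitzOnWith.of_dist_le_mul
    intro a ha b hb
    rw [Real.coe_toNNReal _ hM0, Real.dist_eq, Real.dist_eq]
    rcases le_total a b with h | h
    · rw [abs_sub_comm, abs_sub_comm a b, abs_of_nonneg (sub_nonneg.2 h)]
      exact hM t a b ha h y
    · rw [abs_of_nonneg (sub_nonneg.2 h)]
      exact hM t b a hb h y
  exact this.continuousOn

end HeatAlongLines

theorem abs_mul_gk_le {τ : ℝ} (hτ : 0 < τ) (z : ℝ) : |z| * gk τ z ≤ 2 * √τ * gk (2 * τ) z := by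
  have hr := Real.sqrt_pos.2 hτ
  have hπ := Real.sqrt_pos.2 Real.pi_pos
  have hrs : √τ ^ 2 = τ := Real.sq_sqrt hτ.le
  have h2 := Real.sqrt_pos.2 (zero_lt_two (α := ℝ))
  have h2s : √(2 : ℝ) ^ 2 = 2 := Real.sq_sqrt zero_le_two
  set x := z ^ 2 / (8 * τ) with hx
  have hz : |z| ≤ √2 * √τ * Real.exp x := by
    have h1 : |z| ≤ √2 * √τ * (x + 1) := by
      have e : √2 * √τ * (x + 1) = (z ^ 2 + 8 * √τ ^ 2) * √2 / (8 * √τ) := by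
        rw [hx]
        nth_rewrite 2 [← hrs]
        field_simp
      rw [e, le_div_iff₀ (by positivity), ← sq_abs z]
      have h4 : (1 : ℝ) ≤ √2 := Real.one_le_sqrt.2 one_le_two
      have h5 : (√2 * |z| - 4 * √τ) ^ 2 = 2 * |z| ^ 2 + 16 * √τ ^ 2 - 8 * √2 * |z| * √τ := by
        ring_nf; rw [h2s]; ring
      have h6 := sq_nonneg (√2 * |z| - 4 * √τ)
      rw [h5] at h6
      have h7 : √2 * (8 * √2 * |z| * √τ) = 2 * (|z| * (8 * √τ)) := by
        linear_combination (8 * |z| * √τ) * h2s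
      nlinarith [mul_nonneg h2.le h6]
    exact h1.trans (by gcongr; exact Real.add_one_le_exp x)
  have e1 : gk τ z = (2 * √Real.pi * √τ)⁻¹ * (Real.exp (-x) * Real.exp (-x)) := by
    rw [gk, ← Real.exp_add]
    congr 2
    · rw [Real.sqrt_mul (by positivity), Real.sqrt_mul (by positivity),
        show (4 : ℝ) = 2 ^ 2 by norm_num, Real.sqrt_sq (by norm_num)]
    · rw [hx]; field_simp; ring
  have e2 : gk (2 * τ) z = (2 * √Real.pi * √2 * √τ)⁻¹ * Real.exp (-x) := by
    rw [gk]
    congr 2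
    · rw [Real.sqrt_mul (by positivity), Real.sqrt_mul (by positivity), Real.sqrt_mul (by positivity),
        show (4 : ℝ) = 2 ^ 2 by norm_num, Real.sqrt_sq (by norm_num), ← mul_assoc]
    · rw [hx]; field_simp; ring
  rw [e1, e2]
  calc |z| * ((2 * √Real.pi * √τ)⁻¹ * (Real.exp (-x) * Real.exp (-x)))
      ≤ (√2 * √τ * Real.exp x) * ((2 * √Real.pi * √τ)⁻¹ * (Real.exp (-x) * Real.exp (-x))) := by
        gcongr
    _ = 2 * √τ * ((2 * √Real.pi * √2 * √τ)⁻¹ * Real.exp (-x)) := by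
        have : Real.exp x * Real.exp (-x) = 1 := by rw [← Real.exp_add]; simp
        field_simp
        linear_combination √2 ^ 2 * this + h2s

section HeatEstimates

variable {d : ℕ}

theorem measurable_heatH (q : Fin d → ℝ) (t : ℝ) {g : ℝ × (Fin d → ℝ) → ℝ} (hg : Continuous g)
    {Y : ℝ → Fin d → ℝ} (hY : Measurable Y) : Measurable fun s => heatH q t g s (Y s) := by
  have h1 : Measurable fun r : ℝ × ℝ => gk (r.1 - t) r.2 :=
    measurable_gk.comp (by fun_prop : Measurable fun r : ℝ × ℝ => (r.1 - t, r.2))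
  have h2 : Measurable fun r : ℝ × ℝ => g (r.1, Y r.1 + r.2 • q) :=
    hg.measurable.comp (by fun_prop)
  exact (h1.mul h2).stronglyMeasurable.integral_prod_right.measurable

theorem exists_heatH_sub_le (q : Fin d → ℝ) {g : ℝ × (Fin d → ℝ) → ℝ}
    (hg : ContDiff ℝ (⊤ : ℕ∞) g) (hc : HasCompactSupport g) :
    ∃ M, 0 ≤ M ∧ ∀ t s, t < s → ∀ x y,
      |heatH q t g s y - g (t, x)| ≤ M * (√(s - t) + (s - t) + ‖y - x‖) := by
  obtain ⟨K, hK⟩ := hg.lipschitzWith_of_hasCompactSupport hc (by simp)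
  refine ⟨K * (2 * ‖q‖ + 1), by positivity, fun t s hts x y => ?_⟩
  have hτ : 0 < s - t := sub_pos.2 hts
  have hgi := (integrable_gk hτ)
  have hgi2 := (integrable_gk (mul_pos zero_lt_two hτ))
  have e : heatH q t g s y - g (t, x) = ∫ z, gk (s - t) z * (g (s, y + z • q) - g (t, x)) := by
    simp only [mul_sub]
    rw [integral_sub ((bddCont_slice hg.continuous hc q y s).integrable hτ) (hgi.mul_const _),
      integral_mul_const, integral_gk hτ, one_mul]
    rfl
  have hb (z : ℝ) : ‖gk (s - t) z * (g (s, y + z • q) - g (t, x))‖ ≤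
      K * ((s - t) + ‖y - x‖) * gk (s - t) z + K * ‖q‖ * (2 * √(s - t)) * gk (2 * (s - t)) z := by
    have h1 := hK.dist_le_mul (s, y + z • q) (t, x)
    rw [Real.dist_eq] at h1
    have h2 : dist (s, y + z • q) (t, x) ≤ (s - t) + ‖y - x‖ + |z| * ‖q‖ := by
      rw [Prod.dist_eq]
      apply max_le
      · simp only [Real.dist_eq, abs_of_pos hτ]
        have : 0 ≤ ‖y - x‖ := norm_nonneg _
        have : 0 ≤ |z| * ‖q‖ := by positivity
        linarith
      · simp only [dist_eq_norm]
        have : ‖y + z • q - x‖ ≤ ‖y - x‖ + |z| * ‖q‖ := by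
          rw [← Real.norm_eq_abs, ← norm_smul, add_sub_right_comm]
          exact norm_add_le _ _
        linarith
    have h0 := gk_nonneg (s - t) z
    rw [norm_mul, Real.norm_eq_abs, Real.norm_eq_abs, abs_of_nonneg h0]
    calc gk (s - t) z * |g (s, y + z • q) - g (t, x)|
        ≤ gk (s - t) z * (K * ((s - t) + ‖y - x‖ + |z| * ‖q‖)) := by
          gcongr
          exact h1.trans (by gcongr)
      _ = K * ((s - t) + ‖y - x‖) * gk (s - t) z + K * ‖q‖ * (|z| * gk (s - t) z) := by ring
      _ ≤ K * ((s - t) + ‖y - x‖) * gk (s - t) z +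
          K * ‖q‖ * (2 * √(s - t) * gk (2 * (s - t)) z) := by
          have h3 := mul_le_mul_of_nonneg_left (abs_mul_gk_le hτ z)
            (by positivity : 0 ≤ K * ‖q‖)
          linarith
      _ = _ := by ring
  rw [e, ← Real.norm_eq_abs]
  refine (norm_integral_le_of_norm_le ((hgi.const_mul _).add (hgi2.const_mul _))
    (ae_of_all _ hb)).trans ?_
  simp only [Pi.add_apply]
  rw [integral_add (hgi.const_mul _) (hgi2.const_mul _), integral_const_mul, integral_const_mul,
    integral_gk hτ, integral_gk (mul_pos zero_lt_two hτ)]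
  have hK0 : (0 : ℝ) ≤ K := K.2
  have hq0 : 0 ≤ ‖q‖ := norm_nonneg q
  have : 0 ≤ K * (2 * ‖q‖) * ((s - t) + ‖y - x‖) := by positivity
  have : 0 ≤ K * √(s - t) := by positivity
  nlinarith

theorem exists_heatH_taylor (q : Fin d → ℝ) {g : ℝ × (Fin d → ℝ) → ℝ}
    (hg : ContDiff ℝ (⊤ : ℕ∞) g) (hc : HasCompactSupport g) :
    ∃ M, 0 ≤ M ∧ ∀ t s, t < s → ∀ y ξ,
      |heatH q t g s (y + ξ) + heatH q t g s (y - ξ) - 2 * heatH q t g s y -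
        ∑ i, ∑ j, ξ i * ξ j * heatH q t (dij i j g) s y| ≤ M * ‖ξ‖ ^ 3 := by
  obtain ⟨M, hM0, hM⟩ := exists_taylor_bound hg hc
  refine ⟨M, hM0, fun t s hts y ξ => ?_⟩
  have hτ : 0 < s - t := sub_pos.2 hts
  have b (y : Fin d → ℝ) := bddCont_slice hg.continuous hc q y s
  have b2 (r : Fin d × Fin d) := bddCont_slice (contDiff_dij r.1 r.2 hg).continuous
    (hasCompactSupport_dij r.1 r.2 hc) q y s
  have e : heatH q t g s (y + ξ) + heatH q t g s (y - ξ) - 2 * heatH q t g s y -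
        ∑ i, ∑ j, ξ i * ξ j * heatH q t (dij i j g) s y =
      gav (s - t) fun z => (g (s, y + ξ + z • q) + g (s, y - ξ + z • q) +
        (-2) * g (s, y + z • q)) + ∑ r : Fin d × Fin d, (-(ξ r.1 * ξ r.2)) *
          dij r.1 r.2 g (s, y + z • q) := by
    rw [gav_add hτ (((b _).add (b _)).add ((b _).const_mul _)) (BddCont.sum _ _ b2),
      gav_add hτ ((b _).add (b _)) ((b _).const_mul _), gav_add hτ (b _) (b _), gav_const_mul,
      gav_sum hτ _ _ b2, Fintype.sum_prod_type]
    simp only [neg_mul, Finset.sum_neg_distrib]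
    rfl
  rw [e]
  apply abs_gav_le hτ
  intro z
  have := hM (s, y + z • q) ξ
  convert this using 2
  simp only [Fintype.sum_prod_type, neg_mul, Finset.sum_neg_distrib, sp, Prod.mk_add_mk,
    Prod.mk_sub_mk, add_zero, sub_zero]
  rw [add_right_comm y ξ, sub_add_eq_add_sub y ξ]
  ring

end HeatEstimates

section Cell

variable {d : ℕ}

open scoped MatrixOrder Matrix in
theorem exists_jumps {B : Fin d → Fin d → ℝ} (hs : ∀ i j, B i j = B j i)
    (hB : ∀ x : Fin d → ℝ, 0 ≤ ∑ i, ∑ j, B i j * x i * x j) {b : ℝ} (hb : ∀ i, B i i ≤ b) :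
    ∃ η : Fin d → Fin d → ℝ, (∀ i j, ∑ r, η r i * η r j = 2 * d * B i j) ∧
      ∀ r, ‖η r‖ ≤ √(2 * d * b) := by
  have hpsd : (Matrix.of B).PosSemidef := by
    refine Matrix.PosSemidef.of_dotProduct_mulVec_nonneg ?_ fun x => ?_
    · ext i j
      simpa using hs j i
    · have := hB x
      refine this.trans_eq ?_
      rw [Matrix.dot_mulVec_eq_sum_sum, Finset.sum_comm]
      apply Finset.sum_congr rfl; intro i _
      apply Finset.sum_congr rfl; intro j _
      simp only [star_trivial, Matrix.of_apply]; ring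
  obtain ⟨R, hR⟩ := CStarAlgebra.nonneg_iff_eq_star_mul_self.mp hpsd.nonneg
  have hR' (i j : Fin d) : B i j = ∑ r, R r i * R r j := by
    have := congrFun (congrFun hR i) j
    simpa [Matrix.mul_apply, Matrix.star_eq_conjTranspose] using this
  have hd0 : (0 : ℝ) ≤ 2 * d := by positivity
  refine ⟨fun r i => √(2 * d) * R r i, fun i j => ?_, fun r => ?_⟩
  · rw [hR', Finset.mul_sum]
    apply Finset.sum_congr rfl; intro r _
    have := Real.sq_sqrt hd0
    linear_combination (R r i * R r j) * this
  · rw [pi_norm_le_iff_of_nonneg (Real.sqrt_nonneg _)]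
    intro i
    rw [Real.norm_eq_abs]
    apply Real.abs_le_sqrt
    rw [mul_pow, Real.sq_sqrt hd0]
    gcongr
    refine le_trans ?_ (hb i)
    rw [hR', sq]
    exact Finset.single_le_sum (f := fun r => R r i * R r i) (fun r _ => mul_self_nonneg _)
      (Finset.mem_univ r)

/-- The operator `∂ₜ + ∑ cᵢⱼ ∂²ᵢⱼ` applied to the heat average of `g`. -/
noncomputable def heatF (c : ℝ → Matrix (Fin d) (Fin d) ℝ) (q : Fin d → ℝ) (t : ℝ)
    (g : ℝ × (Fin d → ℝ) → ℝ) (s : ℝ) (y : Fin d → ℝ) : ℝ :=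
  heatH q t (dd (1, 0) g) s y + ∑ i, ∑ j, c s i j * heatH q t (dij i j g) s y

theorem heatH_heatGen (q : Fin d → ℝ) {g : ℝ × (Fin d → ℝ) → ℝ} (hg : ContDiff ℝ (⊤ : ℕ∞) g)
    (hc : HasCompactSupport g) {t s : ℝ} (hts : t < s) (y : Fin d → ℝ) :
    heatH q t (heatGen q g) s y =
      heatH q t (dd (1, 0) g) s y + ∑ i, ∑ j, q i * q j * heatH q t (dij i j g) s y := by
  have hτ : 0 < s - t := sub_pos.2 hts
  have b2 (r : Fin d × Fin d) := bddCont_slice (contDiff_dij r.1 r.2 hg).continuous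
    (hasCompactSupport_dij r.1 r.2 hc) q y s
  have e : heatH q t (heatGen q g) s y = gav (s - t) fun z => dd (1, 0) g (s, y + z • q) +
      ∑ r : Fin d × Fin d, (q r.1 * q r.2) * dij r.1 r.2 g (s, y + z • q) := by
    unfold heatH heatGen
    simp only [dd_sp_dd_sp q q hg, Fintype.sum_prod_type]
  rw [e, gav_add hτ (bddCont_slice (contDiff_dd _ hg).continuous (hasCompactSupport_dd _ hc) q y s)
    (BddCont.sum _ _ b2), gav_sum hτ _ _ b2, Fintype.sum_prod_type]
  rfl

theorem intervalIntegrable_of_bound {f : ℝ → ℝ} (hf : Measurable f) {a b M : ℝ} (hab : a ≤ b)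
    (hM : ∀ s ∈ Ioc a b, |f s| ≤ M) : IntervalIntegrable f volume a b := by
  refine (intervalIntegrable_const (c := M)).mono_fun' hf.aestronglyMeasurable ?_
  rw [uIoc_of_le hab]
  exact (ae_restrict_iff' measurableSet_Ioc).2 (ae_of_all _ fun s hs => hM s hs)

theorem exists_cell {q : Fin d → ℝ} (hq : q ≠ 0) {g : ℝ × (Fin d → ℝ) → ℝ}
    (hg : ContDiff ℝ (⊤ : ℕ∞) g) (hc : HasCompactSupport g)
    {c : ℝ → Matrix (Fin d) (Fin d) ℝ} (hcm : ∀ i j, Measurable fun t => c t i j)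
    (hcs : ∀ t, (c t).IsSymm)
    (hcq : ∀ t (ξ : Fin d → ℝ), (∑ i, q i * ξ i) ^ 2 ≤ ∑ i, ∑ j, c t i j * ξ i * ξ j)
    {A K : ℝ} (hK0 : 0 ≤ K) (hK : ∀ t ∈ Icc (-A) A, ∀ i j, |c t i j - q i * q j| ≤ K) :
    ∃ M, 0 ≤ M ∧ ∀ a b, -A ≤ a → a ≤ b → b ≤ A → ∃ ξ : Fin d × Bool → Fin d → ℝ,
      (∀ r, ‖ξ r‖ ≤ √(2 * d * (K * (b - a)))) ∧
      ∀ t, t < a → ∀ y,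
        |(∑ r, heatH q t g b (y + ξ r)) / (2 * d) - heatH q t g a y -
          ∫ s in a..b, heatF c q t g s y| ≤ M * (√(b - a) ^ 3 + (b - a) ^ 2) := by
  obtain ⟨M₁, hM₁0, hM₁⟩ := exists_heatH_taylor q hg hc
  choose M₂ hM₂0 hM₂ using fun i j => exists_heatH_lip hq (contDiff_dij i j hg)
    (hasCompactSupport_dij i j hc)
  have hd : (0 : ℝ) < d := by
    rcases Nat.eq_zero_or_pos d with rfl | h
    · exact absurd (Subsingleton.elim _ _) hq
    · exact_mod_cast h
  have hS0 : 0 ≤ ∑ i, ∑ j, K * M₂ i j :=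
    Finset.sum_nonneg fun i _ => Finset.sum_nonneg fun j _ => mul_nonneg hK0 (hM₂0 i j)
  refine ⟨M₁ * √(2 * d * K) ^ 3 + ∑ i, ∑ j, K * M₂ i j, by positivity, fun a b ha hab hb => ?_⟩
  have hba : 0 ≤ b - a := sub_nonneg.2 hab
  have hKs {s : ℝ} (hs : s ∈ Ioc a b) : ∀ i j, |c s i j - q i * q j| ≤ K :=
    hK s ⟨by linarith [hs.1], by linarith [hs.2]⟩
  have hci (i j : Fin d) : IntervalIntegrable (fun s => c s i j - q i * q j) volume a b :=
    intervalIntegrable_of_bound ((hcm i j).sub_const _) hab fun s hs => hKs hs i j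
  set B : Fin d → Fin d → ℝ := fun i j => ∫ s in a..b, (c s i j - q i * q j) with hB
  obtain ⟨η, hη, hηn⟩ := exists_jumps (B := B) (b := K * (b - a))
    (fun i j => by simp only [hB, (hcs _).apply i j, mul_comm (q i)])
    (fun x => by
      have e : ∑ i, ∑ j, B i j * x i * x j =
          ∫ s in a..b, ∑ i, ∑ j, (c s i j - q i * q j) * x i * x j := by
        have h1 (i j : Fin d) : IntervalIntegrable
            (fun s => (c s i j - q i * q j) * x i * x j) volume a b :=
          ((hci i j).mul_const _).mul_const _
        rw [intervalIntegral.integral_finsetSum fun i _ => by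
          simpa only [Finset.sum_fn] using IntervalIntegrable.sum Finset.univ fun j _ => h1 i j]
        apply Finset.sum_congr rfl; intro i _
        rw [intervalIntegral.integral_finsetSum fun j _ => h1 i j]
        apply Finset.sum_congr rfl; intro j _
        rw [intervalIntegral.integral_mul_const, intervalIntegral.integral_mul_const]
      rw [e]
      apply intervalIntegral.integral_nonneg hab
      intro s _
      have h2 : (∑ i, q i * x i) ^ 2 = ∑ i, ∑ j, q i * q j * x i * x j := by
        rw [sq, Finset.sum_mul_sum]
        apply Finset.sum_congr rfl; intro i _
        apply Finset.sum_congr rfl; intro j _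
        ring
      have h3 := hcq s x
      rw [h2, ← sub_nonneg, ← Finset.sum_sub_distrib] at h3
      refine h3.trans_eq ?_
      apply Finset.sum_congr rfl; intro i _
      rw [← Finset.sum_sub_distrib]
      apply Finset.sum_congr rfl; intro j _
      ring)
    (fun i => by
      have := intervalIntegral.norm_integral_le_of_norm_le_const (a := a) (b := b) (C := K)
        (f := fun s => c s i i - q i * q i) (fun s hs => by
          rw [uIoc_of_le hab] at hs
          exact hKs hs i i)
      rw [abs_of_nonneg hba] at this
      exact (le_abs_self _).trans this)
  refine ⟨fun r => if r.2 then η r.1 else -η r.1, fun r => ?_, fun t hta y => ?_⟩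
  · dsimp only
    split_ifs
    · exact hηn _
    · rw [norm_neg]; exact hηn _
  have htb : t < b := hta.trans_le hab
  set H : Fin d → Fin d → ℝ → ℝ := fun i j s => heatH q t (dij i j g) s y with hH
  have hHi (i j : Fin d) : IntervalIntegrable (fun s => (c s i j - q i * q j) * H i j s)
      volume a b := by
    refine (hci i j).mul_continuousOn ?_
    refine (continuousOn_heatH hq (contDiff_dij i j hg) (hasCompactSupport_dij i j hc) t y).mono ?_
    intro s hs
    rw [uIcc_of_le hab] at hs
    exact hta.trans_le hs.1
  have hGi : IntervalIntegrable (fun s => heatH q t (heatGen q g) s y) volume a b := by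
    refine (continuousOn_heatH hq (contDiff_heatGen q hg)
      (hasCompactSupport_heatGen q hc) t y |>.mono ?_).intervalIntegrable
    intro s hs
    rw [uIcc_of_le hab] at hs
    exact hta.trans_le hs.1
  -- the average over the jumps
  have e1 : |(∑ r : Fin d × Bool, heatH q t g b (y + if r.2 then η r.1 else -η r.1)) / (2 * d) -
      heatH q t g b y - ∑ i, ∑ j, B i j * H i j b| ≤ M₁ * √(2 * d * K) ^ 3 * √(b - a) ^ 3 := by
    have e : (∑ r : Fin d × Bool, heatH q t g b (y + if r.2 then η r.1 else -η r.1)) / (2 * d) -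
      heatH q t g b y - ∑ i, ∑ j, B i j * H i j b = (∑ r, (heatH q t g b (y + η r) +
        heatH q t g b (y - η r) - 2 * heatH q t g b y -
        ∑ i, ∑ j, η r i * η r j * H i j b)) / (2 * d) := by
      have h1 : ∑ r, ∑ i, ∑ j, η r i * η r j * H i j b = 2 * d * ∑ i, ∑ j, B i j * H i j b := by
        rw [Finset.sum_comm, Finset.mul_sum]
        apply Finset.sum_congr rfl; intro i _
        rw [Finset.sum_comm, Finset.mul_sum]
        apply Finset.sum_congr rfl; intro j _
        rw [← Finset.sum_mul, hη]
        ring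
      rw [Finset.sum_sub_distrib, Finset.sum_sub_distrib, h1, Fintype.sum_prod_type]
      simp only [Fintype.sum_bool, if_true, Bool.false_eq_true, if_false, ← sub_eq_add_neg,
        Finset.sum_const, Finset.card_univ, Fintype.card_fin, nsmul_eq_mul]
      field_simp
    rw [e, abs_div, abs_of_pos (by positivity : (0 : ℝ) < 2 * d), div_le_iff₀ (by positivity)]
    have hsq : √(2 * d * (K * (b - a))) = √(2 * d * K) * √(b - a) := by
      rw [← mul_assoc, Real.sqrt_mul (by positivity)]
    calc _ ≤ ∑ r : Fin d, M₁ * (√(2 * d * K) * √(b - a)) ^ 3 := by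
          refine (Finset.abs_sum_le_sum_abs _ _).trans (Finset.sum_le_sum fun r _ => ?_)
          refine (hM₁ t b htb y (η r)).trans ?_
          rw [← hsq]
          gcongr
          exact hηn r
      _ = d * (M₁ * √(2 * d * K) ^ 3 * √(b - a) ^ 3) := by
          rw [Finset.sum_const, Finset.card_univ, Fintype.card_fin, nsmul_eq_mul]; ring
      _ ≤ _ := by
          have : 0 ≤ M₁ * √(2 * d * K) ^ 3 * √(b - a) ^ 3 := by positivity
          nlinarith
  have e2 := heatH_sub hq hta hab hg hc y
  have e3 : ∫ s in a..b, heatF c q t g s y = (∫ s in a..b, heatH q t (heatGen q g) s y) +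
      ∑ i, ∑ j, ∫ s in a..b, (c s i j - q i * q j) * H i j s := by
    have hs1 (i : Fin d) : IntervalIntegrable (fun s => ∑ j, (c s i j - q i * q j) * H i j s)
        volume a b := by
      simpa only [Finset.sum_fn] using IntervalIntegrable.sum Finset.univ fun j _ => hHi i j
    have hs2 : IntervalIntegrable (fun s => ∑ i, ∑ j, (c s i j - q i * q j) * H i j s)
        volume a b := by
      simpa only [Finset.sum_fn] using IntervalIntegrable.sum Finset.univ fun i _ => hs1 i
    simp only [← intervalIntegral.integral_finsetSum fun j _ => hHi _ j]
    rw [← intervalIntegral.integral_finsetSum fun i _ => hs1 i,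
      ← intervalIntegral.integral_add hGi hs2]
    apply intervalIntegral.integral_congr
    intro s hs
    rw [uIcc_of_le hab] at hs
    simp only
    rw [heatH_heatGen q hg hc (hta.trans_le hs.1), heatF, add_assoc, ← Finset.sum_add_distrib]
    congr 1
    apply Finset.sum_congr rfl; intro i _
    rw [← Finset.sum_add_distrib]
    apply Finset.sum_congr rfl; intro j _
    simp only [hH]
    ring
  have e4 : |∑ i, ∑ j, B i j * H i j b - ∑ i, ∑ j, ∫ s in a..b, (c s i j - q i * q j) * H i j s| ≤
      (∑ i, ∑ j, K * M₂ i j) * (b - a) ^ 2 := by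
    rw [← Finset.sum_sub_distrib, Finset.sum_mul]
    refine (Finset.abs_sum_le_sum_abs _ _).trans (Finset.sum_le_sum fun i _ => ?_)
    rw [← Finset.sum_sub_distrib, Finset.sum_mul]
    refine (Finset.abs_sum_le_sum_abs _ _).trans (Finset.sum_le_sum fun j _ => ?_)
    simp only [hB]
    rw [← intervalIntegral.integral_mul_const,
      ← intervalIntegral.integral_sub ((hci i j).mul_const _) (hHi i j)]
    have := intervalIntegral.norm_integral_le_of_norm_le_const (a := a) (b := b)
      (C := K * (M₂ i j * (b - a)))
      (f := fun s => (c s i j - q i * q j) * H i j b - (c s i j - q i * q j) * H i j s)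
      (fun s hs => by
        rw [uIoc_of_le hab] at hs
        rw [← mul_sub, norm_mul]
        refine mul_le_mul (hKs hs i j) ?_ (norm_nonneg _) hK0
        refine (hM₂ i j t s b (hta.trans hs.1) hs.2 y).trans ?_
        have := hM₂0 i j
        gcongr
        exact hs.1.le)
    rw [abs_of_nonneg hba] at this
    refine this.trans_eq ?_
    ring
  have key : (∑ r : Fin d × Bool, heatH q t g b (y + if r.2 then η r.1 else -η r.1)) / (2 * d) -
      heatH q t g a y - ∫ s in a..b, heatF c q t g s y =
      ((∑ r : Fin d × Bool, heatH q t g b (y + if r.2 then η r.1 else -η r.1)) / (2 * d) -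
      heatH q t g b y - ∑ i, ∑ j, B i j * H i j b) +
      (∑ i, ∑ j, B i j * H i j b - ∑ i, ∑ j, ∫ s in a..b, (c s i j - q i * q j) * H i j s) := by
    rw [e3, ← e2]; ring
  simp only
  rw [key]
  refine (abs_add_le _ _).trans ((add_le_add e1 e4).trans ?_)
  have h1 : 0 ≤ √(b - a) ^ 3 := by positivity
  have h2 : 0 ≤ (b - a) ^ 2 := by positivity
  have h3 : 0 ≤ M₁ * √(2 * d * K) ^ 3 := by positivity
  nlinarith [mul_nonneg h3 h2, mul_nonneg hS0 h1]

end Cell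

section Walk

theorem sum_sum_update {ι J : Type*} [Fintype ι] [DecidableEq ι] [Fintype J] (k : ι)
    (g : (ι → J) → ℝ) :
    ∑ ω, ∑ j, g (Function.update ω k j) = Fintype.card J * ∑ ω, g ω := by
  have e : Function.Involutive fun r : (ι → J) × J => (Function.update r.1 k r.2, r.1 k) := by
    rintro ⟨ω, j⟩
    simp
  have h := Equiv.sum_comp (e.toPerm _) fun r : (ι → J) × J => g r.1
  rw [Fintype.sum_prod_type, Fintype.sum_prod_type] at h
  simp only [Function.Involutive.coe_toPerm, Finset.sum_const, nsmul_eq_mul, Finset.card_univ] at h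
  rw [h, Finset.mul_sum]

variable {J E : Type*} [AddCommGroup E] {n : ℕ}

/-- The walk which makes the jump `ξ k (ω k)` at time `a + (k + 1) δ`. -/
noncomputable def walk (a δ : ℝ) (ξ : Fin n → J → E) (ω : Fin n → J) (s : ℝ) : E :=
  ∑ k : Fin n, (Ici (a + ((k : ℕ) + 1 : ℕ) * δ)).indicator (fun _ => ξ k (ω k)) s

theorem grid_le_iff {a δ s : ℝ} (hδ : 0 < δ) {k : ℕ} (hs : s ∈ Ico (a + k * δ) (a + (k + 1 : ℕ) * δ))
    (l : ℕ) : a + l * δ ≤ s ↔ l ≤ k := by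
  constructor
  · intro h
    have h1 : (l : ℝ) * δ < (k + 1 : ℕ) * δ := by linarith [hs.2]
    have h2 : (l : ℝ) < (k + 1 : ℕ) := lt_of_mul_lt_mul_right h1 hδ.le
    exact Nat.lt_succ_iff.1 (by exact_mod_cast h2)
  · intro h
    have h1 : (l : ℝ) ≤ k := by exact_mod_cast h
    have := mul_le_mul_of_nonneg_right h1 hδ.le
    linarith [hs.1]

theorem walk_eq_sum {a δ : ℝ} (hδ : 0 < δ) (ξ : Fin n → J → E) (ω : Fin n → J) {k : ℕ} {s : ℝ}
    (hs : s ∈ Ico (a + k * δ) (a + (k + 1 : ℕ) * δ)) :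
    walk a δ ξ ω s = ∑ l : Fin n, if (l : ℕ) < k then ξ l (ω l) else 0 := by
  unfold walk
  apply Finset.sum_congr rfl
  intro l _
  simp only [indicator_apply, mem_Ici, grid_le_iff hδ hs, Nat.succ_le_iff]

theorem grid_mem_Ico {a δ : ℝ} (hδ : 0 < δ) (k : ℕ) :
    a + k * δ ∈ Ico (a + k * δ) (a + (k + 1 : ℕ) * δ) := by
  refine ⟨le_rfl, ?_⟩
  push_cast
  linarith

theorem walk_eq_of_mem {a δ : ℝ} (hδ : 0 < δ) (ξ : Fin n → J → E) (ω : Fin n → J) {k : ℕ} {s : ℝ}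
    (hs : s ∈ Ico (a + k * δ) (a + (k + 1 : ℕ) * δ)) :
    walk a δ ξ ω s = walk a δ ξ ω (a + k * δ) := by
  rw [walk_eq_sum hδ ξ ω hs, walk_eq_sum hδ ξ ω (grid_mem_Ico hδ k)]

theorem walk_succ {a δ : ℝ} (hδ : 0 < δ) (ξ : Fin n → J → E) (ω : Fin n → J) (k : Fin n) :
    walk a δ ξ ω (a + ((k : ℕ) + 1 : ℕ) * δ) = walk a δ ξ ω (a + (k : ℕ) * δ) + ξ k (ω k) := by
  rw [walk_eq_sum hδ ξ ω (grid_mem_Ico hδ _), walk_eq_sum hδ ξ ω (grid_mem_Ico hδ _)]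
  have h : ξ k (ω k) = ∑ l : Fin n, if l = k then ξ l (ω l) else 0 := by simp
  rw [h, ← Finset.sum_add_distrib]
  apply Finset.sum_congr rfl
  intro l _
  have hlk : l = k ↔ (l : ℕ) = k := Fin.ext_iff
  simp only [hlk]
  split_ifs <;> first | omega | simp

theorem walk_update {a δ : ℝ} (ξ : Fin n → J → E) (ω : Fin n → J) (k : Fin n) (j : J) {s : ℝ}
    (hs : s < a + ((k : ℕ) + 1 : ℕ) * δ) :
    walk a δ ξ (Function.update ω k j) s = walk a δ ξ ω s := by
  unfold walk
  apply Finset.sum_congr rfl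
  intro l _
  by_cases hl : l = k
  · subst hl
    rw [indicator_of_notMem (by simpa using hs), indicator_of_notMem (by simpa using hs)]
  · rw [Function.update_of_ne hl]

theorem measurable_walk {d : ℕ} (a δ : ℝ) (ξ : Fin n → J → Fin d → ℝ) (ω : Fin n → J) :
    Measurable (walk a δ ξ ω) :=
  Finset.measurable_sum _ fun _ _ => measurable_const.indicator measurableSet_Ici

end Walk

section Support

variable {d : ℕ}

theorem tsupport_dd_subset {E : Type*} [NormedAddCommGroup E] [NormedSpace ℝ E] (v : E)
    (f : E → ℝ) : tsupport (dd v f) ⊆ tsupport f :=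
  (closure_mono (Function.support_subset_iff'.2 fun x hx => by
    rw [dd, Function.notMem_support.1 hx]; rfl)).trans (tsupport_fderiv_subset ℝ (f := f))

theorem measurable_heatF {c : ℝ → Matrix (Fin d) (Fin d) ℝ}
    (hcm : ∀ i j, Measurable fun t => c t i j) (q : Fin d → ℝ) (t : ℝ)
    {g : ℝ × (Fin d → ℝ) → ℝ} (hg : ContDiff ℝ (⊤ : ℕ∞) g) {Y : ℝ → Fin d → ℝ}
    (hY : Measurable Y) : Measurable fun s => heatF c q t g s (Y s) := by
  refine (measurable_heatH q t (contDiff_dd _ hg).continuous hY).add ?_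
  refine Finset.measurable_fun_sum _ fun i _ => Finset.measurable_fun_sum _ fun j _ => ?_
  exact (hcm i j).mul (measurable_heatH q t (contDiff_dij i j hg).continuous hY)

theorem heatH_eq_zero {q : Fin d → ℝ} {t s : ℝ} {g : ℝ × (Fin d → ℝ) → ℝ}
    (h : ∀ y, g (s, y) = 0) (y : Fin d → ℝ) : heatH q t g s y = 0 := by
  simp [heatH, gav, h]

theorem heatF_eq_zero {c : ℝ → Matrix (Fin d) (Fin d) ℝ} {q : Fin d → ℝ} {t s A : ℝ}
    {g : ℝ × (Fin d → ℝ) → ℝ} (hA : ∀ w ∈ tsupport g, w.1 ∈ Ioo (-A) A) (hs : A ≤ s)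
    (y : Fin d → ℝ) : heatF c q t g s y = 0 := by
  have h {f : ℝ × (Fin d → ℝ) → ℝ} (hf : tsupport f ⊆ tsupport g) (y : Fin d → ℝ) :
      f (s, y) = 0 :=
    image_eq_zero_of_notMem_tsupport fun hm => absurd (hA _ (hf hm)).2 (not_lt.2 hs)
  rw [heatF, heatH_eq_zero (h (tsupport_dd_subset _ _)), zero_add]
  apply Finset.sum_eq_zero; intro i _
  apply Finset.sum_eq_zero; intro j _
  have h0 : heatH q t (dij i j g) s y = 0 :=
    heatH_eq_zero (h ((tsupport_dd_subset _ _).trans (tsupport_dd_subset _ _))) y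
  rw [h0, mul_zero]

theorem exists_heatF_bound {c : ℝ → Matrix (Fin d) (Fin d) ℝ} (q : Fin d → ℝ) {A K : ℝ}
    (hK : ∀ t ∈ Icc (-A) A, ∀ i j, |c t i j| ≤ K)
    {g : ℝ × (Fin d → ℝ) → ℝ} (hg : ContDiff ℝ (⊤ : ℕ∞) g) (hc : HasCompactSupport g)
    (hA : ∀ w ∈ tsupport g, w.1 ∈ Ioo (-A) A) :
    ∃ L, 0 ≤ L ∧ ∀ t s, t < s → -A ≤ s → ∀ y, |heatF c q t g s y| ≤ L := by
  obtain ⟨M, hM⟩ := exists_bound_of_hasCompactSupport (contDiff_dd (1, 0) hg).continuous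
    (hasCompactSupport_dd _ hc)
  choose M' hM' using fun i j => exists_bound_of_hasCompactSupport (contDiff_dij i j hg).continuous
    (hasCompactSupport_dij i j hc)
  have hM0 : 0 ≤ M := (abs_nonneg _).trans (hM 0)
  have hM0' (i j) : 0 ≤ M' i j := (abs_nonneg _).trans (hM' i j 0)
  have hS : 0 ≤ ∑ i, ∑ j, |K| * M' i j :=
    Finset.sum_nonneg fun i _ => Finset.sum_nonneg fun j _ => mul_nonneg (abs_nonneg _) (hM0' i j)
  refine ⟨M + ∑ i, ∑ j, |K| * M' i j, by positivity, fun t s hts hs y => ?_⟩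
  rcases le_or_gt A s with h | h
  · rw [heatF_eq_zero hA h, abs_zero]
    positivity
  · refine (abs_add_le _ _).trans (add_le_add (abs_heatH_le hts hM y) ?_)
    refine (Finset.abs_sum_le_sum_abs _ _).trans (Finset.sum_le_sum fun i _ => ?_)
    refine (Finset.abs_sum_le_sum_abs _ _).trans (Finset.sum_le_sum fun j _ => ?_)
    rw [abs_mul]
    exact mul_le_mul ((hK s ⟨hs, h.le⟩ i j).trans (le_abs_self _)) (abs_heatH_le hts (hM' i j) y)
      (abs_nonneg _) (abs_nonneg _)

end Support

section WalkApproximation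

variable {d : ℕ}

theorem intervalIntegrable_heatF {c : ℝ → Matrix (Fin d) (Fin d) ℝ}
    (hcm : ∀ i j, Measurable fun t => c t i j) {q : Fin d → ℝ}
    {g : ℝ × (Fin d → ℝ) → ℝ} (hg : ContDiff ℝ (⊤ : ℕ∞) g) {A L : ℝ}
    (hL : ∀ t s, t < s → -A ≤ s → ∀ y, |heatF c q t g s y| ≤ L) {Y : ℝ → Fin d → ℝ}
    (hY : Measurable Y) {t a b : ℝ} (ht : -A ≤ t) (ha : t < a) (hb : t < b) :
    IntervalIntegrable (fun s => heatF c q t g s (Y s)) volume a b := by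
  have hm := measurable_heatF hcm q t hg hY
  rcases le_total a b with h | h
  · exact intervalIntegrable_of_bound hm h fun s hs =>
      hL t s (ha.trans hs.1) (by linarith [hs.1]) _
  · exact (intervalIntegrable_of_bound hm h fun s hs =>
      hL t s (hb.trans hs.1) (by linarith [hs.1]) _).symm

/-- One step of the walk: the averaged heat flow along the walk satisfies the equation
up to the error made on one cell of the grid. -/
theorem abs_walk_step_le {c : ℝ → Matrix (Fin d) (Fin d) ℝ} {q : Fin d → ℝ}
    {g : ℝ × (Fin d → ℝ) → ℝ} {A δ e : ℝ} (hδ : 0 < δ) {n : ℕ} (hd : 0 < d)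
    (ξ : Fin n → Fin d × Bool → Fin d → ℝ) (k : Fin n) {t : ℝ}
    (ht : t < -A + (k : ℕ) * δ)
    (h : ∀ y, |(∑ r, heatH q t g (-A + ((k : ℕ) + 1 : ℕ) * δ) (y + ξ k r)) / (2 * d) -
      heatH q t g (-A + (k : ℕ) * δ) y -
        ∫ s in (-A + (k : ℕ) * δ)..(-A + ((k : ℕ) + 1 : ℕ) * δ), heatF c q t g s y| ≤ e)
    (x : Fin d → ℝ) :
    |∑ ω : Fin n → Fin d × Bool, heatH q t g (-A + ((k : ℕ) + 1 : ℕ) * δ)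
          (x + (walk (-A) δ ξ ω (-A + ((k : ℕ) + 1 : ℕ) * δ) - walk (-A) δ ξ ω t)) -
        ∑ ω : Fin n → Fin d × Bool, heatH q t g (-A + (k : ℕ) * δ)
          (x + (walk (-A) δ ξ ω (-A + (k : ℕ) * δ) - walk (-A) δ ξ ω t)) -
        ∑ ω : Fin n → Fin d × Bool, ∫ s in (-A + (k : ℕ) * δ)..(-A + ((k : ℕ) + 1 : ℕ) * δ),
          heatF c q t g s (x + (walk (-A) δ ξ ω s - walk (-A) δ ξ ω t))| ≤
      Fintype.card (Fin n → Fin d × Bool) * e := by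
  have hd' : (0 : ℝ) < d := by exact_mod_cast hd
  set a := -A + (k : ℕ) * δ with ha
  set b := -A + ((k : ℕ) + 1 : ℕ) * δ with hb
  have hmem := grid_mem_Ico (a := -A) hδ k
  have hab : a < b := hmem.2
  set y : (Fin n → Fin d × Bool) → Fin d → ℝ :=
    fun ω => x + (walk (-A) δ ξ ω a - walk (-A) δ ξ ω t) with hy
  have h1 : ∑ ω : Fin n → Fin d × Bool, heatH q t g b
      (x + (walk (-A) δ ξ ω b - walk (-A) δ ξ ω t)) =
      ∑ ω, (∑ r, heatH q t g b (y ω + ξ k r)) / (2 * d) := by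
    have e1 := sum_sum_update k fun ω : Fin n → Fin d × Bool => heatH q t g b (y ω + ξ k (ω k))
    have e2 (ω : Fin n → Fin d × Bool) (r : Fin d × Bool) : y (Function.update ω k r) = y ω := by
      simp only [hy]
      rw [walk_update ξ ω k r hab, walk_update ξ ω k r (ht.trans hab)]
    simp only [e2, Function.update_self, Fintype.card_prod, Fintype.card_fin, Fintype.card_bool]
      at e1
    rw [← Finset.sum_div, e1]
    push_cast
    rw [mul_comm (d : ℝ) 2, mul_div_cancel_left₀ _ (by positivity)]
    apply Finset.sum_congr rfl
    intro ω _
    have hw := walk_succ (a := -A) hδ ξ ω k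
    rw [← ha, ← hb] at hw
    rw [hw]
    congr 1
    change x + (walk (-A) δ ξ ω a + ξ k (ω k) - walk (-A) δ ξ ω t) =
      x + (walk (-A) δ ξ ω a - walk (-A) δ ξ ω t) + ξ k (ω k)
    generalize walk (-A) δ ξ ω a = w₁
    generalize walk (-A) δ ξ ω t = w₂
    abel
  have h2 (ω : Fin n → Fin d × Bool) :
      ∫ s in a..b, heatF c q t g s (x + (walk (-A) δ ξ ω s - walk (-A) δ ξ ω t)) =
      ∫ s in a..b, heatF c q t g s (y ω) := by
    rw [intervalIntegral.integral_of_le hab.le, intervalIntegral.integral_of_le hab.le,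
      ← integral_Ico_eq_integral_Ioc, ← integral_Ico_eq_integral_Ioc]
    apply setIntegral_congr_fun measurableSet_Ico
    intro s hs
    simp only [hy]
    rw [walk_eq_of_mem hδ ξ ω hs]
  rw [h1]
  simp only [h2]
  rw [← Finset.sum_sub_distrib, ← Finset.sum_sub_distrib]
  refine (Finset.abs_sum_le_sum_abs _ _).trans ((Finset.sum_le_sum fun ω _ => h (y ω)).trans_eq ?_)
  rw [Finset.sum_const, Finset.card_univ, nsmul_eq_mul]

theorem exists_walks {q : Fin d → ℝ} (hq : q ≠ 0) {g : ℝ × (Fin d → ℝ) → ℝ}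
    (hg : ContDiff ℝ (⊤ : ℕ∞) g) (hc : HasCompactSupport g)
    {c : ℝ → Matrix (Fin d) (Fin d) ℝ} (hcm : ∀ i j, Measurable fun t => c t i j)
    (hcs : ∀ t, (c t).IsSymm)
    (hcq : ∀ t (ξ : Fin d → ℝ), (∑ i, q i * ξ i) ^ 2 ≤ ∑ i, ∑ j, c t i j * ξ i * ξ j)
    {A K : ℝ} (hA0 : 0 < A) (hK : ∀ t ∈ Icc (-A) A, ∀ i j, |c t i j| ≤ K)
    (hA : ∀ w ∈ tsupport g, w.1 ∈ Ioo (-A) A) :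
    ∃ M, 0 ≤ M ∧ ∀ n : ℕ, 0 < n → ∃ X : (Fin n → Fin d × Bool) → ℝ → Fin d → ℝ,
      (∀ ω, Measurable (X ω)) ∧ ∀ t ∈ Ioo (-A) A, ∀ x,
        |(∑ ω, ∫ s in (t + 2 * A / n)..(t + 2 * A), heatF c q t g s (x + (X ω s - X ω t))) /
          Fintype.card (Fin n → Fin d × Bool) + g (t, x)| ≤
            M * (√(2 * A / n) + 2 * A / n) := by
  have hd : 0 < d := by
    rcases Nat.eq_zero_or_pos d with rfl | h
    · exact absurd (Subsingleton.elim _ _) hq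
    · exact h
  obtain ⟨K', hK'0, hK'⟩ : ∃ K', 0 ≤ K' ∧ ∀ t ∈ Icc (-A) A, ∀ i j, |c t i j - q i * q j| ≤ K' := by
    refine ⟨K + ‖q‖ * ‖q‖, ?_, fun t ht i j => ?_⟩
    · have := (abs_nonneg _).trans (hK 0 ⟨by linarith, hA0.le⟩ ⟨0, hd⟩ ⟨0, hd⟩)
      positivity
    · refine (abs_sub _ _).trans (add_le_add (hK t ht i j) ?_)
      rw [abs_mul]
      gcongr
      · exact norm_le_pi_norm q i
      · exact norm_le_pi_norm q j
  obtain ⟨M₁, hM₁0, hM₁⟩ := exists_cell hq hg hc hcm hcs hcq hK'0 hK'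
  obtain ⟨L, hL0, hL⟩ := exists_heatF_bound q hK hg hc hA
  obtain ⟨M₂, hM₂0, hM₂⟩ := exists_heatH_sub_le q hg hc
  refine ⟨2 * A * M₁ + L + M₂ * (1 + √(2 * d * K')), by positivity, fun n hn => ?_⟩
  have hn' : (0 : ℝ) < n := by exact_mod_cast hn
  set δ : ℝ := 2 * A / n with hδd
  have hδ : 0 < δ := by positivity
  have hnδ : n * δ = 2 * A := by rw [hδd]; field_simp
  have hcell (k : Fin n) : ∃ ξ : Fin d × Bool → Fin d → ℝ, (∀ r, ‖ξ r‖ ≤ √(2 * d * K') * √δ) ∧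
      ∀ t, t < -A + (k : ℕ) * δ → ∀ y,
        |(∑ r, heatH q t g (-A + ((k : ℕ) + 1 : ℕ) * δ) (y + ξ r)) / (2 * d) -
          heatH q t g (-A + (k : ℕ) * δ) y - ∫ s in (-A + (k : ℕ) * δ)..
            (-A + ((k : ℕ) + 1 : ℕ) * δ), heatF c q t g s y| ≤ M₁ * (√δ ^ 3 + δ ^ 2) := by
    have hk : (((k : ℕ) + 1 : ℕ) : ℝ) ≤ n := by exact_mod_cast k.2
    have h1 := mul_le_mul_of_nonneg_right hk hδ.le
    have h0 : 0 ≤ ((k : ℕ) : ℝ) * δ := by positivity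
    have e : -A + ((k : ℕ) + 1 : ℕ) * δ - (-A + (k : ℕ) * δ) = δ := by push_cast; ring
    obtain ⟨ξ, hξ, hξ'⟩ := hM₁ (-A + (k : ℕ) * δ) (-A + ((k : ℕ) + 1 : ℕ) * δ) (by linarith)
      (by push_cast; linarith) (by linarith)
    rw [e] at hξ hξ'
    refine ⟨ξ, fun r => (hξ r).trans_eq ?_, hξ'⟩
    rw [← mul_assoc, Real.sqrt_mul (by positivity)]
  choose ξ hξn hξ using hcell
  refine ⟨walk (-A) δ ξ, measurable_walk _ _ _, fun t ht x => ?_⟩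
  -- the cell of `t`
  obtain ⟨m, hm⟩ : ∃ m : ℕ, t ∈ Ico (-A + m * δ) (-A + (m + 1 : ℕ) * δ) := by
    refine ⟨⌊(t + A) / δ⌋₊, ?_, ?_⟩
    · have := Nat.floor_le (a := (t + A) / δ) (div_nonneg (by linarith [ht.1]) hδ.le)
      rw [le_div_iff₀ hδ] at this
      linarith
    · have := Nat.lt_floor_add_one ((t + A) / δ)
      rw [div_lt_iff₀ hδ] at this
      push_cast
      linarith
  have hmn : m + 1 ≤ n := by
    have h1 : (m : ℝ) * δ < n * δ := by linarith [hm.1, ht.2]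
    exact_mod_cast lt_of_mul_lt_mul_right h1 hδ.le
  have hendn : -A + n * δ = A := by linarith
  have gridlt {k : ℕ} (hk : m + 1 ≤ k) : t < -A + k * δ := by
    have h1 : ((m + 1 : ℕ) : ℝ) ≤ k := by exact_mod_cast hk
    have := mul_le_mul_of_nonneg_right h1 hδ.le
    linarith [hm.2]
  set W : ℝ := ((Fintype.card (Fin n → Fin d × Bool) : ℕ) : ℝ) with hW
  have hW0 : 0 < W := by
    have : Nonempty (Fin d × Bool) := ⟨(⟨0, hd⟩, true)⟩
    rw [hW]
    exact_mod_cast Fintype.card_pos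
  have hYm (ω : Fin n → Fin d × Bool) : Measurable fun s => x + (walk (-A) δ ξ ω s - walk (-A) δ ξ ω t) :=
    ((measurable_walk _ _ _ _).sub_const _).const_add _
  set I : (Fin n → Fin d × Bool) → ℝ → ℝ → ℝ := fun ω a b =>
    ∫ s in a..b, heatF c q t g s (x + (walk (-A) δ ξ ω s - walk (-A) δ ξ ω t)) with hI
  set Φ : ℕ → ℝ := fun k => ∑ ω : Fin n → Fin d × Bool, heatH q t g (-A + k * δ)
    (x + (walk (-A) δ ξ ω (-A + k * δ) - walk (-A) δ ξ ω t)) with hΦ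
  have h_int (ω : Fin n → Fin d × Bool) {a b : ℝ} (ha : t < a) (hb : t < b) :=
    intervalIntegrable_heatF hcm hg hL (hYm ω) ht.1.le ha hb
  have htele : ∀ k, m + 1 ≤ k → k ≤ n →
      |Φ k - Φ (m + 1) - ∑ ω, I ω (-A + (m + 1 : ℕ) * δ) (-A + k * δ)| ≤
        k * (W * (M₁ * (√δ ^ 3 + δ ^ 2))) := by
    intro k hk
    induction k, hk using Nat.le_induction with
    | base =>
      intro _
      simp only [hI, intervalIntegral.integral_same, Finset.sum_const_zero, sub_self, abs_zero]
      positivity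
    | succ k hk ih =>
      intro hkn
      have h1 := ih (by omega)
      have h2 := abs_walk_step_le (x := x) hδ hd ξ ⟨k, hkn⟩ (gridlt hk) (hξ ⟨k, hkn⟩ t (gridlt hk))
      have h3 : ∑ ω, I ω (-A + (m + 1 : ℕ) * δ) (-A + (k + 1 : ℕ) * δ) =
          ∑ ω, I ω (-A + (m + 1 : ℕ) * δ) (-A + k * δ) +
          ∑ ω, I ω (-A + k * δ) (-A + (k + 1 : ℕ) * δ) := by
        rw [← Finset.sum_add_distrib]
        apply Finset.sum_congr rfl
        intro ω _
        exact (intervalIntegral.integral_add_adjacent_intervals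
          (h_int ω (gridlt le_rfl) (gridlt hk)) (h_int ω (gridlt hk) (gridlt (by omega)))).symm
      rw [h3]
      have e : Φ (k + 1) - Φ (m + 1) - (∑ ω, I ω (-A + (m + 1 : ℕ) * δ) (-A + k * δ) +
          ∑ ω, I ω (-A + k * δ) (-A + (k + 1 : ℕ) * δ)) =
          (Φ k - Φ (m + 1) - ∑ ω, I ω (-A + (m + 1 : ℕ) * δ) (-A + k * δ)) +
          (Φ (k + 1) - Φ k - ∑ ω, I ω (-A + k * δ) (-A + (k + 1 : ℕ) * δ)) := by ring
      rw [e]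
      refine (abs_add_le _ _).trans ((add_le_add h1 h2).trans_eq ?_)
      push_cast
      ring
  have hΦn : Φ n = 0 := by
    simp only [hΦ, hendn]
    apply Finset.sum_eq_zero
    intro ω _
    exact heatH_eq_zero (fun y => image_eq_zero_of_notMem_tsupport fun h =>
      lt_irrefl _ (hA _ h).2) _
  have hstart : |Φ (m + 1) - W * g (t, x)| ≤
      W * (M₂ * (√δ + δ + √(2 * d * K') * √δ)) := by
    have e : Φ (m + 1) - W * g (t, x) = ∑ ω : Fin n → Fin d × Bool, (heatH q t g (-A + (m + 1 : ℕ) * δ)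
        (x + (walk (-A) δ ξ ω (-A + (m + 1 : ℕ) * δ) - walk (-A) δ ξ ω t)) - g (t, x)) := by
      rw [Finset.sum_sub_distrib, Finset.sum_const, Finset.card_univ, nsmul_eq_mul]
    rw [e]
    refine (Finset.abs_sum_le_sum_abs _ _).trans ((Finset.sum_le_sum (g := fun _ =>
      M₂ * (√δ + δ + √(2 * d * K') * √δ)) fun ω _ => ?_).trans_eq ?_)
    · refine (hM₂ t _ hm.2 x _).trans ?_
      have h1 : -A + (m + 1 : ℕ) * δ - t ≤ δ := by
        have := hm.1
        push_cast
        linarith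
      have h2 : ‖x + (walk (-A) δ ξ ω (-A + (m + 1 : ℕ) * δ) - walk (-A) δ ξ ω t) - x‖ ≤
          √(2 * d * K') * √δ := by
        rw [add_sub_cancel_left, walk_eq_of_mem hδ ξ ω hm]
        have := walk_succ (a := -A) hδ ξ ω ⟨m, hmn⟩
        simp only at this
        rw [this, add_sub_cancel_left]
        exact hξn _ _
      gcongr
    · rw [Finset.sum_const, Finset.card_univ, nsmul_eq_mul]
  have hsplit : |∑ ω, I ω (t + δ) (t + 2 * A) - ∑ ω, I ω (-A + (m + 1 : ℕ) * δ) (-A + n * δ)| ≤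
      W * (L * δ) := by
    rw [← Finset.sum_sub_distrib]
    refine (Finset.abs_sum_le_sum_abs _ _).trans ((Finset.sum_le_sum (g := fun _ => L * δ)
      fun ω _ => ?_).trans_eq ?_)
    · have hz : I ω A (t + 2 * A) = 0 := by
        simp only [hI]
        rw [intervalIntegral.integral_congr (g := fun _ => 0)]
        · simp
        · intro s hs
          rw [uIcc_of_le (by linarith [ht.1])] at hs
          exact heatF_eq_zero hA hs.1 _
      have e1 : I ω (t + δ) (t + 2 * A) = I ω (t + δ) (-A + (m + 1 : ℕ) * δ) +
          I ω (-A + (m + 1 : ℕ) * δ) A + I ω A (t + 2 * A) := by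
        simp only [hI]
        rw [intervalIntegral.integral_add_adjacent_intervals (h_int ω (by linarith) hm.2)
          (h_int ω hm.2 ht.2), intervalIntegral.integral_add_adjacent_intervals
          (h_int ω (by linarith) ht.2) (h_int ω ht.2 (by linarith))]
      rw [hendn, e1, hz, add_zero, add_sub_cancel_right]
      have h1 := intervalIntegral.norm_integral_le_of_norm_le_const (a := t + δ)
        (b := -A + (m + 1 : ℕ) * δ) (C := L)
        (f := fun s => heatF c q t g s (x + (walk (-A) δ ξ ω s - walk (-A) δ ξ ω t)))
        (fun s hs => by
          have hts : t < s := (lt_min (by linarith) hm.2).trans hs.1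
          exact hL t s hts (by linarith [ht.1]) _)
      refine h1.trans ?_
      gcongr
      rw [abs_le]
      have := hm.1
      have := hm.2
      push_cast at *
      constructor <;> linarith
    · rw [Finset.sum_const, Finset.card_univ, nsmul_eq_mul]
  have htn := htele n hmn le_rfl
  rw [hΦn] at htn
  have e : (∑ ω, I ω (t + δ) (t + 2 * A)) / W + g (t, x) =
      ((∑ ω, I ω (t + δ) (t + 2 * A) - ∑ ω, I ω (-A + (m + 1 : ℕ) * δ) (-A + n * δ)) -
      (0 - Φ (m + 1) - ∑ ω, I ω (-A + (m + 1 : ℕ) * δ) (-A + n * δ)) -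
      (Φ (m + 1) - W * g (t, x))) / W := by
    field_simp
    ring
  rw [e, abs_div, abs_of_pos hW0, div_le_iff₀ hW0]
  refine (abs_sub _ _).trans ((add_le_add ((abs_sub _ _).trans (add_le_add hsplit htn))
    hstart).trans ?_)
  have hs2 : √δ ^ 2 = δ := Real.sq_sqrt hδ.le
  have hs3 : √δ ^ 3 = √δ * δ := by rw [pow_succ, hs2]; ring
  have e2 : n * (W * (M₁ * (√δ ^ 3 + δ ^ 2))) = W * (2 * A * M₁ * (√δ + δ)) := by
    rw [← hnδ, hs3]; ring
  rw [e2]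
  have h0 := Real.sqrt_nonneg δ
  have h1 : 0 ≤ W * (M₂ * √(2 * d * K') * δ) := by positivity
  have h2 : 0 ≤ W * (L * √δ) := by positivity
  nlinarith

end WalkApproximation

section Generator

variable {d : ℕ}

/-- The parabolic operator `∂ₜ + ∑ cᵢⱼ(t) ∂²ᵢⱼ`. -/
noncomputable def parab (c : ℝ → Matrix (Fin d) (Fin d) ℝ) (u : ℝ × (Fin d → ℝ) → ℝ)
    (w : ℝ × (Fin d → ℝ)) : ℝ :=
  dd (1, 0) u w + ∑ i, ∑ j, c w.1 i j * dij i j u w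

theorem measurable_parab {c : ℝ → Matrix (Fin d) (Fin d) ℝ}
    (hcm : ∀ i j, Measurable fun t => c t i j) {u : ℝ × (Fin d → ℝ) → ℝ}
    (hu : ContDiff ℝ (⊤ : ℕ∞) u) : Measurable (parab c u) := by
  refine (contDiff_dd _ hu).continuous.measurable.add ?_
  refine Finset.measurable_fun_sum _ fun i _ => Finset.measurable_fun_sum _ fun j _ => ?_
  exact ((hcm i j).comp measurable_fst).mul (contDiff_dij i j hu).continuous.measurable

theorem tsupport_dij_subset (i j : Fin d) (u : ℝ × (Fin d → ℝ) → ℝ) :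
    tsupport (dij i j u) ⊆ tsupport u :=
  (tsupport_dd_subset _ _).trans (tsupport_dd_subset _ _)

theorem parab_eq_zero (c : ℝ → Matrix (Fin d) (Fin d) ℝ) {u : ℝ × (Fin d → ℝ) → ℝ}
    {w : ℝ × (Fin d → ℝ)} (hw : w ∉ tsupport u) : parab c u w = 0 := by
  unfold parab
  rw [image_eq_zero_of_notMem_tsupport fun h => hw (tsupport_dd_subset _ _ h), zero_add]
  refine Finset.sum_eq_zero fun i _ => Finset.sum_eq_zero fun j _ => ?_
  have h0 : dij i j u w = 0 :=
    image_eq_zero_of_notMem_tsupport fun h => hw (tsupport_dij_subset _ _ _ h)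
  rw [h0, mul_zero]

theorem exists_parab_bound {c : ℝ → Matrix (Fin d) (Fin d) ℝ} {A K : ℝ}
    (hK : ∀ t ∈ Icc (-A) A, ∀ i j, |c t i j| ≤ K)
    {u : ℝ × (Fin d → ℝ) → ℝ} (hu : ContDiff ℝ (⊤ : ℕ∞) u) (hc : HasCompactSupport u)
    (hA : ∀ w ∈ tsupport u, w.1 ∈ Ioo (-A) A) :
    ∃ M, ∀ w, |parab c u w| ≤ M := by
  obtain ⟨M, hM⟩ := exists_bound_of_hasCompactSupport (contDiff_dd (1, 0) hu).continuous
    (hasCompactSupport_dd _ hc)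
  choose M' hM' using fun i j => exists_bound_of_hasCompactSupport (contDiff_dij i j hu).continuous
    (hasCompactSupport_dij i j hc)
  have hM0 : 0 ≤ M := (abs_nonneg _).trans (hM 0)
  have hM0' (i j) : 0 ≤ M' i j := (abs_nonneg _).trans (hM' i j 0)
  have hS : 0 ≤ ∑ i, ∑ j, |K| * M' i j :=
    Finset.sum_nonneg fun i _ => Finset.sum_nonneg fun j _ => mul_nonneg (abs_nonneg _) (hM0' i j)
  refine ⟨M + ∑ i, ∑ j, |K| * M' i j, fun w => ?_⟩
  by_cases hw : w ∈ tsupport u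
  · refine (abs_add_le _ _).trans (add_le_add (hM w) ?_)
    refine (Finset.abs_sum_le_sum_abs _ _).trans (Finset.sum_le_sum fun i _ => ?_)
    refine (Finset.abs_sum_le_sum_abs _ _).trans (Finset.sum_le_sum fun j _ => ?_)
    rw [abs_mul]
    exact mul_le_mul ((hK _ (Ioo_subset_Icc_self (hA w hw)) i j).trans (le_abs_self _)) (hM' i j w)
      (abs_nonneg _) (abs_nonneg _)
  · rw [parab_eq_zero c hw, abs_zero]
    positivity

theorem integrable_parab {c : ℝ → Matrix (Fin d) (Fin d) ℝ}
    (hcm : ∀ i j, Measurable fun t => c t i j) {u : ℝ × (Fin d → ℝ) → ℝ}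
    (hu : ContDiff ℝ (⊤ : ℕ∞) u) (hc : HasCompactSupport u)
    (hb : ∃ M, ∀ w, |parab c u w| ≤ M) : Integrable (parab c u) := by
  obtain ⟨M, hM⟩ := hb
  have h : IntegrableOn (parab c u) (tsupport u) :=
    Measure.integrableOn_of_bounded (M := M) hc.isCompact.measure_lt_top.ne
      (measurable_parab hcm hu).aestronglyMeasurable (ae_of_all _ hM)
  exact (integrableOn_iff_integrable_of_support_subset fun w hw => by
    by_contra hn
    exact hw (parab_eq_zero c hn)).1 h

/-- Pairing with the second derivative of the heat kernel moves `∂²_q` onto the function. -/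
theorem integral_hk_mul_slice {q : Fin d → ℝ} (hq : q ≠ 0) {f : ℝ × (Fin d → ℝ) → ℝ}
    (hf : ContDiff ℝ (⊤ : ℕ∞) f) (hc : HasCompactSupport f) {τ : ℝ} (hτ : 0 < τ) (s : ℝ)
    (y : Fin d → ℝ) :
    ∫ z, hk τ z * f (s, y + z • q) =
      gav τ fun z => dd (sp q) (dd (sp q) f) (s, y + z • q) := by
  have hd {g : ℝ × (Fin d → ℝ) → ℝ} (hg : ContDiff ℝ (⊤ : ℕ∞) g) (z : ℝ) :
      HasDerivAt (fun z : ℝ => g (s, y + z • q)) (dd (sp q) g (s, y + z • q)) z := by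
    have h := hasDerivAt_line hg (sp q) (s, y) z
    simpa [sp] using h
  have hs {g : ℝ × (Fin d → ℝ) → ℝ} (hg : HasCompactSupport g) :
      HasCompactSupport fun z : ℝ => g (s, y + z • q) := by
    have h := hasCompactSupport_slice (hasCompactSupport_fib hq y hg) (0, 0) s
    simpa [fib] using h
  have h1 := contDiff_dd (sp q) hf
  have h2 := contDiff_dd (sp q) h1
  exact integral_hk_mul hτ (hd hf) (hd h1) (by have := h2.continuous; fun_prop) (hs hc)
    (hs (hasCompactSupport_dd _ hc)) (hs (hasCompactSupport_dd _ (hasCompactSupport_dd _ hc)))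

theorem integral_hk_mul_parab {q : Fin d → ℝ} (hq : q ≠ 0)
    (c : ℝ → Matrix (Fin d) (Fin d) ℝ) {u : ℝ × (Fin d → ℝ) → ℝ}
    (hu : ContDiff ℝ (⊤ : ℕ∞) u) (hc : HasCompactSupport u) {t s : ℝ} (hs : t < s)
    (y : Fin d → ℝ) :
    ∫ z, hk (s - t) z * parab c u (s, y + z • q) =
      heatF c q t (dd (sp q) (dd (sp q) u)) s y := by
  have hτ : 0 < s - t := sub_pos.2 hs
  have hi {f : ℝ × (Fin d → ℝ) → ℝ} (hf : Continuous f) (hfc : HasCompactSupport f) :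
      Integrable fun z : ℝ => hk (s - t) z * f (s, y + z • q) := by
    obtain ⟨h1, M, hM⟩ := bddCont_slice hf hfc q y s
    exact (integrable_hk hτ).mul_bdd (c := M) h1.aestronglyMeasurable (ae_of_all _ hM)
  have e1 : dd (sp q) (dd (sp q) (dd (1, 0) u)) = dd (1, 0) (dd (sp q) (dd (sp q) u)) := by
    rw [dd_comm (sp q) (1, 0) hu, dd_comm (sp q) (1, 0) (contDiff_dd _ hu)]
  have e2 (i j : Fin d) : dd (sp q) (dd (sp q) (dij i j u)) =
      dij i j (dd (sp q) (dd (sp q) u)) := by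
    have hq2 := contDiff_dd (sp q) hu
    unfold dij
    rw [dd_comm (sp q) _ (contDiff_dd _ hu), dd_comm (sp q) _ hu,
      dd_comm (sp q) _ (contDiff_dd _ hq2), dd_comm (sp q) _ hq2]
  have h1 := integral_hk_mul_slice hq (contDiff_dd (1, 0) hu) (hasCompactSupport_dd _ hc) hτ s y
  have h2 (i j : Fin d) :=
    integral_hk_mul_slice hq (contDiff_dij i j hu) (hasCompactSupport_dij i j hc) hτ s y
  have i2 (i j : Fin d) := hi (contDiff_dij i j hu).continuous (hasCompactSupport_dij i j hc)
  unfold heatF heatH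
  rw [← e1, ← h1]
  simp only [← e2, ← h2]
  simp only [← integral_const_mul]
  have i3 (i j : Fin d) := (i2 i j).const_mul (c s i j)
  have i4 (i : Fin d) := integrable_finsetSum Finset.univ fun j _ => i3 i j
  have i5 := integrable_finsetSum Finset.univ fun i _ => i4 i
  have e3 (i : Fin d) := integral_finsetSum Finset.univ fun j _ => i3 i j
  have e4 := integral_finsetSum Finset.univ fun i _ => i4 i
  simp only [← e3]
  rw [← e4, ← integral_add (hi (contDiff_dd (1, 0) hu).continuous (hasCompactSupport_dd _ hc)) i5]
  congr 1
  ext z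
  simp only [parab, mul_add, Finset.mul_sum, mul_left_comm]

theorem shiftOp_kern_parab {q : Fin d → ℝ} (hq : q ≠ 0)
    {c : ℝ → Matrix (Fin d) (Fin d) ℝ} (hcm : ∀ i j, Measurable fun t => c t i j)
    {u : ℝ × (Fin d → ℝ) → ℝ} (hu : ContDiff ℝ (⊤ : ℕ∞) u) (hc : HasCompactSupport u)
    (hb : ∃ M, ∀ w, |parab c u w| ≤ M) {X : ℝ → Fin d → ℝ} (hX : Measurable X) {ε N : ℝ}
    (hε : 0 < ε) (hN : ε ≤ N) (t : ℝ) (x : Fin d → ℝ) :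
    shiftOp (kern ε N) q X (parab c u) (t, x) =
      ∫ s in (t + ε)..(t + N),
        heatF c q t (dd (sp q) (dd (sp q) u)) s (x + (X s - X t)) := by
  obtain ⟨M, hM⟩ := hb
  have hm := measurable_parab hcm hu
  have h_int : Integrable fun y : ℝ × ℝ =>
      kern ε N y * parab c u (t + y.1, x + y.2 • q + (X (t + y.1) - X t)) :=
    (integrable_kern hε N).mul_bdd (c := M)
      (by fun_prop : Measurable fun y : ℝ × ℝ =>
        parab c u (t + y.1, x + y.2 • q + (X (t + y.1) - X t))).aestronglyMeasurable
      (ae_of_all _ fun y => hM _)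
  unfold shiftOp
  rw [Measure.volume_eq_prod] at h_int ⊢
  rw [integral_prod _ h_int, ← integral_sub_right_eq_self _ t,
    intervalIntegral.integral_of_le (by linarith),
    ← integral_Icc_eq_integral_Ioc, ← integral_indicator measurableSet_Icc]
  congr 1
  ext s
  unfold kern
  by_cases hs : s ∈ Icc (t + ε) (t + N)
  · have hs' : s - t ∈ Icc ε N := ⟨by linarith [hs.1], by linarith [hs.2]⟩
    simp only [indicator_of_mem hs, indicator_of_mem hs', add_sub_cancel]
    rw [← integral_hk_mul_parab hq c hu hc (by linarith [hs.1])]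
    congr 1
    ext z
    rw [add_right_comm]
  · have hs' : s - t ∉ Icc ε N := fun h => hs ⟨by linarith [h.1], by linarith [h.2]⟩
    simp only [indicator_of_notMem hs, indicator_of_notMem hs', zero_mul, integral_zero]

end Generator

section DirectionalEstimate

variable {d : ℕ}

theorem eLpNorm_average_le {α Ω : Type*} [MeasurableSpace α] {μ : Measure α} [Fintype Ω]
    [Nonempty Ω] {p : ℝ≥0∞} (hp : 1 ≤ p) {f : Ω → α → ℝ}
    (hf : ∀ ω, AEStronglyMeasurable (f ω) μ) {B : ℝ≥0∞} (hB : ∀ ω, eLpNorm (f ω) p μ ≤ B) :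
    eLpNorm (fun w => (∑ ω, f ω w) / Fintype.card Ω) p μ ≤ B := by
  have hc : (Fintype.card Ω : ℝ) ≠ 0 := by exact_mod_cast Fintype.card_ne_zero
  have e : (fun w => (∑ ω, f ω w) / Fintype.card Ω) =
      ((Fintype.card Ω : ℝ)⁻¹ • ∑ ω, f ω) := by
    ext w
    simp [div_eq_inv_mul]
  rw [e]
  refine eLpNorm_const_smul_le.trans ?_
  calc ‖(Fintype.card Ω : ℝ)⁻¹‖ₑ * eLpNorm (∑ ω, f ω) p μ
      ≤ ‖(Fintype.card Ω : ℝ)⁻¹‖ₑ * ∑ ω : Ω, B := by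
        gcongr
        exact (eLpNorm_sum_le (fun ω _ => hf ω) hp).trans (Finset.sum_le_sum fun ω _ => hB ω)
    _ = (‖(Fintype.card Ω : ℝ)⁻¹‖ₑ * (Fintype.card Ω : ℝ≥0∞)) * B := by
        rw [Finset.sum_const, Finset.card_univ, nsmul_eq_mul, mul_assoc]
    _ = B := by
        rw [enorm_inv hc, Real.enorm_natCast, ENNReal.inv_mul_cancel, one_mul]
        · exact_mod_cast Fintype.card_ne_zero
        · exact ENNReal.natCast_ne_top _

theorem eLpNorm_le_of_tendsto_on {α : Type*} [MeasurableSpace α] {μ : Measure α} {p : ℝ≥0∞}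
    {T : ℕ → α → ℝ} (hT : ∀ n, Measurable (T n)) {B : ℝ≥0∞} (hB : ∀ n, eLpNorm (T n) p μ ≤ B)
    {v : α → ℝ} {S : Set α} (hv : Function.support v ⊆ S)
    (hlim : ∀ᵐ w ∂(μ.restrict S), Tendsto (fun n => T n w) atTop (𝓝 ((-v) w))) :
    eLpNorm v p μ ≤ B := by
  calc eLpNorm v p μ = eLpNorm (-v) p (μ.restrict S) := by
        rw [eLpNorm_neg, eLpNorm_restrict_eq_of_support_subset hv]
    _ ≤ atTop.liminf fun n => eLpNorm (T n) p (μ.restrict S) :=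
        Lp.eLpNorm_lim_le_liminf_eLpNorm (fun n => (hT n).aestronglyMeasurable) _ hlim
    _ ≤ B := by
        refine liminf_le_of_frequently_le' (Frequently.of_forall fun n => ?_)
        exact (eLpNorm_mono_measure _ Measure.restrict_le_self).trans (hB n)

theorem exists_time_bound {u : ℝ × (Fin d → ℝ) → ℝ} (hc : HasCompactSupport u) :
    ∃ A, 0 < A ∧ ∀ w ∈ tsupport u, w.1 ∈ Ioo (-A) A := by
  obtain ⟨R, hR⟩ := hc.isCompact.isBounded.exists_norm_le
  refine ⟨|R| + 1, by positivity, fun w hw => ?_⟩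
  have h1 := (norm_fst_le w).trans (hR w hw)
  have h2 := abs_le.1 h1
  have := le_abs_self R
  exact ⟨by linarith [h2.1], by linarith [h2.2]⟩

/-- If `c(t)` dominates the rank one form `q ⊗ q`, then `∂²_q u` is controlled in `L^p` by
the parabolic operator, with a constant depending on `p` only. -/
theorem eLpNorm_dd_dd_le {p : ℝ} (hp : 1 < p) {C : ℝ≥0}
    (hC : ∀ ε N : ℝ, 0 < ε → ε ≤ N → HasLpBound (kern ε N) p C) (q : Fin d → ℝ)
    {c : ℝ → Matrix (Fin d) (Fin d) ℝ} (hcm : ∀ i j, Measurable fun t => c t i j)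
    (hcb : ∀ a b : ℝ, ∃ K : ℝ, ∀ t ∈ Icc a b, ∀ i j, |c t i j| ≤ K)
    (hcs : ∀ t, (c t).IsSymm)
    (hcq : ∀ t (ξ : Fin d → ℝ), (∑ i, q i * ξ i) ^ 2 ≤ ∑ i, ∑ j, c t i j * ξ i * ξ j)
    {u : ℝ × (Fin d → ℝ) → ℝ} (hu : ContDiff ℝ (⊤ : ℕ∞) u) (hc : HasCompactSupport u) :
    eLpNorm (dd (sp q) (dd (sp q) u)) (ENNReal.ofReal p) ≤
      C * eLpNorm (parab c u) (ENNReal.ofReal p) := by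
  by_cases hq : q = 0
  · have h0 : dd (sp q) (dd (sp q) u) = 0 := by
      ext w
      have : sp q = 0 := by rw [hq]; rfl
      rw [this]
      simp [dd]
    rw [h0, eLpNorm_zero]
    exact zero_le
  obtain ⟨i₀, -⟩ : ∃ i, q i ≠ 0 := by
    by_contra! h
    exact hq (funext h)
  have : Nonempty (Fin d × Bool) := ⟨(i₀, true)⟩
  obtain ⟨A, hA0, hA⟩ := exists_time_bound hc
  obtain ⟨K, hK⟩ := hcb (-A) A
  have hb := exists_parab_bound hK hu hc hA
  have hpm := measurable_parab hcm hu
  set v := dd (sp q) (dd (sp q) u) with hv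
  have hvA : ∀ w ∈ tsupport v, w.1 ∈ Ioo (-A) A := fun w hw =>
    hA w (tsupport_dd_subset _ _ (tsupport_dd_subset _ _ hw))
  obtain ⟨M, hM0, hM⟩ := exists_walks hq (contDiff_dd (sp q) (contDiff_dd (sp q) hu))
    (hasCompactSupport_dd _ (hasCompactSupport_dd _ hc)) hcm hcs hcq hA0 hK hvA
  choose X hXm hX using fun n : ℕ => hM (n + 1) n.succ_pos
  set δ : ℕ → ℝ := fun n => 2 * A / (n + 1 : ℕ) with hδ
  have hδ0 (n : ℕ) : 0 < δ n := by positivity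
  have hδA (n : ℕ) : δ n ≤ 2 * A :=
    div_le_self (by positivity) (by exact_mod_cast Nat.succ_le_succ (Nat.zero_le n))
  have hδlim : Tendsto δ atTop (𝓝 0) :=
    (tendsto_const_div_atTop_nhds_zero_nat (2 * A)).comp (tendsto_add_atTop_nat 1)
  set T : ℕ → ℝ × (Fin d → ℝ) → ℝ := fun n w =>
    (∑ ω, shiftOp (kern (δ n) (2 * A)) q (X n ω) (parab c u) w) /
      Fintype.card (Fin (n + 1) → Fin d × Bool) with hT
  have hSm (n : ℕ) (ω) : Measurable (shiftOp (kern (δ n) (2 * A)) q (X n ω) (parab c u)) :=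
    measurable_shiftOp (measurable_kern _ _) q (hXm n ω) hpm
  have hTm (n : ℕ) : Measurable (T n) :=
    (Finset.measurable_fun_sum _ fun ω _ => hSm n ω).div_const _
  have hTB (n : ℕ) : eLpNorm (T n) (ENNReal.ofReal p) ≤
      C * eLpNorm (parab c u) (ENNReal.ofReal p) :=
    eLpNorm_average_le (by simpa using hp.le) (fun ω => (hSm n ω).aestronglyMeasurable) fun ω =>
      (hC _ _ (hδ0 n) (hδA n)).shiftOp (measurable_kern _ _) (by linarith) hq (hXm n ω) hpm
        (integrable_parab hcm hu hc hb) hb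
  set S : Set (ℝ × (Fin d → ℝ)) := Prod.fst ⁻¹' Ioo (-A) A with hS
  have hSmeas : MeasurableSet S := measurableSet_Ioo.preimage measurable_fst
  have hlim : ∀ᵐ w ∂(volume.restrict S), Tendsto (fun n => T n w) atTop (𝓝 ((-v) w)) := by
    refine (ae_restrict_iff' hSmeas).2 (ae_of_all _ fun w hw => ?_)
    have hle (n : ℕ) : |T n w - (-v) w| ≤ M * (√(δ n) + δ n) := by
      have h := hX n w.1 hw w.2
      simp only [hT, Pi.neg_apply, sub_neg_eq_add]
      convert h using 6 with ω
      exact shiftOp_kern_parab hq hcm hu hc hb (hXm n ω) (hδ0 n) (hδA n) w.1 w.2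
    have hz : Tendsto (fun n => M * (√(δ n) + δ n)) atTop (𝓝 0) := by
      have h1 := (Real.continuous_sqrt.tendsto 0).comp hδlim
      rw [Real.sqrt_zero] at h1
      simpa using (h1.add hδlim).const_mul M
    rw [tendsto_iff_norm_sub_tendsto_zero]
    exact squeeze_zero (fun n => norm_nonneg _) hle hz
  exact eLpNorm_le_of_tendsto_on hTm hTB (fun w hw => hvA w (subset_tsupport _ hw)) hlim

end DirectionalEstimate

section Partial

variable {d : ℕ}

theorem ptime_eq {u : ℝ × (Fin d → ℝ) → ℝ} (hu : ContDiff ℝ (⊤ : ℕ∞) u) :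
    ptime u = dd (1, 0) u := by
  ext z
  have h := hasDerivAt_line hu (1, 0) (0, z.2) z.1
  simpa [ptime] using h.deriv

theorem pspace_eq (i : Fin d) {u : ℝ × (Fin d → ℝ) → ℝ} (hu : ContDiff ℝ (⊤ : ℕ∞) u) :
    pspace i u = dd (sp (Pi.single i 1)) u := by
  ext z
  have h1 : HasFDerivAt u (fderiv ℝ u z) (z.1, z.2) :=
    (hu.differentiable (by simp)).differentiableAt.hasFDerivAt
  have h2 := h1.comp z.2 (hasFDerivAt_prodMk_right (𝕜 := ℝ) z.1 z.2)
  have h3 : fderiv ℝ (fun y => u (z.1, y)) z.2 =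
      (fderiv ℝ u z).comp (ContinuousLinearMap.inr ℝ ℝ (Fin d → ℝ)) := h2.fderiv
  rw [pspace, h3]
  rfl

theorem pspace2_eq (i j : Fin d) {u : ℝ × (Fin d → ℝ) → ℝ} (hu : ContDiff ℝ (⊤ : ℕ∞) u) :
    pspace2 i j u = dij i j u := by
  rw [pspace2, pspace_eq j hu, pspace_eq i (contDiff_dd _ hu)]
  rfl

theorem dij_comm (i j : Fin d) {u : ℝ × (Fin d → ℝ) → ℝ} (hu : ContDiff ℝ (⊤ : ℕ∞) u) :
    dij i j u = dij j i u := dd_comm _ _ hu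

/-- Polarization of the Hessian. -/
theorem sum_dij_polarization (a : ℝ) (h k : Fin d → ℝ) {u : ℝ × (Fin d → ℝ) → ℝ}
    (hu : ContDiff ℝ (⊤ : ℕ∞) u) (w : ℝ × (Fin d → ℝ)) :
    a ^ 2 * ∑ i, ∑ j, dij i j u w * h i * k j =
      dd (sp fun i => a * ((h i + k i) / 2)) (dd (sp fun i => a * ((h i + k i) / 2)) u) w -
      dd (sp fun i => a * ((h i - k i) / 2)) (dd (sp fun i => a * ((h i - k i) / 2)) u) w := by
  have hsymm : ∑ i, ∑ j, dij i j u w * h i * k j = ∑ i, ∑ j, dij i j u w * k i * h j := by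
    rw [Finset.sum_comm]
    refine Finset.sum_congr rfl fun i _ => Finset.sum_congr rfl fun j _ => ?_
    rw [dij_comm j i hu]
    ring
  have h2 : ∑ i, ∑ j, dij i j u w * h i * k j =
      (∑ i, ∑ j, dij i j u w * h i * k j + ∑ i, ∑ j, dij i j u w * k i * h j) / 2 := by
    rw [← hsymm]; ring
  rw [dd_sp_dd_sp _ _ hu, dd_sp_dd_sp _ _ hu, h2]
  simp only [← Finset.sum_add_distrib, ← Finset.sum_sub_distrib, Finset.mul_sum, Finset.sum_div]
  refine Finset.sum_congr rfl fun i _ => Finset.sum_congr rfl fun j _ => ?_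
  ring

theorem sq_sum_mul_le_of_mulVec_eq {P : Matrix (Fin d) (Fin d) ℝ} (hP : P.IsSymm)
    {a : Fin d → ℝ} (ha : P.mulVec a = a) (ha1 : ∑ i, a i ^ 2 ≤ 1) (ξ : Fin d → ℝ) :
    (∑ i, a i * ξ i) ^ 2 ≤ ∑ i, P.mulVec ξ i ^ 2 := by
  have e : ∑ i, a i * ξ i = ∑ i, a i * P.mulVec ξ i := by
    change a ⬝ᵥ ξ = a ⬝ᵥ P.mulVec ξ
    rw [Matrix.dotProduct_mulVec, ← Matrix.mulVec_transpose, hP.eq, ha]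
  rw [e]
  refine (Finset.sum_mul_sq_le_sq_mul_sq _ _ _).trans ?_
  exact mul_le_of_le_one_left (Finset.sum_nonneg fun i _ => sq_nonneg _) ha1

theorem sum_half_add_sq_le {h k : Fin d → ℝ} (hh : ∑ l, h l ^ 2 = 1) (hk : ∑ l, k l ^ 2 = 1) :
    ∑ l, ((h l + k l) / 2) ^ 2 ≤ 1 ∧ ∑ l, ((h l - k l) / 2) ^ 2 ≤ 1 := by
  have e : ∑ l, (h l ^ 2 + k l ^ 2) / 2 = 1 := by
    rw [← Finset.sum_div, Finset.sum_add_distrib, hh, hk]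
    norm_num
  constructor <;> rw [← e] <;> refine Finset.sum_le_sum fun l _ => ?_
  · nlinarith [sq_nonneg (h l - k l)]
  · nlinarith [sq_nonneg (h l + k l)]

theorem eLpNorm_sum_dij_le {p : ℝ} (hp : 1 < p) {C : ℝ≥0}
    (hC : ∀ ε N : ℝ, 0 < ε → ε ≤ N → HasLpBound (kern ε N) p C)
    {lam : ℝ} (hlam : 0 < lam) {P : Matrix (Fin d) (Fin d) ℝ} (hP : P.IsSymm) (hPP : P * P = P)
    {c : ℝ → Matrix (Fin d) (Fin d) ℝ} (hcm : ∀ i j, Measurable fun t => c t i j)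
    (hcb : ∀ a b : ℝ, ∃ K : ℝ, ∀ t ∈ Icc a b, ∀ i j, |c t i j| ≤ K)
    (hcs : ∀ t, (c t).IsSymm)
    (hcP : ∀ t (ξ : Fin d → ℝ),
      lam * ∑ k, (P.mulVec ξ k) ^ 2 ≤ ∑ i, ∑ j, c t i j * ξ i * ξ j)
    {u : ℝ × (Fin d → ℝ) → ℝ} (hu : ContDiff ℝ (⊤ : ℕ∞) u) (hc : HasCompactSupport u)
    {h k : Fin d → ℝ} (hh : ∃ v, P.mulVec v = h) (hk : ∃ v, P.mulVec v = k)
    (hh1 : ∑ l, h l ^ 2 = 1) (hk1 : ∑ l, k l ^ 2 = 1) :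
    eLpNorm (fun z => ∑ i, ∑ j, dij i j u z * h i * k j) (ENNReal.ofReal p) ≤
      ENNReal.ofReal ((2 * C + 1) / lam) * eLpNorm (parab c u) (ENNReal.ofReal p) := by
  have hfix {h : Fin d → ℝ} (hh : ∃ v, P.mulVec v = h) : P.mulVec h = h := by
    obtain ⟨v, rfl⟩ := hh
    rw [Matrix.mulVec_mulVec, hPP]
  have hsq : √lam ^ 2 = lam := Real.sq_sqrt hlam.le
  have hbound {a : Fin d → ℝ} (ha : P.mulVec a = a) (ha1 : ∑ i, a i ^ 2 ≤ 1) :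
      eLpNorm (dd (sp fun i => √lam * a i) (dd (sp fun i => √lam * a i) u))
        (ENNReal.ofReal p) ≤ C * eLpNorm (parab c u) (ENNReal.ofReal p) := by
    refine eLpNorm_dd_dd_le hp hC _ hcm hcb hcs (fun t ξ => le_trans ?_ (hcP t ξ)) hu hc
    simp only [mul_assoc]
    rw [← Finset.mul_sum, mul_pow, hsq]
    exact mul_le_mul_of_nonneg_left (sq_sum_mul_le_of_mulVec_eq hP ha ha1 ξ) hlam.le
  have hadd : P.mulVec (fun i => (h i + k i) / 2) = fun i => (h i + k i) / 2 := by
    have e : (fun i => (h i + k i) / 2) = (1 / 2 : ℝ) • (h + k) := by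
      ext i; simp; ring
    rw [e, Matrix.mulVec_smul, Matrix.mulVec_add, hfix hh, hfix hk]
  have hsub : P.mulVec (fun i => (h i - k i) / 2) = fun i => (h i - k i) / 2 := by
    have e : (fun i => (h i - k i) / 2) = (1 / 2 : ℝ) • (h - k) := by
      ext i; simp; ring
    rw [e, Matrix.mulVec_smul, Matrix.mulVec_sub, hfix hh, hfix hk]
  obtain ⟨n1, n2⟩ := sum_half_add_sq_le hh1 hk1
  have b1 := hbound hadd n1
  have b2 := hbound hsub n2
  have hm (q : Fin d → ℝ) : AEStronglyMeasurable (dd (sp q) (dd (sp q) u)) :=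
    (contDiff_dd _ (contDiff_dd _ hu)).continuous.aestronglyMeasurable
  have e : (fun z => ∑ i, ∑ j, dij i j u z * h i * k j) =
      lam⁻¹ • (dd (sp fun i => √lam * ((h i + k i) / 2))
        (dd (sp fun i => √lam * ((h i + k i) / 2)) u) -
      dd (sp fun i => √lam * ((h i - k i) / 2))
        (dd (sp fun i => √lam * ((h i - k i) / 2)) u)) := by
    ext w
    have := sum_dij_polarization (√lam) h k hu w
    rw [hsq] at this
    rw [Pi.smul_apply, Pi.sub_apply, ← this, smul_eq_mul, inv_mul_cancel_left₀ hlam.ne']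
  rw [e]
  refine eLpNorm_const_smul_le.trans ?_
  set B := eLpNorm (parab c u) (ENNReal.ofReal p)
  calc _ ≤ ‖lam⁻¹‖ₑ * (C * B + C * B) := by
        gcongr
        exact (eLpNorm_sub_le (hm _) (hm _) (by simpa using hp.le)).trans (add_le_add b1 b2)
    _ = ENNReal.ofReal ((2 * C) / lam) * B := by
        rw [Real.enorm_eq_ofReal (by positivity), ← two_mul, ← mul_assoc, ← mul_assoc,
          div_eq_inv_mul, ENNReal.ofReal_mul (by positivity), ENNReal.ofReal_mul (by norm_num),
          ENNReal.ofReal_coe_nnreal]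
        simp [mul_assoc]
    _ ≤ ENNReal.ofReal ((2 * C + 1) / lam) * B := by
        gcongr
        linarith

end Partial

end ParabolicLp

/-- Remark: a-priori estimates under a general orthogonal projection.
Let `I₀` be an orthogonal projection of `ℝᵈ` (given by a symmetric idempotent matrix `P`)
of rank `r`.  There is `M₀ = M₀(d,p,r) > 0`: for every `λ > 0` and every Borel measurable,
locally bounded `c` with `c(t)` symmetric non-negative definite and
`⟨c(t)ξ,ξ⟩ ≥ λ |I₀ ξ|²`, every `u ∈ C_0^∞(ℝ^{d+1})` and all unit vectors `h, k` in the
range of `I₀`, `‖⟨D²ₓu h, k⟩‖_{L^p(ℝ^{d+1})} ≤ (M₀/λ) ‖∂ₜ u + L u‖_{L^p(ℝ^{d+1})}`. -/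
theorem apriori_Lp_estimate_projection
    (d : ℕ) (hd : 1 ≤ d) (p : ℝ) (hp : 1 < p) (r : ℕ) :
    ∃ M₀ : ℝ, 0 < M₀ ∧
      ∀ lam : ℝ, 0 < lam →
      ∀ P : Matrix (Fin d) (Fin d) ℝ,
        P.IsSymm → P * P = P → P.rank = r →
      ∀ c : ℝ → Matrix (Fin d) (Fin d) ℝ,
        (∀ i j, Measurable fun t => c t i j) →
        (∀ a b : ℝ, ∃ K : ℝ, ∀ t ∈ Set.Icc a b, ∀ i j, |c t i j| ≤ K) →
        (∀ t, (c t).IsSymm) →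
        (∀ t (ξ : Fin d → ℝ), 0 ≤ ∑ i, ∑ j, c t i j * ξ i * ξ j) →
        (∀ t (ξ : Fin d → ℝ),
          lam * ∑ k, (P.mulVec ξ k) ^ 2 ≤ ∑ i, ∑ j, c t i j * ξ i * ξ j) →
      ∀ u : ℝ × (Fin d → ℝ) → ℝ, ContDiff ℝ (⊤ : ℕ∞) u → HasCompactSupport u →
      ∀ h k : Fin d → ℝ,
        (∃ v, P.mulVec v = h) → (∃ v, P.mulVec v = k) →
        (∑ l, h l ^ 2 = 1) → (∑ l, k l ^ 2 = 1) →
        eLpNorm (fun z => ∑ i, ∑ j, pspace2 i j u z * h i * k j)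
            (ENNReal.ofReal p) volume
          ≤ ENNReal.ofReal (M₀ / lam) *
            eLpNorm (fun z => ptime u z + ∑ i', ∑ j', c z.1 i' j' * pspace2 i' j' u z)
              (ENNReal.ofReal p) volume := by
  obtain ⟨C, hC⟩ := ParabolicLp.exists_hasLpBound_kern hp
  refine ⟨2 * C + 1, by positivity, ?_⟩
  intro lam hlam P hP hPP _ c hcm hcb hcs _ hcP u hu hc h k hh hk hh1 hk1
  simp only [ParabolicLp.ptime_eq hu, ParabolicLp.pspace2_eq _ _ hu]
  exact ParabolicLp.eLpNorm_sum_dij_le hp hC hlam hP hPP hcm hcb hcs hcP hu hc hh hk hh1 hk1
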